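/- Positivity preservation for the linearized phonon transport equation with a nonnegative boundary source (used in the proof of Theorem A.1): Let η : (0,∞) → [0,1], let φ be a bounded nonnegative incoming datum at x = 0 (possibly zero), and let S : [0,T_max]×[−1,0)×(0,∞) → ℝ be nonnegative. Let G be a bounded solution of the linearized phonon transport equation with nonnegative initial data, G(t,0,μ,ω) = φ(t,μ,ω) for μ > 0, and G(t,1,μ,ω) = η(ω) G(t,1,−μ,ω) + S(t,μ,ω) for μ < 0. Then G(t,x,μ,ω) ≥ 0 at every point of the domain. -/

import Mathlib

open MeasureTheory Set

/-- `g*(ω) = ω² eʷ/(eʷ−1)²`. -/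
noncomputable def gstar (ω : ℝ) : ℝ := ω ^ 2 * Real.exp ω / (Real.exp ω - 1) ^ 2

/-- Bracket: `⟨f⟩ = ∫_{ω>0} ∫_{μ∈[−1,1]} f(μ,ω) dμ dω`. -/
noncomputable def bracket (f : ℝ → ℝ → ℝ) : ℝ :=
  ∫ ω in Ioi (0:ℝ), ∫ μ in Icc (-1:ℝ) 1, f μ ω

/-- `⟨ω g*⟩ = 2 ∫_0^∞ ω g*(ω) dω`. -/
noncomputable def wgstar : ℝ := 2 * ∫ ω in Ioi (0:ℝ), ω * gstar ω

/-- Normalized Maxwellian `M(ω) = ω g*(ω)/⟨ω g*⟩`. -/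
noncomputable def Mw (ω : ℝ) : ℝ := ω * gstar ω / wgstar

/-- Linearized BGK collision operator `(𝓛g)(μ,ω) = −ω g(μ,ω) + M(ω) ⟨ω g⟩`. -/
noncomputable def coll (g : ℝ → ℝ → ℝ) (μ ω : ℝ) : ℝ :=
  -(ω * g μ ω) + Mw ω * bracket (fun μ' ω' => ω' * g μ' ω')

/-- Integrability of `f(μ,ω)` sufficient for the iterated bracket to be finite. -/
def BracketIntegrable (f : ℝ → ℝ → ℝ) : Prop :=
  (∀ ω ∈ Ioi (0:ℝ), IntegrableOn (fun μ => f μ ω) (Icc (-1:ℝ) 1)) ∧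
  IntegrableOn (fun ω => ∫ μ in Icc (-1:ℝ) 1, f μ ω) (Ioi (0:ℝ))

/-- The forward linearized phonon transport equation
`∂_t g + μ ω ∂_x g = −ω g + M(ω)⟨ω g⟩(t,x)` on `[0,T]×[0,1]×[−1,1]×(0,∞)`,
together with differentiability of the solution in `t` and `x`. -/
def SatisfiesPTE (Tmax : ℝ) (g : ℝ → ℝ → ℝ → ℝ → ℝ) : Prop :=
  ∀ t ∈ Icc (0:ℝ) Tmax, ∀ x ∈ Icc (0:ℝ) 1, ∀ μ ∈ Icc (-1:ℝ) 1, ∀ ω ∈ Ioi (0:ℝ),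
    DifferentiableAt ℝ (fun s => g s x μ ω) t ∧
    DifferentiableAt ℝ (fun y => g t y μ ω) x ∧
    deriv (fun s => g s x μ ω) t + μ * ω * deriv (fun y => g t y μ ω) x
      = coll (fun μ' ω' => g t x μ' ω') μ ω

/-- The adjoint equation `∂_t h + μ ω ∂_x h = ω h − M(ω)⟨ω h⟩ = −𝓛h`. -/
def SatisfiesAdjointPTE (Tmax : ℝ) (h : ℝ → ℝ → ℝ → ℝ → ℝ) : Prop :=
  ∀ t ∈ Icc (0:ℝ) Tmax, ∀ x ∈ Icc (0:ℝ) 1, ∀ μ ∈ Icc (-1:ℝ) 1, ∀ ω ∈ Ioi (0:ℝ),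
    DifferentiableAt ℝ (fun s => h s x μ ω) t ∧
    DifferentiableAt ℝ (fun y => h t y μ ω) x ∧
    deriv (fun s => h s x μ ω) t + μ * ω * deriv (fun y => h t y μ ω) x
      = -(coll (fun μ' ω' => h t x μ' ω') μ ω)

/-- Boundedness of a function of `(t,x,μ,ω)`. -/
def BoundedFn (g : ℝ → ℝ → ℝ → ℝ → ℝ) : Prop := ∃ B, ∀ t x μ ω, |g t x μ ω| ≤ B

/-- `ω g(t,x,·,·)` is integrable in `(μ,ω)` at every point of the domain, so
that `⟨ω g⟩(t,x)` is finite. -/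
def BracketIntegrableSol (Tmax : ℝ) (g : ℝ → ℝ → ℝ → ℝ → ℝ) : Prop :=
  ∀ t ∈ Icc (0:ℝ) Tmax, ∀ x ∈ Icc (0:ℝ) 1,
    BracketIntegrable (fun μ ω => ω * g t x μ ω)

/-- `g` is a bounded-domain solution of the forward problem with reflection
coefficient `η` and incoming datum `φ`: the PDE, zero initial data, incoming
boundary condition at `x = 0` for `μ > 0`, and reflective boundary condition
at `x = 1` for `μ < 0`. -/
def IsForwardSolution (Tmax : ℝ) (η : ℝ → ℝ) (φ : ℝ → ℝ → ℝ → ℝ)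
    (g : ℝ → ℝ → ℝ → ℝ → ℝ) : Prop :=
  SatisfiesPTE Tmax g ∧
  (∀ x ∈ Icc (0:ℝ) 1, ∀ μ ∈ Icc (-1:ℝ) 1, ∀ ω ∈ Ioi (0:ℝ), g 0 x μ ω = 0) ∧
  (∀ t ∈ Icc (0:ℝ) Tmax, ∀ μ ∈ Ioc (0:ℝ) 1, ∀ ω ∈ Ioi (0:ℝ), g t 0 μ ω = φ t μ ω) ∧
  (∀ t ∈ Icc (0:ℝ) Tmax, ∀ μ ∈ Ico (-1:ℝ) 0, ∀ ω ∈ Ioi (0:ℝ), g t 1 μ ω = η ω * g t 1 (-μ) ω)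

/-- `h` is a bounded-domain solution of the adjoint problem with reflection
coefficient `η` and measurement profile `ψ`: the adjoint PDE, zero final data
at `t = Tmax`, boundary condition `h(t,0,μ,ω) = ψ(t) g*(ω)/μ` for `μ < 0`,
and reflective boundary condition at `x = 1` for `μ > 0`. -/
def IsAdjointSolution (Tmax : ℝ) (η : ℝ → ℝ) (ψ : ℝ → ℝ)
    (h : ℝ → ℝ → ℝ → ℝ → ℝ) : Prop :=
  SatisfiesAdjointPTE Tmax h ∧
  (∀ x ∈ Icc (0:ℝ) 1, ∀ μ ∈ Icc (-1:ℝ) 1, ∀ ω ∈ Ioi (0:ℝ), h Tmax x μ ω = 0) ∧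
  (∀ t ∈ Icc (0:ℝ) Tmax, ∀ μ ∈ Ico (-1:ℝ) 0, ∀ ω ∈ Ioi (0:ℝ), h t 0 μ ω = ψ t * gstar ω / μ) ∧
  (∀ t ∈ Icc (0:ℝ) Tmax, ∀ μ ∈ Ioc (0:ℝ) 1, ∀ ω ∈ Ioi (0:ℝ), h t 1 μ ω = η ω * h t 1 (-μ) ω)

open Filter Topology

/-- A bounded, separately continuous function of two real variables. -/
structure SepBdd (f : ℝ → ℝ → ℝ) : Prop where
  contL : ∀ x, Continuous fun t => f t x
  contR : ∀ t, Continuous fun x => f t x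
  bdd : ∃ C, ∀ t x, |f t x| ≤ C

/-- The primitive in the second variable. -/
noncomputable def primX (f : ℝ → ℝ → ℝ) (t x : ℝ) : ℝ := ∫ y in (0:ℝ)..x, f t y

/-- The primitive in the first variable. -/
noncomputable def primT (f : ℝ → ℝ → ℝ) (t x : ℝ) : ℝ := ∫ s in (0:ℝ)..t, f s x

/-- The rectangular increment. -/
def rectInc (H : ℝ → ℝ → ℝ) (t₁ t₂ x₁ x₂ : ℝ) : ℝ := H t₂ x₂ - H t₁ x₂ - H t₂ x₁ + H t₁ x₁

lemma SepBdd.swap {f : ℝ → ℝ → ℝ} (hf : SepBdd f) : SepBdd (fun x t => f t x) :=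
  ⟨hf.contR, hf.contL, by obtain ⟨C, hC⟩ := hf.bdd; exact ⟨C, fun t x => hC x t⟩⟩

lemma SepBdd.intervalIntegrableX {f : ℝ → ℝ → ℝ} (hf : SepBdd f) (t a b : ℝ) :
    IntervalIntegrable (fun x => f t x) volume a b := (hf.contR t).intervalIntegrable _ _

lemma SepBdd.intervalIntegrableT {f : ℝ → ℝ → ℝ} (hf : SepBdd f) (x a b : ℝ) :
    IntervalIntegrable (fun t => f t x) volume a b := (hf.contL x).intervalIntegrable _ _

lemma primX_sub {f : ℝ → ℝ → ℝ} (hf : SepBdd f) (t a b : ℝ) :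
    primX f t b - primX f t a = ∫ y in a..b, f t y :=
  intervalIntegral.integral_interval_sub_left (hf.intervalIntegrableX _ _ _)
    (hf.intervalIntegrableX _ _ _)

lemma primT_sub {f : ℝ → ℝ → ℝ} (hf : SepBdd f) (x a b : ℝ) :
    primT f b x - primT f a x = ∫ s in a..b, f s x :=
  intervalIntegral.integral_interval_sub_left (hf.intervalIntegrableT _ _ _)
    (hf.intervalIntegrableT _ _ _)

lemma continuous_primX {f : ℝ → ℝ → ℝ} (hf : SepBdd f) :
    Continuous (fun p : ℝ × ℝ => primX f p.1 p.2) := by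
  obtain ⟨C, hC⟩ := hf.bdd
  have hC0 : 0 ≤ C := (abs_nonneg _).trans (hC 0 0)
  refine continuous_prod_of_continuous_lipschitzWith' (fun p : ℝ × ℝ => primX f p.1 p.2)
    (⟨C, hC0⟩ : NNReal) ?_ ?_
  · intro t
    refine LipschitzWith.of_dist_le_mul fun a b => ?_
    have h := intervalIntegral.norm_integral_le_of_norm_le_const (f := fun y => f t y) (a := b)
      (b := a) (C := C) fun y _ => hC t y
    rw [← primX_sub hf] at h
    exact h
  · intro x
    exact intervalIntegral.continuous_of_dominated_interval
      (fun t => (hf.contR t).aestronglyMeasurable) (bound := fun _ => C)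
      (fun t => ae_of_all _ fun y _ => hC t y) intervalIntegrable_const
      (ae_of_all _ fun y _ => hf.contL y)

lemma continuous_primT {f : ℝ → ℝ → ℝ} (hf : SepBdd f) :
    Continuous (fun p : ℝ × ℝ => primT f p.1 p.2) :=
  (continuous_primX hf.swap).comp continuous_swap

lemma glue_chain {Q : ℝ → ℝ → Prop} (h0 : ∀ a, Q a a)
    (hg : ∀ a b c, a ≤ b → b ≤ c → Q a b → Q b c → Q a c)
    (a h : ℝ) (hh : 0 ≤ h) (n : ℕ) (hc : ∀ i < n, Q (a + i * h) (a + (i + 1 : ℕ) * h)) :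
    Q a (a + n * h) := by
  induction n with
  | zero => simpa using h0 a
  | succ n ih =>
    refine hg _ _ _ ?_ ?_ (ih fun i hi => hc i (by omega)) (hc n (by omega))
    · nlinarith [mul_nonneg (Nat.cast_nonneg (α := ℝ) n) hh]
    · push_cast; nlinarith

lemma glue_interval {Q : ℝ → ℝ → Prop} (h0 : ∀ a, Q a a)
    (hg : ∀ a b c, a ≤ b → b ≤ c → Q a b → Q b c → Q a c) {a b δ : ℝ} (hδ : 0 < δ) (hδ' : δ ≤ b - a)
    (hc : ∀ s t, a ≤ s → t ≤ b → δ / 2 ≤ t - s → t - s ≤ δ → Q s t) : Q a b := by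
  set n := ⌈(b - a) / δ⌉₊ with hn
  have h1 : (b - a) / δ ≤ n := Nat.le_ceil _
  have h2 : (n:ℝ) < (b - a) / δ + 1 :=
    Nat.ceil_lt_add_one (div_nonneg (by linarith) hδ.le)
  have h3 : 1 ≤ (b - a) / δ := by rw [le_div_iff₀ hδ]; linarith
  have hn0 : (0:ℝ) < n := by linarith
  set h := (b - a) / n with hh
  have hab : b = a + n * h := by rw [hh]; field_simp; ring
  have hh0 : 0 ≤ h := div_nonneg (by linarith) hn0.le
  have hle : h ≤ δ := by
    rw [hh, div_le_iff₀ hn0]; rw [div_le_iff₀ hδ] at h1; linarith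
  have hge : δ / 2 ≤ h := by
    rw [hh, le_div_iff₀ hn0]
    have : (n:ℝ) ≤ 2 * ((b - a) / δ) := by linarith
    have h4 : (b - a) / δ * δ = b - a := div_mul_cancel₀ _ hδ.ne'
    nlinarith
  rw [hab]
  refine glue_chain h0 hg a h hh0 n fun i hi => hc _ _ ?_ ?_ ?_ ?_
  · have := mul_nonneg (Nat.cast_nonneg (α := ℝ) i) hh0; linarith
  · have : ((i + 1 : ℕ) : ℝ) ≤ n := by exact_mod_cast hi
    nlinarith
  · push_cast; linarith
  · push_cast; linarith

lemma glue_rect {Q : ℝ → ℝ → ℝ → ℝ → Prop} (h0 : ∀ a x y, Q a a x y) (h0' : ∀ s t a, Q s t a a)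
    (hT : ∀ a b c x y, a ≤ b → b ≤ c → x ≤ y → Q a b x y → Q b c x y → Q a c x y)
    (hX : ∀ s t a b c, s ≤ t → a ≤ b → b ≤ c → Q s t a b → Q s t b c → Q s t a c)
    {t₁ t₂ x₁ x₂ δ : ℝ} (hδ : 0 < δ) (ht : δ ≤ t₂ - t₁) (hx : δ ≤ x₂ - x₁)
    (hc : ∀ s t x y, t₁ ≤ s → t ≤ t₂ → x₁ ≤ x → y ≤ x₂ → δ / 2 ≤ t - s → t - s ≤ δ →
      δ / 2 ≤ y - x → y - x ≤ δ → Q s t x y) : Q t₁ t₂ x₁ x₂ := by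
  refine glue_interval (Q := fun s t => Q s t x₁ x₂) (fun a => h0 a _ _)
    (fun a b c hab hbc => hT a b c _ _ hab hbc (by linarith)) hδ ht fun s t hs ht' h1 h2 => ?_
  exact glue_interval (Q := fun x y => Q s t x y) (fun a => h0' _ _ a)
    (fun a b c => hX _ _ a b c (by linarith)) hδ hx fun x y hx hy h3 h4 =>
      hc s t x y hs ht' hx hy h1 h2 h3 h4

lemma baire_portion {E ι : Type*} [MetricSpace E] [Countable ι] {P : Set E} (hP : IsCompact P)
    (hne : P.Nonempty) {F : ι → Set E} (hF : ∀ i, IsClosed (F i)) (hc : P ⊆ ⋃ i, F i) :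
    ∃ i, ∃ p ∈ P, ∃ r > 0, P ∩ Metric.ball p r ⊆ F i := by
  have : CompactSpace P := isCompact_iff_compactSpace.mp hP
  have : Nonempty P := hne.to_subtype
  obtain ⟨i, p, hp⟩ := nonempty_interior_of_iUnion_of_closed
    (f := fun i => (Subtype.val ⁻¹' F i : Set P))
    (fun i => (hF i).preimage continuous_subtype_val) (by
      ext p; simpa using hc p.2)
  rw [mem_interior_iff_mem_nhds, Metric.mem_nhds_iff] at hp
  obtain ⟨r, hr, hsub⟩ := hp
  exact ⟨i, p, p.2, r, hr, fun q hq => hsub (show (⟨q, hq.1⟩ : P) ∈ Metric.ball p r from hq.2)⟩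

lemma measureReal_Ioc_prod (s t x y : ℝ) (h : s ≤ t) (hxy : x ≤ y) :
    volume.real (Ioc s t ×ˢ Ioc x y : Set (ℝ × ℝ)) = (t - s) * (y - x) := by
  rw [Measure.volume_eq_prod, measureReal_prod_prod, Real.volume_real_Ioc_of_le h,
    Real.volume_real_Ioc_of_le hxy]

lemma measureReal_Icc_prod (s t x y : ℝ) (h : s ≤ t) (hxy : x ≤ y) :
    volume.real (Icc s t ×ˢ Icc x y : Set (ℝ × ℝ)) = (t - s) * (y - x) := by
  rw [Measure.volume_eq_prod, measureReal_prod_prod, Real.volume_real_Icc_of_le h,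
    Real.volume_real_Icc_of_le hxy]

/-- The points near which `rectInc H` is bounded by `B` times the area. -/
def RegSet (H : ℝ → ℝ → ℝ) (T B : ℝ) : Set (ℝ × ℝ) :=
  {p | ∃ r > 0, ∀ t₁ t₂ x₁ x₂, 0 ≤ t₁ → t₁ ≤ t₂ → t₂ ≤ T → 0 ≤ x₁ → x₁ ≤ x₂ → x₂ ≤ 1 →
    (t₁, x₁) ∈ Metric.ball p r → (t₂, x₂) ∈ Metric.ball p r →
    |rectInc H t₁ t₂ x₁ x₂| ≤ B * ((t₂ - t₁) * (x₂ - x₁))}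

lemma isOpen_regSet (H : ℝ → ℝ → ℝ) (T B : ℝ) : IsOpen (RegSet H T B) := by
  rw [Metric.isOpen_iff]
  rintro p ⟨r, hr, h⟩
  refine ⟨r / 2, half_pos hr, fun q hq => ⟨r / 2, half_pos hr, ?_⟩⟩
  intro t₁ t₂ x₁ x₂ h1 h2 h3 h4 h5 h6 h7 h8
  have hsub : Metric.ball q (r / 2) ⊆ Metric.ball p r := by
    apply Metric.ball_subset_ball'
    rw [Metric.mem_ball] at hq; linarith
  exact h _ _ _ _ h1 h2 h3 h4 h5 h6 (hsub h7) (hsub h8)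

lemma rectInc_le_of_subset_regSet {H : ℝ → ℝ → ℝ} {T B : ℝ} {t₁ t₂ x₁ x₂ : ℝ}
    (h1 : 0 ≤ t₁) (h2 : t₁ ≤ t₂) (h3 : t₂ ≤ T) (h4 : 0 ≤ x₁) (h5 : x₁ ≤ x₂) (h6 : x₂ ≤ 1)
    (hs : Icc t₁ t₂ ×ˢ Icc x₁ x₂ ⊆ RegSet H T B) :
    |rectInc H t₁ t₂ x₁ x₂| ≤ B * ((t₂ - t₁) * (x₂ - x₁)) := by
  rcases h2.eq_or_lt with rfl | h2'
  · simp [rectInc]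
  rcases h5.eq_or_lt with rfl | h5'
  · simp [rectInc]
  choose! r hr hbd using (fun p (hp : p ∈ RegSet H T B) => hp)
  obtain ⟨δ, hδ, hL⟩ := lebesgue_number_lemma_of_metric
    (isCompact_Icc.prod isCompact_Icc : IsCompact (Icc t₁ t₂ ×ˢ Icc x₁ x₂))
    (c := fun p : RegSet H T B => Metric.ball (p : ℝ × ℝ) (r p)) (fun _ => Metric.isOpen_ball)
    (fun p hp => mem_iUnion.2 ⟨⟨p, hs hp⟩, Metric.mem_ball_self (hr _ (hs hp))⟩)
  have hd : 0 < min (δ / 2) (min (t₂ - t₁) (x₂ - x₁)) :=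
    lt_min (half_pos hδ) (lt_min (by linarith) (by linarith))
  refine glue_rect (Q := fun s t x y => |rectInc H s t x y| ≤ B * ((t - s) * (y - x)))
    (by simp [rectInc]) (by simp [rectInc]) ?_ ?_ hd
    ((min_le_right _ _).trans (min_le_left _ _)) ((min_le_right _ _).trans (min_le_right _ _)) ?_
  · intro a b c x y _ _ _ hab hbc
    have : rectInc H a c x y = rectInc H a b x y + rectInc H b c x y := by unfold rectInc; ring
    rw [this]
    refine (abs_add_le _ _).trans ((add_le_add hab hbc).trans (le_of_eq (by ring)))
  · intro s t a b c _ _ _ hab hbc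
    have : rectInc H s t a c = rectInc H s t a b + rectInc H s t b c := by unfold rectInc; ring
    rw [this]
    refine (abs_add_le _ _).trans ((add_le_add hab hbc).trans (le_of_eq (by ring)))
  · intro s t x y hs1 ht1 hx1 hy1 hst hst' hxy hxy'
    have hlt : min (δ / 2) (min (t₂ - t₁) (x₂ - x₁)) ≤ δ / 2 := min_le_left _ _
    obtain ⟨p, hp⟩ := hL (s, x) ⟨⟨hs1, by linarith⟩, ⟨hx1, by linarith⟩⟩
    refine hbd p p.2 s t x y (by linarith) (by linarith) (by linarith) (by linarith) (by linarith)
      (by linarith) (hp (Metric.mem_ball_self hδ)) (hp ?_)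
    rw [Metric.mem_ball, Prod.dist_eq, max_lt_iff, Real.dist_eq, Real.dist_eq, abs_lt, abs_lt]
    refine ⟨⟨?_, ?_⟩, ⟨?_, ?_⟩⟩ <;> dsimp only <;> linarith

lemma rectInc_le_of_interior_subset {H : ℝ → ℝ → ℝ} (hH : Continuous fun p : ℝ × ℝ => H p.1 p.2)
    {T B : ℝ} {t₁ t₂ x₁ x₂ : ℝ}
    (h1 : 0 ≤ t₁) (h2 : t₁ ≤ t₂) (h3 : t₂ ≤ T) (h4 : 0 ≤ x₁) (h5 : x₁ ≤ x₂) (h6 : x₂ ≤ 1)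
    (hs : Ioo t₁ t₂ ×ˢ Ioo x₁ x₂ ⊆ RegSet H T B) :
    |rectInc H t₁ t₂ x₁ x₂| ≤ B * ((t₂ - t₁) * (x₂ - x₁)) := by
  rcases h2.eq_or_lt with rfl | h2'
  · simp [rectInc]
  rcases h5.eq_or_lt with rfl | h5'
  · simp [rectInc]
  have hc : ∀ f g : ℝ → ℝ, Continuous f → Continuous g → Continuous fun τ => H (f τ) (g τ) :=
    fun f g hf hg => hH.comp (hf.prodMk hg)
  have hL : Tendsto (fun τ => |rectInc H (t₁ + τ) (t₂ - τ) (x₁ + τ) (x₂ - τ)|) (𝓝[>] 0)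
      (𝓝 |rectInc H (t₁ + 0) (t₂ - 0) (x₁ + 0) (x₂ - 0)|) := by
    apply tendsto_nhdsWithin_of_tendsto_nhds
    apply Continuous.tendsto (f := fun τ => |rectInc H (t₁ + τ) (t₂ - τ) (x₁ + τ) (x₂ - τ)|)
    unfold rectInc
    refine Continuous.abs (((Continuous.sub (Continuous.sub ?_ ?_) ?_)).add ?_) <;>
      exact hc _ _ (by fun_prop) (by fun_prop)
  have hR : Tendsto (fun τ => B * (((t₂ - τ) - (t₁ + τ)) * ((x₂ - τ) - (x₁ + τ)))) (𝓝[>] 0)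
      (𝓝 (B * (((t₂ - 0) - (t₁ + 0)) * ((x₂ - 0) - (x₁ + 0))))) := by
    apply tendsto_nhdsWithin_of_tendsto_nhds
    apply Continuous.tendsto
      (f := fun τ => B * (((t₂ - τ) - (t₁ + τ)) * ((x₂ - τ) - (x₁ + τ))))
    fun_prop
  simp only [add_zero, sub_zero] at hL hR
  refine le_of_tendsto_of_tendsto hL hR ?_
  have hd : 0 < min (t₂ - t₁) (x₂ - x₁) / 2 := half_pos (lt_min (by linarith) (by linarith))
  filter_upwards [Ioo_mem_nhdsGT hd] with τ hτ
  have ha := min_le_left (t₂ - t₁) (x₂ - x₁)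
  have hb := min_le_right (t₂ - t₁) (x₂ - x₁)
  obtain ⟨hτ0, hτ1⟩ := hτ
  refine rectInc_le_of_subset_regSet (T := T) (by linarith) (by linarith) (by linarith)
    (by linarith) (by linarith) (by linarith) (Subset.trans ?_ hs)
  exact Set.prod_mono (Icc_subset_Ioo (by linarith) (by linarith))
    (Icc_subset_Ioo (by linarith) (by linarith))

lemma rectInc_cell {H : ℝ → ℝ → ℝ} (hH : Continuous fun p : ℝ × ℝ => H p.1 p.2)
    {T ε δ : ℝ} (hε : 0 < ε) {N : Set (ℝ × ℝ)} [IsFiniteMeasure (volume.restrict N)]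
    {P E : Set (ℝ × ℝ)} (hPc : IsCompact P)
    (hP : P = (Icc 0 T ×ˢ Icc 0 1) \ RegSet H T (4 * ε))
    (hN : Metric.cthickening δ P \ P ⊆ N)
    (hloc : ∀ t₁ t₂ x₁ x₂, 0 ≤ t₁ → t₁ ≤ t₂ → t₂ ≤ T → 0 ≤ x₁ → x₁ ≤ x₂ → x₂ ≤ 1 →
      t₂ - t₁ ≤ δ → x₂ - x₁ ≤ δ →
      (∃ x ∈ Icc x₁ x₂, (t₁, x) ∈ E) → (∃ x ∈ Icc x₁ x₂, (t₂, x) ∈ E) →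
      (∃ t ∈ Icc t₁ t₂, (t, x₁) ∈ E) → (∃ t ∈ Icc t₁ t₂, (t, x₂) ∈ E) →
      |rectInc H t₁ t₂ x₁ x₂| ≤ ε * δ ^ 2)
    {s t x y : ℝ} (h1 : 0 ≤ s) (h3 : t ≤ T) (h4 : 0 ≤ x) (h6 : y ≤ 1) (hδ : 0 < δ)
    (hst : δ / 2 ≤ t - s) (hst' : t - s ≤ δ) (hxy : δ / 2 ≤ y - x) (hxy' : y - x ≤ δ)
    (hE : P ∩ (Icc s t ×ˢ Icc x y) ⊆ E) :
    |rectInc H s t x y| ≤ 4 * ε * ((t - s) * (y - x)) +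
      4 * ε * (volume.restrict N).real (Ioc s t ×ˢ Ioc x y) := by
  have hreg : ∀ p : ℝ × ℝ, p ∈ (Icc 0 T ×ˢ Icc 0 1 : Set (ℝ × ℝ)) → p ∉ P →
      p ∈ RegSet H T (4 * ε) := by
    intro p hp hpP
    by_contra hcon
    exact hpP (hP ▸ ⟨hp, hcon⟩)
  have hpos : 0 ≤ 4 * ε * (volume.restrict N).real (Ioc s t ×ˢ Ioc x y) := by positivity
  set K := P ∩ (Icc s t ×ˢ Icc x y) with hK
  rcases K.eq_empty_or_nonempty with hKe | hKne
  · have := rectInc_le_of_subset_regSet (H := H) (B := 4 * ε) h1 (by linarith : s ≤ t) h3 h4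
      (by linarith : x ≤ y) h6 (fun p hp => hreg p
        ⟨⟨h1.trans hp.1.1, hp.1.2.trans h3⟩, ⟨h4.trans hp.2.1, hp.2.2.trans h6⟩⟩ fun hpP => by
          have : p ∈ K := ⟨hpP, hp⟩
          rw [hKe] at this; exact this)
    linarith
  have hKc : IsCompact K := hPc.inter (isCompact_Icc.prod isCompact_Icc)
  obtain ⟨p₁, hp₁, hm₁⟩ := hKc.exists_isMinOn hKne continuous_fst.continuousOn
  obtain ⟨p₂, hp₂, hm₂⟩ := hKc.exists_isMaxOn hKne continuous_fst.continuousOn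
  obtain ⟨q₁, hq₁, hn₁⟩ := hKc.exists_isMinOn hKne continuous_snd.continuousOn
  obtain ⟨q₂, hq₂, hn₂⟩ := hKc.exists_isMaxOn hKne continuous_snd.continuousOn
  rw [isMinOn_iff] at hm₁ hn₁
  rw [isMaxOn_iff] at hm₂ hn₂
  have B₁ := hp₁.2; have B₂ := hp₂.2; have B₃ := hq₁.2; have B₄ := hq₂.2
  simp only [mem_prod, mem_Icc] at B₁ B₂ B₃ B₄
  obtain ⟨⟨b1, b2⟩, b3, b4⟩ := B₁
  obtain ⟨⟨b5, b6⟩, b7, b8⟩ := B₂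
  obtain ⟨⟨b9, b10⟩, b11, b12⟩ := B₃
  obtain ⟨⟨b13, b14⟩, b15, b16⟩ := B₄
  have c1 := hm₁ p₂ hp₂
  have c2 := hn₁ q₂ hq₂
  set a₁ := p₁.1
  set a₂ := p₂.1
  set d₁ := q₁.2
  set d₂ := q₂.2
  have hJ : |rectInc H a₁ a₂ d₁ d₂| ≤ ε * δ ^ 2 := by
    refine hloc _ _ _ _ (by linarith) c1 (by linarith) (by linarith) c2 (by linarith)
      (by linarith) (by linarith) ?_ ?_ ?_ ?_
    · exact ⟨p₁.2, ⟨hn₁ _ hp₁, hn₂ _ hp₁⟩, hE hp₁⟩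
    · exact ⟨p₂.2, ⟨hn₁ _ hp₂, hn₂ _ hp₂⟩, hE hp₂⟩
    · exact ⟨q₁.1, ⟨hm₁ _ hq₁, hm₂ _ hq₁⟩, hE hq₁⟩
    · exact ⟨q₂.1, ⟨hm₁ _ hq₂, hm₂ _ hq₂⟩, hE hq₂⟩
  have hL : |rectInc H s a₁ x y| ≤ 4 * ε * ((a₁ - s) * (y - x)) := by
    refine rectInc_le_of_interior_subset hH h1 b1 (b2.trans h3) h4 (by linarith) h6 fun p hp => ?_
    obtain ⟨⟨e1, e2⟩, e3, e4⟩ := hp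
    refine hreg p ⟨⟨by linarith, by linarith⟩, by linarith, by linarith⟩ fun hpP => ?_
    have := hm₁ p ⟨hpP, ⟨by linarith, by linarith⟩, by linarith, by linarith⟩
    linarith
  have hR : |rectInc H a₂ t x y| ≤ 4 * ε * ((t - a₂) * (y - x)) := by
    refine rectInc_le_of_interior_subset hH (by linarith) b6 h3 h4 (by linarith) h6 fun p hp => ?_
    obtain ⟨⟨e1, e2⟩, e3, e4⟩ := hp
    refine hreg p ⟨⟨by linarith, by linarith⟩, by linarith, by linarith⟩ fun hpP => ?_
    have := hm₂ p ⟨hpP, ⟨by linarith, by linarith⟩, by linarith, by linarith⟩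
    linarith
  have hD : |rectInc H a₁ a₂ x d₁| ≤ 4 * ε * ((a₂ - a₁) * (d₁ - x)) := by
    refine rectInc_le_of_interior_subset hH (by linarith) c1 (b6.trans h3) h4 (by linarith)
      (by linarith) fun p hp => ?_
    obtain ⟨⟨e1, e2⟩, e3, e4⟩ := hp
    refine hreg p ⟨⟨by linarith, by linarith⟩, by linarith, by linarith⟩ fun hpP => ?_
    have := hn₁ p ⟨hpP, ⟨by linarith, by linarith⟩, by linarith, by linarith⟩
    linarith
  have hU : |rectInc H a₁ a₂ d₂ y| ≤ 4 * ε * ((a₂ - a₁) * (y - d₂)) := by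
    refine rectInc_le_of_interior_subset hH (by linarith) c1 (b6.trans h3) (by linarith)
      (by linarith) h6 fun p hp => ?_
    obtain ⟨⟨e1, e2⟩, e3, e4⟩ := hp
    refine hreg p ⟨⟨by linarith, by linarith⟩, by linarith, by linarith⟩ fun hpP => ?_
    have := hn₂ p ⟨hpP, ⟨by linarith, by linarith⟩, by linarith, by linarith⟩
    linarith
  have hvol : (t - s) * (y - x) - (a₂ - a₁) * (d₂ - d₁) ≤
      (volume.restrict N).real (Ioc s t ×ˢ Ioc x y) := by
    rw [measureReal_restrict_apply (measurableSet_Ioc.prod measurableSet_Ioc),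
      ← measureReal_Ioc_prod s t x y (by linarith) (by linarith),
      ← measureReal_Icc_prod a₁ a₂ d₁ d₂ c1 c2]
    have hfin : volume (Ioc s t ×ˢ Ioc x y : Set (ℝ × ℝ)) ≠ ⊤ := by
      rw [Measure.volume_eq_prod, Measure.prod_prod]
      exact ENNReal.mul_ne_top (by simp) (by simp)
    refine (le_measureReal_sdiff ?_).trans (measureReal_mono ?_ ?_)
    · rw [Measure.volume_eq_prod, Measure.prod_prod]
      exact ENNReal.mul_ne_top (by simp) (by simp)
    · rintro p ⟨hp, hpJ⟩
      refine ⟨hp, hN ⟨?_, fun hpP => hpJ ?_⟩⟩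
      · obtain ⟨⟨e1, e2⟩, e3, e4⟩ := hp
        refine Metric.mem_cthickening_of_dist_le p p₁ δ P hp₁.1 ?_
        rw [Prod.dist_eq, max_le_iff, Real.dist_eq, Real.dist_eq, abs_le, abs_le]
        refine ⟨⟨?_, ?_⟩, ⟨?_, ?_⟩⟩ <;> linarith
      · have hpK : p ∈ K := ⟨hpP, ⟨⟨hp.1.1.le, hp.1.2⟩, ⟨hp.2.1.le, hp.2.2⟩⟩⟩
        exact ⟨⟨hm₁ _ hpK, hm₂ _ hpK⟩, ⟨hn₁ _ hpK, hn₂ _ hpK⟩⟩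
    · exact measure_ne_top_of_subset inter_subset_left hfin
  have hsum : rectInc H s t x y = rectInc H s a₁ x y + rectInc H a₂ t x y +
      rectInc H a₁ a₂ x d₁ + rectInc H a₁ a₂ d₂ y + rectInc H a₁ a₂ d₁ d₂ := by
    unfold rectInc; ring
  have hδ2 : ε * δ ^ 2 ≤ 4 * ε * ((t - s) * (y - x)) := by
    have : (δ / 2) * (δ / 2) ≤ (t - s) * (y - x) :=
      mul_le_mul hst hxy (by positivity) (by linarith)
    nlinarith
  have habs : |rectInc H s t x y| ≤ |rectInc H s a₁ x y| + |rectInc H a₂ t x y| +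
      |rectInc H a₁ a₂ x d₁| + |rectInc H a₁ a₂ d₂ y| + |rectInc H a₁ a₂ d₁ d₂| := by
    rw [hsum]
    refine (abs_add_le _ _).trans (add_le_add_left ((abs_add_le _ _).trans (add_le_add_left
      ((abs_add_le _ _).trans (add_le_add_left (abs_add_le _ _) _)) _)) _)
  have := mul_le_mul_of_nonneg_left hvol (by positivity : 0 ≤ 4 * ε)
  nlinarith

lemma tendsto_measureReal_cthickening_sdiff {P : Set (ℝ × ℝ)} (hP : IsCompact P) :
    Tendsto (fun η => volume.real (Metric.cthickening η P \ P)) (𝓝[>] 0) (𝓝 0) := by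
  have h := (tendsto_measure_cthickening_of_isCompact (μ := volume) hP).mono_left
    (nhdsWithin_le_nhds (s := Ioi 0))
  have hfin : volume P ≠ ⊤ := hP.measure_lt_top.ne
  have h2 := (ENNReal.tendsto_toReal hfin).comp h
  have h3 : Tendsto (fun η => volume.real (Metric.cthickening η P) - volume.real P) (𝓝[>] 0)
      (𝓝 0) := by
    have := h2.sub_const (volume.real P)
    rwa [show (volume P).toReal - volume.real P = 0 from sub_self _] at this
  refine h3.congr' ?_
  filter_upwards [self_mem_nhdsWithin] with η hη
  rw [measureReal_sdiff (Metric.self_subset_cthickening P)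
    hP.measurableSet (hP.cthickening.measure_lt_top.ne)]

lemma rectInc_le_of_local {H : ℝ → ℝ → ℝ} (hH : Continuous fun p : ℝ × ℝ => H p.1 p.2)
    {T ε : ℝ} (hε : 0 < ε) {ι : Type*} [Countable ι] {E : ι → Set (ℝ × ℝ)}
    (hEc : ∀ i, IsClosed (E i)) (hcov : Icc 0 T ×ˢ Icc 0 1 ⊆ ⋃ i, E i)
    (hloc : ∀ i, ∃ r > 0, ∀ δ ≤ r,
      ∀ t₁ t₂ x₁ x₂, 0 ≤ t₁ → t₁ ≤ t₂ → t₂ ≤ T → 0 ≤ x₁ → x₁ ≤ x₂ → x₂ ≤ 1 →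
      t₂ - t₁ ≤ δ → x₂ - x₁ ≤ δ →
      (∃ x ∈ Icc x₁ x₂, (t₁, x) ∈ E i) → (∃ x ∈ Icc x₁ x₂, (t₂, x) ∈ E i) →
      (∃ t ∈ Icc t₁ t₂, (t, x₁) ∈ E i) → (∃ t ∈ Icc t₁ t₂, (t, x₂) ∈ E i) →
      |rectInc H t₁ t₂ x₁ x₂| ≤ ε * δ ^ 2)
    {t₁ t₂ x₁ x₂ : ℝ} (h1 : 0 ≤ t₁) (h2 : t₁ ≤ t₂) (h3 : t₂ ≤ T) (h4 : 0 ≤ x₁) (h5 : x₁ ≤ x₂)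
    (h6 : x₂ ≤ 1) :
    |rectInc H t₁ t₂ x₁ x₂| ≤ 4 * ε * ((t₂ - t₁) * (x₂ - x₁)) := by
  obtain ⟨P, hP⟩ : ∃ P, P = (Icc 0 T ×ˢ Icc 0 1) \ RegSet H T (4 * ε) := ⟨_, rfl⟩
  have hPc : IsCompact P := by
    rw [hP]; exact (isCompact_Icc.prod isCompact_Icc).diff (isOpen_regSet _ _ _)
  rcases P.eq_empty_or_nonempty with hPe | hPne
  · refine rectInc_le_of_subset_regSet h1 h2 h3 h4 h5 h6 fun p hp => ?_
    by_contra hcon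
    have : p ∈ P := hP ▸ ⟨⟨⟨h1.trans hp.1.1, hp.1.2.trans h3⟩,
      ⟨h4.trans hp.2.1, hp.2.2.trans h6⟩⟩, hcon⟩
    rw [hPe] at this; exact this
  exfalso
  obtain ⟨i, p₀, hp₀, r₀, hr₀, hsub⟩ := baire_portion hPc hPne hEc
    ((hP ▸ sdiff_subset : P ⊆ Icc 0 T ×ˢ Icc 0 1).trans hcov)
  obtain ⟨r, hr, hl⟩ := hloc i
  have hp₀' := hp₀
  rw [hP] at hp₀'
  refine hp₀'.2 ⟨r₀, hr₀, ?_⟩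
  intro s t x y k1 k2 k3 k4 k5 k6 hb1 hb2
  rcases k2.eq_or_lt with rfl | k2'
  · simp [rectInc]
  rcases k5.eq_or_lt with rfl | k5'
  · simp [rectInc]
  have hlim := (tendsto_measureReal_cthickening_sdiff hPc).const_mul (4 * ε) |>.const_add
    (4 * ε * ((t - s) * (y - x)))
  rw [mul_zero, add_zero] at hlim
  refine ge_of_tendsto hlim ?_
  have hd : 0 < min r (min (t - s) (y - x)) := lt_min hr (lt_min (by linarith) (by linarith))
  filter_upwards [Ioo_mem_nhdsGT hd] with δ hδ
  obtain ⟨hδ0, hδ1⟩ := hδ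
  rw [lt_min_iff, lt_min_iff] at hδ1
  set N := Metric.cthickening δ P \ P with hN
  have hNfin : volume N ≠ ⊤ :=
    measure_ne_top_of_subset sdiff_subset hPc.cthickening.measure_lt_top.ne
  have : IsFiniteMeasure (volume.restrict N) := ⟨by
    rw [Measure.restrict_apply_univ]; exact hNfin.lt_top⟩
  have key : |rectInc H s t x y| ≤ 4 * ε * ((t - s) * (y - x)) +
      4 * ε * (volume.restrict N).real (Ioc s t ×ˢ Ioc x y) := by
    refine glue_rect (Q := fun s' t' x' y' => s ≤ s' → t' ≤ t → x ≤ x' → y' ≤ y →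
      |rectInc H s' t' x' y'| ≤ 4 * ε * ((t' - s') * (y' - x')) +
      4 * ε * (volume.restrict N).real (Ioc s' t' ×ˢ Ioc x' y'))
      (by intros; simp [rectInc]) (by intros; simp [rectInc]) ?_ ?_ hδ0 hδ1.2.1.le hδ1.2.2.le ?_
      le_rfl le_rfl le_rfl le_rfl
    · intro a b c x' y' hab hbc _ q1 q2 e1 e2 e3 e4
      specialize q1 e1 (hbc.trans e2) e3 e4
      specialize q2 (e1.trans hab) e2 e3 e4
      have hd : (volume.restrict N).real (Ioc a c ×ˢ Ioc x' y') =
          (volume.restrict N).real (Ioc a b ×ˢ Ioc x' y') +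
          (volume.restrict N).real (Ioc b c ×ˢ Ioc x' y') := by
        rw [← measureReal_union _ (measurableSet_Ioc.prod measurableSet_Ioc), ← union_prod,
          Ioc_union_Ioc_eq_Ioc hab hbc]
        exact Disjoint.set_prod_left (Ioc_disjoint_Ioc_of_le le_rfl) _ _
      have : rectInc H a c x' y' = rectInc H a b x' y' + rectInc H b c x' y' := by
        unfold rectInc; ring
      rw [this, hd]
      refine (abs_add_le _ _).trans ((add_le_add q1 q2).trans (le_of_eq (by ring)))
    · intro s' t' a b c _ hab hbc q1 q2 e1 e2 e3 e4
      specialize q1 e1 e2 e3 (hbc.trans e4)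
      specialize q2 e1 e2 (e3.trans hab) e4
      have hd : (volume.restrict N).real (Ioc s' t' ×ˢ Ioc a c) =
          (volume.restrict N).real (Ioc s' t' ×ˢ Ioc a b) +
          (volume.restrict N).real (Ioc s' t' ×ˢ Ioc b c) := by
        rw [← measureReal_union _ (measurableSet_Ioc.prod measurableSet_Ioc), ← prod_union,
          Ioc_union_Ioc_eq_Ioc hab hbc]
        exact Disjoint.set_prod_right (Ioc_disjoint_Ioc_of_le le_rfl) _ _
      have : rectInc H s' t' a c = rectInc H s' t' a b + rectInc H s' t' b c := by
        unfold rectInc; ring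
      rw [this, hd]
      refine (abs_add_le _ _).trans ((add_le_add q1 q2).trans (le_of_eq (by ring)))
    · intro s' t' x' y' e1 e2 e3 e4 f1 f2 f3 f4 _ _ _ _
      refine rectInc_cell hH hε (E := E i) hPc hP subset_rfl (hl δ hδ1.1.le) (k1.trans e1)
        (e2.trans k3) (k4.trans e3) (e4.trans k6) hδ0 f1 f2 f3 f4 ?_
      refine Subset.trans ?_ hsub
      refine inter_subset_inter_right _ fun p hp => ?_
      rw [Metric.mem_ball, Prod.dist_eq, max_lt_iff, Real.dist_eq, Real.dist_eq, abs_lt, abs_lt]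
        at hb1 hb2 ⊢
      dsimp only at hb1 hb2
      obtain ⟨⟨g1, g2⟩, g3, g4⟩ := hp
      refine ⟨⟨?_, ?_⟩, ⟨?_, ?_⟩⟩ <;> linarith [hb1.1.1, hb1.1.2, hb1.2.1, hb1.2.2, hb2.1.1,
        hb2.1.2, hb2.2.1, hb2.2.2]
  refine key.trans ?_
  have : (volume.restrict N).real (Ioc s t ×ˢ Ioc x y) ≤ volume.real N := by
    rw [measureReal_restrict_apply (measurableSet_Ioc.prod measurableSet_Ioc)]
    exact measureReal_mono inter_subset_right hNfin
  have := mul_le_mul_of_nonneg_left this (by positivity : 0 ≤ 4 * ε)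
  linarith

/-- The points of `[0,T] × [0,1]` at which `f` is `ε`-close to affine with slopes `κ₁`, `κ₂` along
the horizontal and vertical segments of half-length `1 / (n + 1)`. -/
def Arm (T : ℝ) (f : ℝ → ℝ → ℝ) (κ₁ κ₂ ε : ℝ) (n : ℕ) : Set (ℝ × ℝ) :=
  {p | (p.1 ∈ Icc 0 T ∧ p.2 ∈ Icc 0 1) ∧
    (∀ s ∈ Icc 0 T, |s - p.1| < 1 / (n + 1) →
      |f s p.2 - f p.1 p.2 - κ₁ * (s - p.1)| ≤ ε * |s - p.1|) ∧
    (∀ y ∈ Icc (0:ℝ) 1, |y - p.2| < 1 / (n + 1) →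
      |f p.1 y - f p.1 p.2 - κ₂ * (y - p.2)| ≤ ε * |y - p.2|)}

lemma isClosed_arm {T : ℝ} {f : ℝ → ℝ → ℝ} (hf : SepBdd f) (κ₁ κ₂ ε : ℝ) (n : ℕ) :
    IsClosed (Arm T f κ₁ κ₂ ε n) := by
  refine IsSeqClosed.isClosed fun u p hu hlim => ?_
  have hn : (0:ℝ) < 1 / (n + 1) := by positivity
  have l1 : Tendsto (fun j => (u j).1) atTop (𝓝 p.1) := (continuous_fst.tendsto p).comp hlim
  have l2 : Tendsto (fun j => (u j).2) atTop (𝓝 p.2) := (continuous_snd.tendsto p).comp hlim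
  have m1 : p.1 ∈ Icc 0 T := isClosed_Icc.mem_of_tendsto l1 (.of_forall fun j => (hu j).1.1)
  have m2 : p.2 ∈ Icc (0:ℝ) 1 := isClosed_Icc.mem_of_tendsto l2 (.of_forall fun j => (hu j).1.2)
  have near : ∀ s, |s - p.1| < 1 / (n + 1) → ∀ᶠ j in atTop, |s - (u j).1| < 1 / ((n:ℝ) + 1) :=
    fun s hs => (l1.const_sub s).abs.eventually_lt_const hs
  have near' : ∀ s, |s - p.2| < 1 / (n + 1) → ∀ᶠ j in atTop, |s - (u j).2| < 1 / ((n:ℝ) + 1) :=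
    fun s hs => (l2.const_sub s).abs.eventually_lt_const hs
  have hval : Tendsto (fun j => f (u j).1 (u j).2) atTop (𝓝 (f p.1 p.2)) := by
    have a1 : Tendsto (fun j => f p.1 (u j).2) atTop (𝓝 (f p.1 p.2)) :=
      ((hf.contR p.1).tendsto p.2).comp l2
    have a2 : Tendsto (fun j => p.1 - (u j).1) atTop (𝓝 0) := by
      simpa using l1.const_sub p.1
    have a3 : Tendsto (fun j => f p.1 (u j).2 - f (u j).1 (u j).2 - κ₁ * (p.1 - (u j).1)) atTop
        (𝓝 0) := by
      refine squeeze_zero_norm' (a := fun j => ε * |p.1 - (u j).1|) ?_ ?_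
      · filter_upwards [near p.1 (by simpa using hn)] with j hj using (hu j).2.1 p.1 m1 hj
      · simpa using a2.abs.const_mul ε
    have a4 := (a1.sub a3).sub (a2.const_mul κ₁)
    simp only [mul_zero, sub_zero] at a4
    refine a4.congr fun j => ?_
    ring
  refine ⟨⟨m1, m2⟩, fun s hs hsd => ?_, fun y hy hyd => ?_⟩
  · have b1 : Tendsto (fun j => f s (u j).2) atTop (𝓝 (f s p.2)) :=
      ((hf.contR s).tendsto p.2).comp l2
    refine le_of_tendsto_of_tendsto (((b1.sub hval).sub ((l1.const_sub s).const_mul κ₁)).abs)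
      ((l1.const_sub s).abs.const_mul ε) ?_
    filter_upwards [near s hsd] with j hj using (hu j).2.1 s hs hj
  · have b1 : Tendsto (fun j => f (u j).1 y) atTop (𝓝 (f p.1 y)) :=
      ((hf.contL y).tendsto p.1).comp l1
    refine le_of_tendsto_of_tendsto (((b1.sub hval).sub ((l2.const_sub y).const_mul κ₂)).abs)
      ((l2.const_sub y).abs.const_mul ε) ?_
    filter_upwards [near' y hyd] with j hj using (hu j).2.2 y hy hj

lemma HasDerivWithinAt.exists_arm {g : ℝ → ℝ} {α κ ε t : ℝ} {S : Set ℝ}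
    (hg : HasDerivWithinAt g α S t) (hκ : |α - κ| < ε) :
    ∃ n₀ : ℕ, ∀ n ≥ n₀, ∀ s ∈ S, |s - t| < 1 / (n + 1) →
      |g s - g t - κ * (s - t)| ≤ ε * |s - t| := by
  have h := (hasDerivWithinAt_iff_isLittleO.1 hg).def (sub_pos.2 hκ)
  rw [eventually_nhdsWithin_iff, Metric.eventually_nhds_iff] at h
  obtain ⟨δ, hδ, h⟩ := h
  obtain ⟨n₀, hn₀⟩ := exists_nat_one_div_lt hδ
  refine ⟨n₀, fun n hn s hs hst => ?_⟩
  have h1 : 1 / ((n:ℝ) + 1) ≤ 1 / ((n₀:ℝ) + 1) := Nat.one_div_le_one_div hn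
  have h2 := h (y := s) (by rw [Real.dist_eq]; linarith) hs
  simp only [Real.norm_eq_abs, smul_eq_mul] at h2
  calc |g s - g t - κ * (s - t)| = |(g s - g t - (s - t) * α) + (α - κ) * (s - t)| := by
        congr 1; ring
    _ ≤ (ε - |α - κ|) * |s - t| + |α - κ| * |s - t| :=
        (abs_add_le _ _).trans (add_le_add h2 (abs_mul _ _).le)
    _ = ε * |s - t| := by ring

lemma exists_mem_arm {T : ℝ} {f : ℝ → ℝ → ℝ} {p : ℝ × ℝ} {α₁ α₂ κ₁ κ₂ ε : ℝ}
    (h1 : p.1 ∈ Icc 0 T) (h2 : p.2 ∈ Icc 0 1)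
    (d1 : HasDerivWithinAt (fun s => f s p.2) α₁ (Icc 0 T) p.1)
    (d2 : HasDerivWithinAt (fun y => f p.1 y) α₂ (Icc 0 1) p.2)
    (e1 : |α₁ - κ₁| < ε) (e2 : |α₂ - κ₂| < ε) : ∃ n₀ : ℕ, ∀ n ≥ n₀, p ∈ Arm T f κ₁ κ₂ ε n := by
  obtain ⟨n₁, hn₁⟩ := d1.exists_arm e1
  obtain ⟨n₂, hn₂⟩ := d2.exists_arm e2
  exact ⟨max n₁ n₂, fun n hn => ⟨⟨h1, h2⟩, hn₁ n (le_of_max_le_left hn),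
    hn₂ n (le_of_max_le_right hn)⟩⟩

lemma arm_incr {T : ℝ} {f : ℝ → ℝ → ℝ} {κ₁ κ₂ ε δ : ℝ} {n : ℕ} (hε : 0 < ε)
    (hδ : δ < 1 / (n + 1)) {t₁ t₂ x₁ x₂ x : ℝ} (h1 : 0 ≤ t₁) (h2 : t₁ ≤ t₂) (h3 : t₂ ≤ T)
    (h4 : 0 ≤ x₁) (h6 : x₂ ≤ 1) (ht : t₂ - t₁ ≤ δ) (hx : x₂ - x₁ ≤ δ) (hxm : x ∈ Icc x₁ x₂)
    (ha : ∃ x ∈ Icc x₁ x₂, (t₁, x) ∈ Arm T f κ₁ κ₂ ε n)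
    (hb : ∃ x ∈ Icc x₁ x₂, (t₂, x) ∈ Arm T f κ₁ κ₂ ε n) :
    |f t₂ x - f t₁ x - κ₁ * (t₂ - t₁)| ≤ 4 * (ε * δ) := by
  obtain ⟨x', hx', -, -, a2⟩ := ha
  obtain ⟨x'', hx'', -, b1, b2⟩ := hb
  dsimp only at a2 b1 b2
  obtain ⟨m1, m2⟩ := hxm
  obtain ⟨m3, m4⟩ := hx'
  obtain ⟨m5, m6⟩ := hx''
  have d1 : ∀ u v, x₁ ≤ u → u ≤ x₂ → x₁ ≤ v → v ≤ x₂ → |u - v| ≤ δ := fun u v _ _ _ _ => by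
    rw [abs_le]; constructor <;> linarith
  have d2 : |t₁ - t₂| ≤ δ := by rw [abs_le]; constructor <;> linarith
  have c1 := (b2 x ⟨by linarith, by linarith⟩ ((d1 x x'' m1 m2 m5 m6).trans_lt hδ)).trans
    (mul_le_mul_of_nonneg_left (d1 x x'' m1 m2 m5 m6) hε.le)
  have c2 := (a2 x ⟨by linarith, by linarith⟩ ((d1 x x' m1 m2 m3 m4).trans_lt hδ)).trans
    (mul_le_mul_of_nonneg_left (d1 x x' m1 m2 m3 m4) hε.le)
  have c3 := (a2 x'' ⟨by linarith, by linarith⟩ ((d1 x'' x' m5 m6 m3 m4).trans_lt hδ)).trans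
    (mul_le_mul_of_nonneg_left (d1 x'' x' m5 m6 m3 m4) hε.le)
  have c4 := (b1 t₁ ⟨by linarith, by linarith⟩ (d2.trans_lt hδ)).trans
    (mul_le_mul_of_nonneg_left d2 hε.le)
  rw [abs_le] at c1 c2 c3 c4 ⊢
  constructor <;> linarith [c1.1, c1.2, c2.1, c2.2, c3.1, c3.2, c4.1, c4.2]

lemma arm_incr' {T : ℝ} {f : ℝ → ℝ → ℝ} {κ₁ κ₂ ε δ : ℝ} {n : ℕ} (hε : 0 < ε)
    (hδ : δ < 1 / (n + 1)) {t₁ t₂ x₁ x₂ t : ℝ} (h1 : 0 ≤ t₁) (h3 : t₂ ≤ T)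
    (h4 : 0 ≤ x₁) (h5 : x₁ ≤ x₂) (h6 : x₂ ≤ 1) (ht : t₂ - t₁ ≤ δ) (hx : x₂ - x₁ ≤ δ)
    (htm : t ∈ Icc t₁ t₂)
    (ha : ∃ t ∈ Icc t₁ t₂, (t, x₁) ∈ Arm T f κ₁ κ₂ ε n)
    (hb : ∃ t ∈ Icc t₁ t₂, (t, x₂) ∈ Arm T f κ₁ κ₂ ε n) :
    |f t x₂ - f t x₁ - κ₂ * (x₂ - x₁)| ≤ 4 * (ε * δ) := by
  obtain ⟨x', hx', -, a2, -⟩ := ha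
  obtain ⟨x'', hx'', -, b2, b1⟩ := hb
  dsimp only at a2 b1 b2
  obtain ⟨m1, m2⟩ := htm
  obtain ⟨m3, m4⟩ := hx'
  obtain ⟨m5, m6⟩ := hx''
  have d1 : ∀ u v, t₁ ≤ u → u ≤ t₂ → t₁ ≤ v → v ≤ t₂ → |u - v| ≤ δ := fun u v _ _ _ _ => by
    rw [abs_le]; constructor <;> linarith
  have d2 : |x₁ - x₂| ≤ δ := by rw [abs_le]; constructor <;> linarith
  have c1 := (b2 t ⟨by linarith, by linarith⟩ ((d1 t x'' m1 m2 m5 m6).trans_lt hδ)).trans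
    (mul_le_mul_of_nonneg_left (d1 t x'' m1 m2 m5 m6) hε.le)
  have c2 := (a2 t ⟨by linarith, by linarith⟩ ((d1 t x' m1 m2 m3 m4).trans_lt hδ)).trans
    (mul_le_mul_of_nonneg_left (d1 t x' m1 m2 m3 m4) hε.le)
  have c3 := (a2 x'' ⟨by linarith, by linarith⟩ ((d1 x'' x' m5 m6 m3 m4).trans_lt hδ)).trans
    (mul_le_mul_of_nonneg_left (d1 x'' x' m5 m6 m3 m4) hε.le)
  have c4 := (b1 x₁ ⟨by linarith, by linarith⟩ (d2.trans_lt hδ)).trans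
    (mul_le_mul_of_nonneg_left d2 hε.le)
  rw [abs_le] at c1 c2 c3 c4 ⊢
  constructor <;> linarith [c1.1, c1.2, c2.1, c2.2, c3.1, c3.2, c4.1, c4.2]

lemma abs_integral_sub_const_le {g : ℝ → ℝ} (hg : Continuous g) {a b k C : ℝ} (hab : a ≤ b)
    (h : ∀ x ∈ Icc a b, |g x - k| ≤ C) : |(∫ x in a..b, g x) - k * (b - a)| ≤ C * (b - a) := by
  have h1 : (∫ x in a..b, g x) - k * (b - a) = ∫ x in a..b, (g x - k) := by
    rw [intervalIntegral.integral_sub (hg.intervalIntegrable _ _) intervalIntegrable_const]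
    simp; ring
  rw [h1, ← abs_of_nonneg (sub_nonneg.2 hab)]
  refine intervalIntegral.norm_integral_le_of_norm_le_const (f := fun x => g x - k) (C := C)
    fun x hx => h x ?_
  rw [uIoc_of_le hab] at hx
  exact Ioc_subset_Icc_self hx

lemma rectInc_primX {u : ℝ → ℝ → ℝ} (hu : SepBdd u) (t₁ t₂ x₁ x₂ : ℝ) :
    rectInc (primX u) t₁ t₂ x₁ x₂ = ∫ x in x₁..x₂, (u t₂ x - u t₁ x) := by
  rw [intervalIntegral.integral_sub (hu.intervalIntegrableX _ _ _) (hu.intervalIntegrableX _ _ _),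
    ← primX_sub hu, ← primX_sub hu]
  unfold rectInc; ring

lemma rectInc_primT {u : ℝ → ℝ → ℝ} (hu : SepBdd u) (t₁ t₂ x₁ x₂ : ℝ) :
    rectInc (primT u) t₁ t₂ x₁ x₂ = ∫ t in t₁..t₂, (u t x₂ - u t x₁) := by
  rw [intervalIntegral.integral_sub (hu.intervalIntegrableT _ _ _) (hu.intervalIntegrableT _ _ _),
    ← primT_sub hu, ← primT_sub hu]
  unfold rectInc; ring

/-- A Looman–Menchoff type theorem: a separately differentiable, bounded field with zero divergence
has zero flux through every rectangle. -/
theorem rectInc_eq_zero_of_div_eq_zero {u v : ℝ → ℝ → ℝ} (hu : SepBdd u) (hv : SepBdd v) {T : ℝ}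
    (hdiv : ∀ t ∈ Icc 0 T, ∀ x ∈ Icc (0:ℝ) 1, ∃ α₁ α₂ α₃ α₄ : ℝ, α₁ + α₄ = 0 ∧
      HasDerivWithinAt (fun s => u s x) α₁ (Icc 0 T) t ∧
      HasDerivWithinAt (fun y => u t y) α₂ (Icc 0 1) x ∧
      HasDerivWithinAt (fun s => v s x) α₃ (Icc 0 T) t ∧
      HasDerivWithinAt (fun y => v t y) α₄ (Icc 0 1) x)
    {t₁ t₂ x₁ x₂ : ℝ} (h1 : 0 ≤ t₁) (h2 : t₁ ≤ t₂) (h3 : t₂ ≤ T) (h4 : 0 ≤ x₁) (h5 : x₁ ≤ x₂)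
    (h6 : x₂ ≤ 1) : rectInc (primX u) t₁ t₂ x₁ x₂ + rectInc (primT v) t₁ t₂ x₁ x₂ = 0 := by
  set H : ℝ → ℝ → ℝ := fun t x => primX u t x + primT v t x with hHdef
  have hH : Continuous fun p : ℝ × ℝ => H p.1 p.2 := (continuous_primX hu).add (continuous_primT hv)
  have hsplit : ∀ t₁ t₂ x₁ x₂, rectInc H t₁ t₂ x₁ x₂ =
      rectInc (primX u) t₁ t₂ x₁ x₂ + rectInc (primT v) t₁ t₂ x₁ x₂ := fun t₁ t₂ x₁ x₂ => by
    simp only [rectInc, hHdef]; ring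
  rw [← hsplit]
  have key : ∀ ε > 0, |rectInc H t₁ t₂ x₁ x₂| ≤ 4 * (10 * ε) * ((t₂ - t₁) * (x₂ - x₁)) := by
    intro ε hε
    refine rectInc_le_of_local hH (by positivity : 0 < 10 * ε)
      (ι := {i : ℕ × ℚ × ℚ × ℚ × ℚ // |((i.2.1 : ℝ) + i.2.2.2.2)| ≤ 2 * ε})
      (E := fun i => Arm T u i.1.2.1 i.1.2.2.1 ε i.1.1 ∩ Arm T v i.1.2.2.2.1 i.1.2.2.2.2 ε i.1.1)
      (fun i => (isClosed_arm hu _ _ _ _).inter (isClosed_arm hv _ _ _ _)) ?_ ?_ h1 h2 h3 h4 h5 h6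
    · rintro ⟨t, x⟩ ⟨ht, hx⟩
      obtain ⟨α₁, α₂, α₃, α₄, hα, d1, d2, d3, d4⟩ := hdiv t ht x hx
      have hq : ∀ α : ℝ, ∃ q : ℚ, |α - q| < ε := fun α => by
        obtain ⟨q, hq1, hq2⟩ := exists_rat_btwn (sub_lt_self α hε)
        exact ⟨q, by rw [abs_lt]; constructor <;> linarith⟩
      obtain ⟨q₁, e1⟩ := hq α₁
      obtain ⟨q₂, e2⟩ := hq α₂
      obtain ⟨q₃, e3⟩ := hq α₃
      obtain ⟨q₄, e4⟩ := hq α₄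
      obtain ⟨n, hn⟩ := exists_mem_arm (p := (t, x)) ht hx d1 d2 e1 e2
      obtain ⟨m, hm⟩ := exists_mem_arm (p := (t, x)) ht hx d3 d4 e3 e4
      refine mem_iUnion.2 ⟨⟨(max n m, q₁, q₂, q₃, q₄), ?_⟩, hn _ (le_max_left _ _),
        hm _ (le_max_right _ _)⟩
      dsimp only
      rw [abs_lt] at e1 e4
      rw [abs_le]; constructor <;> linarith [e1.1, e1.2, e4.1, e4.2]
    · rintro ⟨⟨n, q₁, q₂, q₃, q₄⟩, hq⟩
      dsimp only at hq ⊢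
      have hn : (0:ℝ) < 1 / (n + 1) := by positivity
      refine ⟨1 / (n + 1) / 2, half_pos hn, ?_⟩
      intro δ hδ s t x y k1 k2 k3 k4 k5 k6 k7 k8 ha hb hc hd
      have hδ' : δ < 1 / ((n:ℝ) + 1) := by linarith
      have hA : |rectInc (primX u) s t x y - q₁ * (t - s) * (y - x)| ≤ 4 * (ε * δ) * (y - x) := by
        rw [rectInc_primX hu]
        refine abs_integral_sub_const_le ((hu.contR t).sub (hu.contR s)) k5 fun z hz => ?_
        exact arm_incr hε hδ' k1 k2 k3 k4 k6 k7 k8 hz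
          (ha.imp fun _ h => ⟨h.1, h.2.1⟩) (hb.imp fun _ h => ⟨h.1, h.2.1⟩)
      have hB : |rectInc (primT v) s t x y - q₄ * (y - x) * (t - s)| ≤ 4 * (ε * δ) * (t - s) := by
        rw [rectInc_primT hv]
        refine abs_integral_sub_const_le ((hv.contL y).sub (hv.contL x)) k2 fun z hz => ?_
        exact arm_incr' hε hδ' k1 k3 k4 k5 k6 k7 k8 hz
          (hc.imp fun _ h => ⟨h.1, h.2.2⟩) (hd.imp fun _ h => ⟨h.1, h.2.2⟩)
      have hδ0 : 0 ≤ δ := by linarith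
      have hA' : 4 * (ε * δ) * (y - x) ≤ 4 * (ε * δ) * δ :=
        mul_le_mul_of_nonneg_left k8 (by positivity)
      have hB' : 4 * (ε * δ) * (t - s) ≤ 4 * (ε * δ) * δ :=
        mul_le_mul_of_nonneg_left k7 (by positivity)
      have hC : |((q₁:ℝ) + q₄) * ((t - s) * (y - x))| ≤ 2 * ε * (δ * δ) := by
        rw [abs_mul, abs_of_nonneg (mul_nonneg (sub_nonneg.2 k2) (sub_nonneg.2 k5))]
        exact mul_le_mul hq (mul_le_mul k7 k8 (by linarith) hδ0)
          (mul_nonneg (by linarith) (by linarith)) (by positivity)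
      rw [hsplit]
      rw [abs_le] at hA hB hC ⊢
      constructor <;> nlinarith [hA.1, hA.2, hB.1, hB.2, hC.1, hC.2]
  by_contra hne
  have hpos : 0 < |rectInc H t₁ t₂ x₁ x₂| := abs_pos.2 hne
  set A := (t₂ - t₁) * (x₂ - x₁) with hAdef
  have hA0 : 0 ≤ A := mul_nonneg (sub_nonneg.2 h2) (sub_nonneg.2 h5)
  have h := key (|rectInc H t₁ t₂ x₁ x₂| / (80 * (A + 1))) (by positivity)
  have h' : 4 * (10 * (|rectInc H t₁ t₂ x₁ x₂| / (80 * (A + 1)))) * A =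
      |rectInc H t₁ t₂ x₁ x₂| / 2 * (A / (A + 1)) := by field_simp; ring
  have h'' : A / (A + 1) ≤ 1 := by rw [div_le_one (by positivity)]; linarith
  rw [h'] at h
  nlinarith

lemma hasDerivAt_comp_of_partials {Φ U V : ℝ → ℝ → ℝ}
    (h₁ : ∀ t x, HasDerivAt (fun s => Φ s x) (U t x) t)
    (h₂ : ∀ t x, HasDerivAt (fun y => Φ t y) (V t x) x)
    (hU : Continuous fun p : ℝ × ℝ => U p.1 p.2) (hV : Continuous fun p : ℝ × ℝ => V p.1 p.2)
    {p q : ℝ → ℝ} {p' q' y : ℝ} (hp : HasDerivAt p p' y) (hq : HasDerivAt q q' y) :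
    HasDerivAt (fun y => Φ (p y) (q y)) (U (p y) (q y) * p' + V (p y) (q y) * q') y := by
  have h := hasStrictFDerivAt_uncurry_coprod (𝕜 := ℝ) (u := (p y, q y)) (f := Φ)
    (f₁ := fun t x => U t x • (1 : ℝ →L[ℝ] ℝ)) (f₂ := fun t x => V t x • (1 : ℝ →L[ℝ] ℝ))
    (.of_forall fun v => by
      refine (h₁ v.1 v.2).hasFDerivAt.congr_fderiv ?_
      ext; simp [Function.HasUncurry.uncurry])
    (.of_forall fun v => by
      refine (h₂ v.1 v.2).hasFDerivAt.congr_fderiv ?_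
      ext; simp [Function.HasUncurry.uncurry])
    (hU.smul continuous_const).continuousAt (hV.smul continuous_const).continuousAt
  have h' := h.hasFDerivAt.comp_hasDerivAt y (hp.prodMk hq)
  refine h'.congr_deriv ?_
  simp [Function.HasUncurry.uncurry]

/-- The double primitive. -/
noncomputable def primTX (w : ℝ → ℝ → ℝ) (t x : ℝ) : ℝ := ∫ s in (0:ℝ)..t, primX w s x

lemma SepBdd.measurable_uncurry {w : ℝ → ℝ → ℝ} (hw : SepBdd w) :
    Measurable (Function.uncurry w) :=
  measurable_uncurry_of_continuous_of_measurable hw.contL fun t => (hw.contR t).measurable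

lemma primTX_eq {w : ℝ → ℝ → ℝ} (hw : SepBdd w) (t x : ℝ) :
    primTX w t x = ∫ y in (0:ℝ)..x, primT w t y := by
  obtain ⟨C, hC⟩ := hw.bdd
  refine intervalIntegral_intervalIntegral_swap ?_
  refine Measure.integrableOn_of_bounded (M := C) ?_ hw.measurable_uncurry.aestronglyMeasurable
    (ae_of_all _ fun p => hC _ _)
  rw [Measure.volume_eq_prod, Measure.prod_prod]
  exact ENNReal.mul_ne_top (by simp [uIoc]) (by simp [uIoc])

lemma hasDerivAt_primTX_left {w : ℝ → ℝ → ℝ} (hw : SepBdd w) (t x : ℝ) :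
    HasDerivAt (fun s => primTX w s x) (primX w t x) t := by
  have hc : Continuous fun s => primX w s x :=
    (continuous_primX hw).comp (continuous_id.prodMk continuous_const)
  exact intervalIntegral.integral_hasDerivAt_right (hc.intervalIntegrable _ _)
    (hc.stronglyMeasurableAtFilter _ _) hc.continuousAt

lemma hasDerivAt_primTX_right {w : ℝ → ℝ → ℝ} (hw : SepBdd w) (t x : ℝ) :
    HasDerivAt (fun y => primTX w t y) (primT w t x) x := by
  have hc : Continuous fun y => primT w t y :=
    (continuous_primT hw).comp (continuous_const.prodMk continuous_id)
  have h := intervalIntegral.integral_hasDerivAt_right (hc.intervalIntegrable 0 x)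
    (hc.stronglyMeasurableAtFilter _ _) hc.continuousAt
  exact h.congr_of_eventuallyEq (.of_forall fun y => primTX_eq hw t y)

/-- The average of `w` over the box `[t, t + d] × [x, x + e]`. -/
noncomputable def boxAvg (w : ℝ → ℝ → ℝ) (d e t x : ℝ) : ℝ :=
  rectInc (primTX w) t (t + d) x (x + e) / (d * e)

/-- The `t`-derivative of `boxAvg`. -/
noncomputable def boxAvgDeriv (w : ℝ → ℝ → ℝ) (d e t x : ℝ) : ℝ :=
  rectInc (primX w) t (t + d) x (x + e) / (d * e)

lemma boxAvg_eq {w : ℝ → ℝ → ℝ} (hw : SepBdd w) (d e t x : ℝ) :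
    boxAvg w d e t x = (∫ s in t..t + d, ∫ y in x..x + e, w s y) / (d * e) := by
  have hc : ∀ x, Continuous fun s => primX w s x := fun x =>
    (continuous_primX hw).comp (continuous_id.prodMk continuous_const)
  unfold boxAvg
  congr 1
  simp_rw [← primX_sub hw]
  rw [intervalIntegral.integral_sub ((hc _).intervalIntegrable _ _) ((hc _).intervalIntegrable _ _),
    ← intervalIntegral.integral_interval_sub_left ((hc (x + e)).intervalIntegrable 0 (t + d))
      ((hc (x + e)).intervalIntegrable 0 t),
    ← intervalIntegral.integral_interval_sub_left ((hc x).intervalIntegrable 0 (t + d))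
      ((hc x).intervalIntegrable 0 t)]
  unfold rectInc primTX
  ring

lemma boxAvg_le {w : ℝ → ℝ → ℝ} (hw : SepBdd w) {d e t x C : ℝ} (hd : 0 < d) (he : 0 < e)
    (h : ∀ s ∈ Icc t (t + d), ∀ y ∈ Icc x (x + e), w s y ≤ C) : boxAvg w d e t x ≤ C := by
  have hc : ∀ x, Continuous fun s => primX w s x := fun x =>
    (continuous_primX hw).comp (continuous_id.prodMk continuous_const)
  rw [boxAvg_eq hw, div_le_iff₀ (mul_pos hd he)]
  have h1 : ∀ s ∈ Icc t (t + d), ∫ y in x..x + e, w s y ≤ e * C := fun s hs => by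
    have := intervalIntegral.integral_mono_on (by linarith) (hw.intervalIntegrableX s x (x + e))
      (intervalIntegrable_const (c := C)) (fun y hy => h s hs y hy)
    simpa using this
  have h2 : IntervalIntegrable (fun s => ∫ y in x..x + e, w s y) volume t (t + d) := by
    simp_rw [← primX_sub hw]
    exact ((hc _).sub (hc _)).intervalIntegrable _ _
  have := intervalIntegral.integral_mono_on (by linarith) h2
    (intervalIntegrable_const (c := e * C)) h1
  simp only [intervalIntegral.integral_const, add_sub_cancel_left, smul_eq_mul] at this
  linarith

lemma boxAvg_neg (w : ℝ → ℝ → ℝ) (d e t x : ℝ) :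
    boxAvg (fun t x => - w t x) d e t x = - boxAvg w d e t x := by
  simp [boxAvg, rectInc, primTX, primX]
  ring

lemma SepBdd.neg {w : ℝ → ℝ → ℝ} (hw : SepBdd w) : SepBdd fun t x => - w t x :=
  ⟨fun x => (hw.contL x).neg, fun t => (hw.contR t).neg, by
    obtain ⟨C, hC⟩ := hw.bdd
    exact ⟨C, fun t x => by simpa using hC t x⟩⟩

lemma SepBdd.sub {w b : ℝ → ℝ → ℝ} (hw : SepBdd w) (hb : SepBdd b) :
    SepBdd fun t x => w t x - b t x :=
  ⟨fun x => (hw.contL x).sub (hb.contL x), fun t => (hw.contR t).sub (hb.contR t), by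
    obtain ⟨C, hC⟩ := hw.bdd
    obtain ⟨D, hD⟩ := hb.bdd
    exact ⟨C + D, fun t x => (abs_sub _ _).trans (add_le_add (hC t x) (hD t x))⟩⟩

lemma SepBdd.const_mul {w : ℝ → ℝ → ℝ} (c : ℝ) (hw : SepBdd w) : SepBdd fun t x => c * w t x :=
  ⟨fun x => (hw.contL x).const_mul c, fun t => (hw.contR t).const_mul c, by
    obtain ⟨C, hC⟩ := hw.bdd
    refine ⟨|c| * C, fun t x => ?_⟩
    rw [abs_mul]; exact mul_le_mul_of_nonneg_left (hC t x) (abs_nonneg c)⟩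

lemma abs_boxAvg_le {w : ℝ → ℝ → ℝ} (hw : SepBdd w) {d e t x C : ℝ} (hd : 0 < d) (he : 0 < e)
    (h : ∀ s y, |w s y| ≤ C) : |boxAvg w d e t x| ≤ C := by
  rw [abs_le]
  have h1 := boxAvg_le hw hd he (t := t) (x := x) fun s _ y _ => (abs_le.1 (h s y)).2
  have h2 := boxAvg_le hw.neg hd he (t := t) (x := x) fun s _ y _ =>
    (neg_le.1 (abs_le.1 (h s y)).1)
  rw [boxAvg_neg] at h2
  constructor <;> linarith

lemma tendsto_boxAvg_left {w : ℝ → ℝ → ℝ} (hw : SepBdd w) (e t x : ℝ) :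
    Tendsto (fun d => boxAvg w d e t x) (𝓝[>] 0) (𝓝 ((primX w t (x + e) - primX w t x) / e)) := by
  have h1 := (hasDerivAt_primTX_left hw t (x + e)).tendsto_slope_zero_right
  have h2 := (hasDerivAt_primTX_left hw t x).tendsto_slope_zero_right
  refine ((h1.sub h2).div_const e).congr fun d => ?_
  simp only [smul_eq_mul, boxAvg, rectInc]
  rw [mul_comm d e, ← div_div, div_right_comm, div_eq_inv_mul _ d]
  ring

lemma tendsto_boxAvg_right {w : ℝ → ℝ → ℝ} (hw : SepBdd w) (t x : ℝ) :
    Tendsto (fun e => (primX w t (x + e) - primX w t x) / e) (𝓝[>] 0) (𝓝 (w t x)) := by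
  have h1 : HasDerivAt (fun x => primX w t x) (w t x) x :=
    intervalIntegral.integral_hasDerivAt_right (hw.intervalIntegrableX _ _ _)
    ((hw.contR t).stronglyMeasurableAtFilter _ _) (hw.contR t).continuousAt
  refine h1.tendsto_slope_zero_right.congr fun d => ?_
  simp only [smul_eq_mul]
  rw [div_eq_inv_mul]

lemma hasDerivAt_boxAvg {w : ℝ → ℝ → ℝ} (hw : SepBdd w) (d e t x : ℝ) :
    HasDerivAt (fun s => boxAvg w d e s x) (boxAvgDeriv w d e t x) t := by
  have h : ∀ τ ξ, HasDerivAt (fun s => primTX w (s + τ) ξ) (primX w (t + τ) ξ) t := fun τ ξ =>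
    (hasDerivAt_primTX_left hw (t + τ) ξ).comp_add_const t τ
  have h0 : ∀ ξ, HasDerivAt (fun s => primTX w s ξ) (primX w t ξ) t := fun ξ =>
    hasDerivAt_primTX_left hw t ξ
  exact ((((h d _).sub (h0 _)).sub (h d _)).add (h0 _)).div_const _

lemma continuous_boxAvgDeriv {w : ℝ → ℝ → ℝ} (hw : SepBdd w) (d e : ℝ) :
    Continuous fun p : ℝ × ℝ => boxAvgDeriv w d e p.1 p.2 := by
  have h : ∀ f g : ℝ × ℝ → ℝ, Continuous f → Continuous g →
      Continuous fun p => primX w (f p) (g p) := fun f g hf hg =>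
    (continuous_primX hw).comp (hf.prodMk hg)
  refine Continuous.div_const (((Continuous.sub (Continuous.sub ?_ ?_) ?_)).add ?_) _ <;>
    exact h _ _ (by fun_prop) (by fun_prop)

/-- The transport relation `∂ₜ (w - b) + c ∂ₓ w = 0` on `[0,T] × [0,1]`. -/
def Transports (T c : ℝ) (w b : ℝ → ℝ → ℝ) : Prop :=
  ∀ t ∈ Icc 0 T, ∀ x ∈ Icc (0:ℝ) 1, ∃ α₁ α₂ β₁ β₂ : ℝ, α₁ - β₁ + c * α₂ = 0 ∧
    HasDerivWithinAt (fun s => w s x) α₁ (Icc 0 T) t ∧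
    HasDerivWithinAt (fun y => w t y) α₂ (Icc 0 1) x ∧
    HasDerivWithinAt (fun s => b s x) β₁ (Icc 0 T) t ∧
    HasDerivWithinAt (fun y => b t y) β₂ (Icc 0 1) x

lemma Transports.rectInc {T c : ℝ} {w b : ℝ → ℝ → ℝ} (h : Transports T c w b) (hw : SepBdd w)
    (hb : SepBdd b) {t₁ t₂ x₁ x₂ : ℝ} (h1 : 0 ≤ t₁) (h2 : t₁ ≤ t₂) (h3 : t₂ ≤ T) (h4 : 0 ≤ x₁)
    (h5 : x₁ ≤ x₂) (h6 : x₂ ≤ 1) :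
    rectInc (primX w) t₁ t₂ x₁ x₂ + c * rectInc (primT w) t₁ t₂ x₁ x₂ =
      rectInc (primX b) t₁ t₂ x₁ x₂ := by
  have key := rectInc_eq_zero_of_div_eq_zero (hw.sub hb) (hw.const_mul c) (T := T) (by
    intro t ht x hx
    obtain ⟨α₁, α₂, β₁, β₂, h0, d1, d2, d3, d4⟩ := h t ht x hx
    exact ⟨α₁ - β₁, α₂ - β₂, c * α₁, c * α₂, h0, d1.sub d3, d2.sub d4, d1.const_mul c,
      d2.const_mul c⟩) h1 h2 h3 h4 h5 h6
  rw [rectInc_primX (hw.sub hb), rectInc_primT (hw.const_mul c)] at key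
  rw [rectInc_primX hw, rectInc_primX hb, rectInc_primT hw, ← intervalIntegral.integral_const_mul]
  have e1 : (∫ x in x₁..x₂, (w t₂ x - b t₂ x - (w t₁ x - b t₁ x))) =
      (∫ x in x₁..x₂, (w t₂ x - w t₁ x)) - ∫ x in x₁..x₂, (b t₂ x - b t₁ x) := by
    have i1 : IntervalIntegrable (fun x => w t₂ x - w t₁ x) volume x₁ x₂ :=
      ((hw.contR _).sub (hw.contR _)).intervalIntegrable _ _
    have i2 : IntervalIntegrable (fun x => b t₂ x - b t₁ x) volume x₁ x₂ :=
      ((hb.contR _).sub (hb.contR _)).intervalIntegrable _ _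
    rw [← intervalIntegral.integral_sub i1 i2]
    congr 1; ext x; ring
  have e2 : (∫ t in t₁..t₂, (c * w t x₂ - c * w t x₁)) =
      ∫ t in t₁..t₂, c * (w t x₂ - w t x₁) := by
    congr 1; ext x; ring
  rw [e1, e2] at key
  linarith

lemma Transports.boxAvg_sub {T c : ℝ} {w b : ℝ → ℝ → ℝ} (h : Transports T c w b) (hw : SepBdd w)
    (hb : SepBdd b) (hc : 0 < c) {t X y₁ y₂ d e : ℝ} (hd : 0 < d) (he : 0 < e) (hy : y₁ ≤ y₂)
    (ht : y₂ ≤ c * t) (hX : y₂ ≤ X) (htd : t - y₁ / c + d ≤ T) (hXe : X - y₁ + e ≤ 1) :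
    boxAvg w d e (t - y₁ / c) (X - y₁) - boxAvg w d e (t - y₂ / c) (X - y₂) =
      ∫ y in y₁..y₂, boxAvgDeriv b d e (t - y / c) (X - y) / c := by
  have hcont : Continuous fun y => boxAvgDeriv b d e (t - y / c) (X - y) / c :=
    ((continuous_boxAvgDeriv hb d e).comp
      (by fun_prop : Continuous fun y : ℝ => (t - y / c, X - y))).div_const c
  have hder : ∀ y ∈ uIcc y₁ y₂, HasDerivAt (fun y => - boxAvg w d e (t - y / c) (X - y))
      (boxAvgDeriv b d e (t - y / c) (X - y) / c) y := by
    intro y hy'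
    rw [uIcc_of_le hy] at hy'
    have hp : ∀ τ, HasDerivAt (fun y => t - y / c + τ) (-(1 / c)) y := fun τ =>
      (((hasDerivAt_id y).div_const c).const_sub t).add_const τ
    have hp0 : HasDerivAt (fun y => t - y / c) (-(1 / c)) y :=
      ((hasDerivAt_id y).div_const c).const_sub t
    have hq : ∀ ξ, HasDerivAt (fun y => X - y + ξ) (-1) y := fun ξ =>
      ((hasDerivAt_id y).const_sub X).add_const ξ
    have hq0 : HasDerivAt (fun y => X - y) (-1) y := (hasDerivAt_id y).const_sub X
    have hcomp := fun {p q : ℝ → ℝ} {p' q' : ℝ} (hp : HasDerivAt p p' y)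
      (hq : HasDerivAt q q' y) => hasDerivAt_comp_of_partials (hasDerivAt_primTX_left hw)
        (hasDerivAt_primTX_right hw) (continuous_primX hw) (continuous_primT hw) hp hq
    have H := (((((hcomp (hp d) (hq e)).sub (hcomp hp0 (hq e))).sub (hcomp (hp d) hq0)).add
      (hcomp hp0 hq0)).div_const (d * e)).neg
    have hy1 : y / c ≤ t := by rw [div_le_iff₀ hc]; linarith [hy'.2]
    have hy2 : y₁ / c ≤ y / c := div_le_div_of_nonneg_right hy'.1 hc.le
    have hL := h.rectInc hw hb (t₁ := t - y / c) (t₂ := t - y / c + d) (x₁ := X - y)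
      (x₂ := X - y + e) (by linarith) (by linarith) (by linarith) (by linarith [hy'.2])
      (by linarith) (by linarith [hy'.1])
    refine H.congr_deriv ?_
    unfold boxAvgDeriv
    rw [← hL]
    unfold _root_.rectInc
    field_simp
    ring
  rw [intervalIntegral.integral_eq_sub_of_hasDerivAt hder (hcont.intervalIntegrable _ _)]
  ring

lemma boxAvg_shift_sub_le {w : ℝ → ℝ → ℝ} (hw : SepBdd w) {d e s₁ s₂ x C : ℝ} (hd : 0 < d)
    (he : 0 < e)
    (h : ∀ σ ∈ Icc 0 d, ∀ y ∈ Icc x (x + e), w (s₁ + σ) y - w (s₂ + σ) y ≤ C) :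
    boxAvg w d e s₁ x - boxAvg w d e s₂ x ≤ C := by
  have hv : SepBdd fun s y => w (s + s₂) y := ⟨fun y => (hw.contL y).comp (by fun_prop),
    fun s => hw.contR _, by obtain ⟨C, hC⟩ := hw.bdd; exact ⟨C, fun _ _ => hC _ _⟩⟩
  have hu : SepBdd fun s y => w (s + s₁) y := ⟨fun y => (hw.contL y).comp (by fun_prop),
    fun s => hw.contR _, by obtain ⟨C, hC⟩ := hw.bdd; exact ⟨C, fun _ _ => hC _ _⟩⟩
  have hX : ∀ {v : ℝ → ℝ → ℝ}, SepBdd v → Continuous fun s => ∫ y in x..x + e, v s y := by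
    intro v hv
    simp_rw [← primX_sub hv]
    exact ((continuous_primX hv).comp (continuous_id.prodMk continuous_const)).sub
      ((continuous_primX hv).comp (continuous_id.prodMk continuous_const))
  have key := boxAvg_le (hu.sub hv) hd he (t := 0) (x := x) (C := C) (by
    intro s hs y hy
    rw [zero_add] at hs
    have := h s hs y hy
    rwa [add_comm s₁, add_comm s₂] at this)
  have e0 : ∀ r, boxAvg (fun s y => w (s + r) y) d e 0 x = boxAvg w d e r x := by
    intro r
    have hr : SepBdd fun s y => w (s + r) y := ⟨fun y => (hw.contL y).comp (by fun_prop),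
      fun s => hw.contR _, by obtain ⟨C, hC⟩ := hw.bdd; exact ⟨C, fun _ _ => hC _ _⟩⟩
    rw [boxAvg_eq hr, boxAvg_eq hw,
      intervalIntegral.integral_comp_add_right (fun s => ∫ y in x..x + e, w s y)]
    rw [zero_add, zero_add, add_comm d]
  rw [← e0 s₁, ← e0 s₂]
  refine le_trans (le_of_eq ?_) key
  rw [boxAvg_eq hu, boxAvg_eq hv, boxAvg_eq (hu.sub hv), ← sub_div,
    ← intervalIntegral.integral_sub ((hX hu).intervalIntegrable _ _)
      ((hX hv).intervalIntegrable _ _)]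
  congr 2
  ext s
  rw [← intervalIntegral.integral_sub (hu.intervalIntegrableX _ _ _)
    (hv.intervalIntegrableX _ _ _)]

lemma bounded_boxAvgDeriv {w : ℝ → ℝ → ℝ} (hw : SepBdd w) (d e : ℝ) :
    ∃ C, ∀ t x, |boxAvgDeriv w d e t x| ≤ C := by
  obtain ⟨C, hC⟩ := hw.bdd
  refine ⟨(C * |e| + C * |e|) / |d * e|, fun t x => ?_⟩
  have h : ∀ s, |primX w s (x + e) - primX w s x| ≤ C * |e| := fun s => by
    rw [primX_sub hw]
    have := intervalIntegral.norm_integral_le_of_norm_le_const (f := fun y => w s y) (C := C)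
      (a := x) (b := x + e) fun y _ => hC s y
    simpa using this
  unfold boxAvgDeriv rectInc
  rw [abs_div]
  refine div_le_div_of_nonneg_right ?_ (abs_nonneg _)
  calc _ = |(primX w (t + d) (x + e) - primX w (t + d) x) -
      (primX w t (x + e) - primX w t x)| := by congr 1; ring
    _ ≤ _ := (abs_sub _ _).trans (add_le_add (h _) (h _))

lemma boxAvgDeriv_nonneg {b : ℝ → ℝ → ℝ} (hb : SepBdd b) {d e t x : ℝ} (hd : 0 < d) (he : 0 < e)
    (h : ∀ y ∈ Icc x (x + e), b t y ≤ b (t + d) y) : 0 ≤ boxAvgDeriv b d e t x := by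
  refine div_nonneg ?_ (mul_pos hd he).le
  rw [rectInc_primX hb]
  exact intervalIntegral.integral_nonneg (by linarith) fun y hy => sub_nonneg.2 (h y hy)

/-- The increment of `w` along the part of the backward characteristic
`y ↦ (t - y / c, X - y)`, `y ∈ [y₀, X]`, that lies in `{t ≥ 0}`. -/
noncomputable def legVal (w : ℝ → ℝ → ℝ) (c t y₀ X : ℝ) : ℝ :=
  w (t - min y₀ (c * t) / c) (X - min y₀ (c * t)) - w (t - min X (c * t) / c) (X - min X (c * t))

/-- The increment of the box average of `w` along a truncated characteristic. -/
noncomputable def legAvg (w : ℝ → ℝ → ℝ) (c t y₀ X d e : ℝ) : ℝ :=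
  boxAvg w d e (t - min y₀ (c * t) / c) (X - min y₀ (c * t)) -
    boxAvg w d e (t - min X (c * t) / c) (X - min X (c * t))

lemma tendsto_legVal_sub {w : ℝ → ℝ → ℝ} (hw : SepBdd w) {c t y₀ X : ℝ} :
    Tendsto (fun δ => legVal w c t y₀ (X - δ)) (𝓝[>] 0) (𝓝 (legVal w c t y₀ X)) := by
  have hid : Tendsto (fun δ : ℝ => X - δ) (𝓝[>] 0) (𝓝 X) := by
    have : Tendsto (fun δ : ℝ => X - δ) (𝓝 0) (𝓝 (X - 0)) :=
      (continuous_const.sub continuous_id).tendsto 0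
    rw [sub_zero] at this
    exact this.mono_left nhdsWithin_le_nhds
  unfold legVal
  have hR : ∀ s y, Tendsto (fun δ : ℝ => w s (X - δ - y)) (𝓝[>] 0) (𝓝 (w s (X - y))) := fun s y =>
    ((hw.contR s).tendsto _).comp (hid.sub_const y)
  refine (hR _ _).sub ?_
  rcases le_or_gt X (c * t) with h | h
  · have : Tendsto (fun δ : ℝ => w (t - (X - δ) / c) 0) (𝓝[>] 0) (𝓝 (w (t - X / c) 0)) :=
      ((hw.contL 0).tendsto _).comp ((hid.div_const c).const_sub t)
    rw [min_eq_left h, sub_self]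
    refine this.congr' ?_
    filter_upwards [self_mem_nhdsWithin] with δ hδ
    have hδ' : (0:ℝ) < δ := hδ
    rw [min_eq_left (by linarith), sub_self]
  · rw [min_eq_right h.le]
    refine (hR _ _).congr' ?_
    filter_upwards [Ioo_mem_nhdsGT (sub_pos.2 h)] with δ hδ
    rw [min_eq_right (by linarith [hδ.2])]

/-- The increment of the spatial average of `w` along a truncated characteristic. -/
noncomputable def legAvgX (w : ℝ → ℝ → ℝ) (c t y₀ X e : ℝ) : ℝ :=
  (primX w (t - min y₀ (c * t) / c) (X - min y₀ (c * t) + e) -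
      primX w (t - min y₀ (c * t) / c) (X - min y₀ (c * t))) / e -
    (primX w (t - min X (c * t) / c) (X - min X (c * t) + e) -
      primX w (t - min X (c * t) / c) (X - min X (c * t))) / e

lemma tendsto_legAvg {w : ℝ → ℝ → ℝ} (hw : SepBdd w) (c t y₀ X e : ℝ) :
    Tendsto (fun d => legAvg w c t y₀ X d e) (𝓝[>] 0) (𝓝 (legAvgX w c t y₀ X e)) :=
  (tendsto_boxAvg_left hw _ _ _).sub (tendsto_boxAvg_left hw _ _ _)

lemma tendsto_legAvgX {w : ℝ → ℝ → ℝ} (hw : SepBdd w) (c t y₀ X : ℝ) :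
    Tendsto (fun e => legAvgX w c t y₀ X e) (𝓝[>] 0) (𝓝 (legVal w c t y₀ X)) :=
  (tendsto_boxAvg_right hw _ _).sub (tendsto_boxAvg_right hw _ _)

lemma Transports.legAvg_eq {T c : ℝ} {w b : ℝ → ℝ → ℝ} (h : Transports T c w b) (hw : SepBdd w)
    (hb : SepBdd b) (hc : 0 < c) {t y₀ X d e : ℝ} (hd : 0 < d) (he : 0 < e)
    (hy₀ : 0 ≤ y₀) (hX : y₀ ≤ X) (htd : t + d ≤ T) (hXe : X - y₀ + e ≤ 1) :
    legAvg w c t y₀ X d e =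
      ∫ y in min y₀ (c * t)..min X (c * t), boxAvgDeriv b d e (t - y / c) (X - y) / c := by
  rcases le_or_gt (c * t) y₀ with h1 | h1
  · simp [legAvg, min_eq_right h1, min_eq_right (h1.trans hX)]
  · rw [min_eq_left h1.le]
    have := h.boxAvg_sub hw hb hc hd he (t := t) (X := X) (y₁ := y₀) (y₂ := min X (c * t))
      (le_min hX h1.le) (min_le_right _ _) (min_le_left _ _)
      (by have := div_nonneg hy₀ hc.le; linarith) hXe
    rw [← this, legAvg, min_eq_left h1.le]

/-- If `b` is nondecreasing in time, then `w` decreases along backward characteristics. -/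
lemma Transports.legVal_nonneg {T c : ℝ} {w b : ℝ → ℝ → ℝ} (h : Transports T c w b)
    (hw : SepBdd w) (hb : SepBdd b) (hc : 0 < c) {t y₀ X : ℝ} (htT : t < T)
    (hy₀ : 0 ≤ y₀) (hX : y₀ ≤ X) (hX1 : X - y₀ ≤ 1)
    (hmono : ∀ x ∈ Icc (0:ℝ) 1, ∀ s₁ ∈ Icc 0 T, ∀ s₂ ∈ Icc 0 T, s₁ ≤ s₂ → b s₁ x ≤ b s₂ x) :
    0 ≤ legVal w c t y₀ X := by
  have main : ∀ X, y₀ ≤ X → X - y₀ < 1 → 0 ≤ legVal w c t y₀ X := by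
    intro X hX hX1
    refine ge_of_tendsto (tendsto_legAvgX hw c t y₀ X) ?_
    filter_upwards [Ioo_mem_nhdsGT (sub_pos.2 hX1)] with e he
    refine ge_of_tendsto (tendsto_legAvg hw c t y₀ X e) ?_
    filter_upwards [Ioo_mem_nhdsGT (sub_pos.2 htT)] with d hd
    rw [h.legAvg_eq hw hb hc hd.1 he.1 hy₀ hX (by linarith [hd.2]) (by linarith [he.2])]
    rcases le_or_gt (c * t) y₀ with h1 | h1
    · simp [min_eq_right h1, min_eq_right (h1.trans hX)]
    rw [min_eq_left h1.le]
    refine intervalIntegral.integral_nonneg (le_min hX h1.le) fun y hy => ?_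
    have hyt : y / c ≤ t := by
      rw [div_le_iff₀ hc]; linarith [hy.2.trans (min_le_right _ _)]
    have hyX := hy.2.trans (min_le_left _ _)
    have hy0 : 0 ≤ y / c := div_nonneg (hy₀.trans hy.1) hc.le
    refine div_nonneg (boxAvgDeriv_nonneg hb hd.1 he.1 fun ξ hξ => ?_) hc.le
    exact hmono ξ ⟨by linarith [hξ.1], by linarith [hξ.2, he.2, hy.1]⟩ _
      ⟨by linarith, by linarith⟩ _ ⟨by linarith [hd.1], by linarith [hd.2]⟩ (by linarith [hd.1])
  rcases hX1.lt_or_eq with h1 | h1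
  · exact main X hX h1
  · refine ge_of_tendsto (tendsto_legVal_sub hw) ?_
    filter_upwards [Ioo_mem_nhdsGT (zero_lt_one (α := ℝ))] with δ hδ
    exact main _ (by linarith [hδ.2]) (by linarith [hδ.1])

/-- Bounds from below on `∫ μ in ε..1, ℓ μ`, together with measurability. -/
def IntLower (ε E : ℝ) (ℓ : ℝ → ℝ) : Prop :=
  AEStronglyMeasurable ℓ (volume.restrict (Ioc ε 1)) ∧ -E ≤ ∫ μ in Ioc ε 1, ℓ μ

lemma IntLower.of_tendsto {ε E C : ℝ} {F : ℝ → ℝ → ℝ} {ℓ : ℝ → ℝ}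
    (h : ∀ᶠ d in 𝓝[>] (0:ℝ), IntLower ε E (F d) ∧ ∀ μ ∈ Ioc ε 1, |F d μ| ≤ C)
    (hl : ∀ μ ∈ Ioc ε 1, Tendsto (fun d => F d μ) (𝓝[>] 0) (𝓝 (ℓ μ))) :
    IntLower ε E ℓ := by
  have hae : ∀ᵐ μ ∂(volume.restrict (Ioc ε 1)), Tendsto (fun d => F d μ) (𝓝[>] 0) (𝓝 (ℓ μ)) :=
    (ae_restrict_iff' measurableSet_Ioc).2 (ae_of_all _ hl)
  refine ⟨?_, ?_⟩
  · obtain ⟨u, hu⟩ := (𝓝[>] (0:ℝ)).exists_seq_tendsto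
    obtain ⟨N, hN⟩ := eventually_atTop.1 (hu.eventually h)
    refine aestronglyMeasurable_of_tendsto_ae (u := atTop) (f := fun n => F (u (n + N)))
      (fun n => (hN _ (Nat.le_add_left _ _)).1.1) ?_
    filter_upwards [hae] with μ hμ
    exact hμ.comp (hu.comp (tendsto_add_atTop_nat N))
  · refine ge_of_tendsto (tendsto_integral_filter_of_dominated_convergence (fun _ => C)
      (h.mono fun d hd => hd.1.1) (h.mono fun d hd => ?_) (integrable_const C) hae)
      (h.mono fun d hd => hd.1.2)
    exact (ae_restrict_iff' measurableSet_Ioc).2 (ae_of_all _ hd.2)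

lemma IntLower.congr {ε E : ℝ} {ℓ ℓ' : ℝ → ℝ} (h : IntLower ε E ℓ)
    (he : ∀ μ ∈ Ioc ε 1, ℓ μ = ℓ' μ) : IntLower ε E ℓ' := by
  have hae : ℓ =ᵐ[volume.restrict (Ioc ε 1)] ℓ' :=
    (ae_restrict_iff' measurableSet_Ioc).2 (ae_of_all _ he)
  exact ⟨h.1.congr hae, by rw [← integral_congr_ae hae]; exact h.2⟩

/-- One-dimensional form of the cone estimate. -/
lemma integral_div_ge_of_sub_le {k g : ℝ → ℝ} {y ω m c : ℝ} (hy : 0 < y) (hω : 0 < ω)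
    (hm : 0 < m) (hm1 : m ≤ 1)
    (hk : ∀ μ ∈ Icc m 1, HasDerivAt k (g μ * (y / (μ ^ 2 * ω))) μ)
    (hg : ContinuousOn g (Icc m 1))
    (hkd : ∀ μ ∈ Icc m 1, k μ - k 1 ≤ c * y / √μ) :
    -(2 * c) ≤ ∫ μ in m..1, g μ / (μ * ω) := by
  have hpos : ∀ μ ∈ Icc m 1, 0 < μ := fun μ hμ => hm.trans_le hμ.1
  have hc0 : 0 ≤ c := by
    have := hkd 1 (right_mem_Icc.2 hm1)
    simp only [sub_self, Real.sqrt_one, div_one] at this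
    exact nonneg_of_mul_nonneg_left this hy
  have hder : ∀ μ ∈ uIcc m 1, HasDerivAt (fun μ => μ / y * (k μ - k 1) - 2 * c * √μ)
      (1 / y * (k μ - k 1) + μ / y * (g μ * (y / (μ ^ 2 * ω))) - 2 * c * (1 / (2 * √μ))) μ := by
    intro μ hμ
    rw [uIcc_of_le hm1] at hμ
    exact (((hasDerivAt_id μ).div_const y).mul ((hk μ hμ).sub_const _)).sub
      ((Real.hasDerivAt_sqrt (hpos μ hμ).ne').const_mul _)
  have hkc : ContinuousOn k (Icc m 1) := fun μ hμ => (hk μ hμ).continuousAt.continuousWithinAt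
  have hci : ContinuousOn (fun μ => 1 / y * (k μ - k 1) + μ / y * (g μ * (y / (μ ^ 2 * ω))) -
      2 * c * (1 / (2 * √μ))) (uIcc m 1) := by
    rw [uIcc_of_le hm1]
    refine ContinuousOn.sub (ContinuousOn.add (by fun_prop) (ContinuousOn.mul (by fun_prop)
      (hg.mul (continuousOn_const.div (by fun_prop) ?_)))) (continuousOn_const.mul
      (continuousOn_const.div (by fun_prop) ?_))
    · intro μ hμ; have := hpos μ hμ; positivity
    · intro μ hμ; have := hpos μ hμ; positivity
  have hint := intervalIntegral.integral_eq_sub_of_hasDerivAt hder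
    (hci.intervalIntegrable (μ := volume))
  have hcg : ContinuousOn (fun μ => g μ / (μ * ω)) (uIcc m 1) := by
    rw [uIcc_of_le hm1]
    refine hg.div (by fun_prop) ?_
    intro μ hμ; have := hpos μ hμ; positivity
  have hmono := intervalIntegral.integral_mono_on hm1 (hci.intervalIntegrable (μ := volume))
    (hcg.intervalIntegrable (μ := volume)) (fun μ hμ => by
      have h0 := hpos μ hμ
      have h1 := hkd μ hμ
      have h2 : 1 / y * (k μ - k 1) ≤ c / √μ := by
        rw [one_div, inv_mul_le_iff₀ hy]
        refine h1.trans (le_of_eq (by ring))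
      have h3 : μ / y * (g μ * (y / (μ ^ 2 * ω))) = g μ / (μ * ω) := by field_simp
      have h4 : 2 * c * (1 / (2 * √μ)) = c / √μ := by
        have := Real.sqrt_pos.2 h0; field_simp
      rw [h3, h4]; linarith)
  rw [hint] at hmono
  have h5 : m / y * (k m - k 1) ≤ c * √m := by
    have h1 := hkd m (left_mem_Icc.2 hm1)
    calc _ ≤ m / y * (c * y / √m) := mul_le_mul_of_nonneg_left h1 (by positivity)
      _ = c * (m / √m) := by field_simp
      _ = _ := by rw [Real.div_sqrt]
  have h6 := mul_nonneg hc0 (Real.sqrt_nonneg m)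
  simp only [sub_self, mul_zero, Real.sqrt_one] at hmono
  linarith

lemma integral_inv_sqrt_le {y₀ X : ℝ} (h0 : 0 ≤ y₀) (hX : y₀ ≤ X) (hX2 : X ≤ 2) :
    IntegrableOn (fun y => 1 / √y) (Ioc y₀ X) ∧ ∫ y in Ioc y₀ X, 1 / √y ≤ 3 := by
  have he : EqOn (fun y : ℝ => y ^ (-(1/2) : ℝ)) (fun y => 1 / √y) (Ioc y₀ X) := fun y hy => by
    have : 0 ≤ y := h0.trans hy.1.le
    simp only
    rw [Real.rpow_neg this, ← Real.sqrt_eq_rpow, one_div]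
  have hi : IntervalIntegrable (fun y : ℝ => y ^ (-(1/2) : ℝ)) volume y₀ X :=
    intervalIntegral.intervalIntegrable_rpow' (by norm_num)
  refine ⟨((intervalIntegrable_iff_integrableOn_Ioc_of_le hX).1 hi).congr_fun he
    measurableSet_Ioc, ?_⟩
  rw [← setIntegral_congr_fun measurableSet_Ioc he, ← intervalIntegral.integral_of_le hX,
    integral_rpow (Or.inl (by norm_num))]
  norm_num
  rw [← Real.sqrt_eq_rpow, ← Real.sqrt_eq_rpow]
  have h1 : √X ≤ 3 / 2 := by
    rw [Real.sqrt_le_left (by norm_num)]; linarith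
  have := Real.sqrt_nonneg y₀
  linarith

/-- Integrand of the cone integral. -/
noncomputable def coneFn (g : ℝ → ℝ → ℝ) (ω t X μ y : ℝ) : ℝ :=
  if y ≤ μ * ω * t then g (t - y / (μ * ω)) (X - y) / (μ * ω) else 0

lemma measurable_coneFn {g : ℝ → ℝ → ℝ} (hg : Continuous fun p : ℝ × ℝ => g p.1 p.2)
    (ω t X : ℝ) : Measurable (Function.uncurry (coneFn g ω t X)) := by
  refine Measurable.ite (measurableSet_le (by fun_prop) (by fun_prop)) ?_ measurable_const
  refine Measurable.div ?_ (by fun_prop)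
  exact hg.measurable.comp (by fun_prop : Measurable fun p : ℝ × ℝ =>
    (t - p.2 / (p.1 * ω), X - p.2))

lemma abs_coneFn_le {g : ℝ → ℝ → ℝ} {C ε ω t X μ : ℝ} (hC : ∀ t x, |g t x| ≤ C) (hω : 0 < ω)
    (hε : 0 < ε) (hμ : ε < μ) (y : ℝ) : |coneFn g ω t X μ y| ≤ C / (ε * ω) := by
  have hC0 : 0 ≤ C := (abs_nonneg _).trans (hC 0 0)
  unfold coneFn
  split_ifs with h
  · have hμ0 : 0 < μ := hε.trans hμ
    rw [abs_div, abs_of_pos (mul_pos hμ0 hω)]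
    exact div_le_div₀ hC0 (hC _ _) (by positivity) (mul_le_mul_of_nonneg_right hμ.le hω.le)
  · simp only [abs_zero]; positivity

lemma integral_coneFn {g : ℝ → ℝ → ℝ} {ω t X μ y₀ : ℝ} (hX : y₀ ≤ X) :
    ∫ y in Ioc y₀ X, coneFn g ω t X μ y =
      ∫ y in min y₀ (μ * ω * t)..min X (μ * ω * t), g (t - y / (μ * ω)) (X - y) / (μ * ω) := by
  have h1 : coneFn g ω t X μ = (Iic (μ * ω * t)).indicator
      fun y => g (t - y / (μ * ω)) (X - y) / (μ * ω) := by
    ext y; simp [coneFn, indicator]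
  rw [h1, setIntegral_indicator measurableSet_Iic, Ioc_inter_Iic]
  rcases le_or_gt (μ * ω * t) y₀ with h | h
  · rw [min_eq_right h, min_eq_right (h.trans hX), Ioc_eq_empty (not_lt.2 h)]
    simp
  · rw [min_eq_left h.le, intervalIntegral.integral_of_le (le_min hX h.le)]

lemma integral_coneFn_snd_ge {f g : ℝ → ℝ → ℝ} {ε ω t X κ y : ℝ}
    (hf : ∀ t x, HasDerivAt (fun s => f s x) (g t x) t)
    (hg : Continuous fun p : ℝ × ℝ => g p.1 p.2)
    (hε : 0 < ε) (hε1 : ε < 1) (hω : 0 < ω) (ht : 0 ≤ t) (hy : 0 < y) (hκ : 0 ≤ κ)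
    (hdrop : ∀ μ ∈ Ioc (0:ℝ) 1, y ≤ μ * ω * t →
      f (t - y / (μ * ω)) (X - y) - f (t - y / ω) (X - y) ≤ κ * √(y / (μ * ω))) :
    -(2 * (κ / √ω) * (1 / √y)) ≤ ∫ μ in Ioc ε 1, coneFn g ω t X μ y := by
  have hE : 0 ≤ 2 * (κ / √ω) * (1 / √y) := by positivity
  rcases ht.eq_or_lt with rfl | ht
  · have : ∀ μ, coneFn g ω 0 X μ y = 0 := fun μ => by
      simp only [coneFn, mul_zero, ite_eq_right_iff]
      intro h; exact absurd h (not_le.2 hy)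
    simp only [this, integral_zero]; linarith
  set m := max ε (y / (ω * t)) with hm
  have hm0 : 0 < m := hε.trans_le (le_max_left _ _)
  have hind : EqOn (fun μ => coneFn g ω t X μ y)
      ((Ici (y / (ω * t))).indicator fun μ => g (t - y / (μ * ω)) (X - y) / (μ * ω))
      (Ioc ε 1) := by
    intro μ hμ
    have : y ≤ μ * ω * t ↔ y / (ω * t) ≤ μ := by
      rw [div_le_iff₀ (mul_pos hω ht), mul_assoc]
    simp [coneFn, indicator, this]
  rw [setIntegral_congr_fun measurableSet_Ioc hind, setIntegral_indicator measurableSet_Ici]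
  rcases le_or_gt m 1 with hm1 | hm1
  · have hset : (Ioc ε 1 ∩ Ici (y / (ω * t)) : Set ℝ) =ᵐ[volume] Ioc m 1 := by
      have h1 : (Ioc ε 1 ∩ Ici (y / (ω * t)) : Set ℝ) =ᵐ[volume]
          (Ioc ε 1 ∩ Ioi (y / (ω * t)) : Set ℝ) := (ae_eq_refl _).inter Ioi_ae_eq_Ici.symm
      refine h1.trans (Eq.eventuallyEq ?_)
      rw [Ioc_inter_Ioi]
    rw [setIntegral_congr_set hset, ← intervalIntegral.integral_of_le hm1]
    have hle : ∀ μ ∈ Icc m 1, y ≤ μ * ω * t := fun μ hμ => by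
      have := (le_max_right ε (y / (ω * t))).trans hμ.1
      rw [div_le_iff₀ (mul_pos hω ht)] at this
      linarith
    have key := integral_div_ge_of_sub_le (k := fun μ => f (t - y / (μ * ω)) (X - y))
      (g := fun μ => g (t - y / (μ * ω)) (X - y)) (c := κ / √ω * (1 / √y)) hy hω hm0 hm1 ?_ ?_ ?_
    · linarith
    · intro μ hμ
      have hμ0 : 0 < μ := hm0.trans_le hμ.1
      have h1 : HasDerivAt (fun μ : ℝ => t - y / (μ * ω)) (y / (μ ^ 2 * ω)) μ := by
        have h2 := (((hasDerivAt_id μ).mul_const ω).inv (mul_pos hμ0 hω).ne').const_mul y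
        have h3 := h2.const_sub t
        simp only [id] at h3
        refine (h3.congr_deriv ?_)
        field_simp
      exact HasDerivAt.comp (h₂ := fun s => f s (X - y)) μ (hf _ _) h1
    · intro μ hμ
      have hμ0 : 0 < μ := hm0.trans_le hμ.1
      refine ContinuousAt.continuousWithinAt ?_
      have h1 : ContinuousAt (fun μ : ℝ => (t - y / (μ * ω), X - y)) μ := by
        refine ContinuousAt.prodMk (continuousAt_const.sub (continuousAt_const.div (by fun_prop)
          (by positivity))) continuousAt_const
      exact hg.continuousAt.comp h1
    · intro μ hμ
      have hμ0 : 0 < μ := hm0.trans_le hμ.1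
      have h1 := hdrop μ ⟨hμ0, hμ.2⟩ (hle μ hμ)
      simp only [one_mul]
      refine h1.trans (le_of_eq ?_)
      rw [Real.sqrt_div hy.le, Real.sqrt_mul hμ0.le]
      have e1 : √y * √y = y := Real.mul_self_sqrt hy.le
      have : 0 < √y := Real.sqrt_pos.2 hy
      have : 0 < √ω := Real.sqrt_pos.2 hω
      have : 0 < √μ := Real.sqrt_pos.2 hμ0
      field_simp
      nlinarith
  · have hset : (Ioc ε 1 ∩ Ici (y / (ω * t)) : Set ℝ) = ∅ := by
      rw [← disjoint_iff_inter_eq_empty, Set.disjoint_left]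
      intro μ hμ hμ'
      have : m ≤ μ := max_le hμ.1.le hμ'
      linarith [hμ.2]
    rw [hset]; simp only [setIntegral_empty]; linarith

lemma intLower_cone {f g : ℝ → ℝ → ℝ} {ε ω t X y₀ κ C : ℝ}
    (hf : ∀ t x, HasDerivAt (fun s => f s x) (g t x) t)
    (hg : Continuous fun p : ℝ × ℝ => g p.1 p.2) (hC : ∀ t x, |g t x| ≤ C)
    (hε : 0 < ε) (hε1 : ε < 1) (hω : 0 < ω) (ht : 0 ≤ t) (hy₀ : 0 ≤ y₀) (hX : y₀ ≤ X)
    (hX2 : X ≤ 2) (hκ : 0 ≤ κ)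
    (hdrop : ∀ y ∈ Ioc y₀ X, ∀ μ ∈ Ioc (0:ℝ) 1, y ≤ μ * ω * t →
      f (t - y / (μ * ω)) (X - y) - f (t - y / ω) (X - y) ≤ κ * √(y / (μ * ω))) :
    IntLower ε (6 * (κ / √ω)) fun μ =>
      ∫ y in min y₀ (μ * ω * t)..min X (μ * ω * t), g (t - y / (μ * ω)) (X - y) / (μ * ω) := by
  have hmeas := measurable_coneFn hg ω t X
  simp_rw [← integral_coneFn hX]
  refine ⟨(hmeas.stronglyMeasurable.integral_prod_right
    (ν := volume.restrict (Ioc y₀ X))).aestronglyMeasurable, ?_⟩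
  have hint : Integrable (Function.uncurry (coneFn g ω t X))
      ((volume.restrict (Ioc ε 1)).prod (volume.restrict (Ioc y₀ X))) := by
    refine Integrable.of_bound hmeas.aestronglyMeasurable (C / (ε * ω)) ?_
    rw [Measure.prod_restrict]
    refine (ae_restrict_iff' (measurableSet_Ioc.prod measurableSet_Ioc)).2 (ae_of_all _ ?_)
    rintro ⟨μ, y⟩ ⟨hμ, -⟩
    exact abs_coneFn_le hC hω hε hμ.1 y
  rw [integral_integral_swap hint]
  obtain ⟨hi, hle⟩ := integral_inv_sqrt_le hy₀ hX hX2
  have h1 := setIntegral_mono_on (hi.const_mul (-(2 * (κ / √ω)))) hint.integral_prod_right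
    measurableSet_Ioc (fun y hy => by
      have := integral_coneFn_snd_ge (X := X) hf hg hε hε1 hω ht (hy₀.trans_lt hy.1) hκ (hdrop y hy)
      simp only [Function.uncurry]
      rw [neg_mul]
      exact this)
  rw [integral_const_mul] at h1
  simp only [Function.uncurry] at h1
  refine le_trans ?_ h1
  have : 0 ≤ κ / √ω := by positivity
  nlinarith

lemma abs_legAvg_le {w : ℝ → ℝ → ℝ} (hw : SepBdd w) {C : ℝ} (hC : ∀ t x, |w t x| ≤ C)
    (c t y₀ X : ℝ) {d e : ℝ} (hd : 0 < d) (he : 0 < e) : |legAvg w c t y₀ X d e| ≤ C + C :=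
  (abs_sub _ _).trans (add_le_add (abs_boxAvg_le hw hd he hC) (abs_boxAvg_le hw hd he hC))

lemma abs_legAvgX_le {w : ℝ → ℝ → ℝ} (hw : SepBdd w) {C : ℝ} (hC : ∀ t x, |w t x| ≤ C)
    (c t y₀ X : ℝ) {e : ℝ} (he : 0 < e) : |legAvgX w c t y₀ X e| ≤ C + C :=
  le_of_tendsto (tendsto_legAvg hw c t y₀ X e).abs (by
    filter_upwards [self_mem_nhdsWithin] with d hd
    exact abs_legAvg_le hw hC c t y₀ X hd he)

lemma abs_legVal_le {w : ℝ → ℝ → ℝ} {C : ℝ} (hC : ∀ t x, |w t x| ≤ C)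
    (c t y₀ X : ℝ) : |legVal w c t y₀ X| ≤ C + C :=
  (abs_sub _ _).trans (add_le_add (hC _ _) (hC _ _))

/-- Lower bound for the average over directions of the increments of `w μ` along
characteristics, in terms of a modulus for the drops of `b` in time. -/
lemma intLower_leg {T ω t y₀ X κ C ε d₀ e₀ : ℝ} {w : ℝ → ℝ → ℝ → ℝ} {b : ℝ → ℝ → ℝ}
    (hb : SepBdd b) (hw : ∀ μ ∈ Ioc (0:ℝ) 1, SepBdd (w μ))
    (hC : ∀ μ ∈ Ioc (0:ℝ) 1, ∀ t x, |w μ t x| ≤ C)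
    (htr : ∀ μ ∈ Ioc (0:ℝ) 1, Transports T (μ * ω) (w μ) b)
    (hε : 0 < ε) (hε1 : ε < 1) (hω : 0 < ω) (ht : 0 ≤ t) (htT : t < T) (hy₀ : 0 ≤ y₀)
    (hX : y₀ ≤ X) (hX2 : X ≤ 2) (hX1 : X - y₀ ≤ 1) (hκ : 0 ≤ κ) (hd₀ : 0 < d₀) (he₀ : 0 < e₀)
    (hdrop : ∀ y ∈ Ioc y₀ X, ∀ μ ∈ Ioc (0:ℝ) 1, y ≤ μ * ω * t → ∀ σ ∈ Icc 0 d₀,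
      ∀ x ∈ Icc (0:ℝ) 1, |x - (X - y)| ≤ e₀ →
      b (t - y / (μ * ω) + σ) x - b (t - y / ω + σ) x ≤ κ * √(y / (μ * ω))) :
    IntLower ε (6 * (κ / √ω)) fun μ => legVal (w μ) (μ * ω) t y₀ X := by
  have hμ0 : ∀ μ ∈ Ioc ε 1, μ ∈ Ioc (0:ℝ) 1 := fun μ hμ => ⟨hε.trans hμ.1, hμ.2⟩
  have main : ∀ X e₀, 0 < e₀ → y₀ ≤ X → X ≤ 2 → X - y₀ < 1 →
      (∀ y ∈ Ioc y₀ X, ∀ μ ∈ Ioc (0:ℝ) 1, y ≤ μ * ω * t → ∀ σ ∈ Icc 0 d₀,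
      ∀ x ∈ Icc (0:ℝ) 1, |x - (X - y)| ≤ e₀ →
      b (t - y / (μ * ω) + σ) x - b (t - y / ω + σ) x ≤ κ * √(y / (μ * ω))) →
      IntLower ε (6 * (κ / √ω)) fun μ => legVal (w μ) (μ * ω) t y₀ X := by
    intro X e₀ he₀ hX hX2 hX1 hdrop
    refine IntLower.of_tendsto (C := C + C) (F := fun e μ => legAvgX (w μ) (μ * ω) t y₀ X e) ?_
      fun μ hμ => tendsto_legAvgX (hw μ (hμ0 μ hμ)) _ _ _ _
    filter_upwards [Ioo_mem_nhdsGT (sub_pos.2 hX1), Ioo_mem_nhdsGT he₀] with e he he'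
    refine ⟨?_, fun μ hμ => abs_legAvgX_le (hw μ (hμ0 μ hμ)) (hC μ (hμ0 μ hμ)) _ _ _ _ he.1⟩
    refine IntLower.of_tendsto (C := C + C) (F := fun d μ => legAvg (w μ) (μ * ω) t y₀ X d e) ?_
      fun μ hμ => tendsto_legAvg (hw μ (hμ0 μ hμ)) _ _ _ _ _
    filter_upwards [Ioo_mem_nhdsGT (sub_pos.2 htT), Ioo_mem_nhdsGT hd₀] with d hd hd'
    refine ⟨?_, fun μ hμ =>
      abs_legAvg_le (hw μ (hμ0 μ hμ)) (hC μ (hμ0 μ hμ)) _ _ _ _ hd.1 he.1⟩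
    obtain ⟨Cg, hCg⟩ := bounded_boxAvgDeriv hb d e
    refine (intLower_cone (f := boxAvg b d e) (fun t x => hasDerivAt_boxAvg hb d e t x)
      (continuous_boxAvgDeriv hb d e) hCg hε hε1 hω ht hy₀ hX hX2 hκ ?_).congr ?_
    · intro y hy μ hμ hyt
      refine boxAvg_shift_sub_le hb hd.1 he.1 fun σ hσ x hx => ?_
      refine hdrop y hy μ hμ hyt σ ⟨hσ.1, hσ.2.trans hd'.2.le⟩ x
        ⟨by linarith [hx.1, hy.2], by linarith [hx.2, hy.1, he.2]⟩ ?_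
      rw [abs_le]
      constructor <;> linarith [hx.1, hx.2, he'.1, he'.2]
    · intro μ hμ
      exact ((htr μ (hμ0 μ hμ)).legAvg_eq (hw μ (hμ0 μ hμ)) hb (mul_pos (hμ0 μ hμ).1 hω) hd.1 he.1
        hy₀ hX (by linarith [hd.2]) (by linarith [he.2])).symm
  rcases hX1.lt_or_eq with h1 | h1
  · exact main X e₀ he₀ hX hX2 h1 hdrop
  · refine IntLower.of_tendsto (C := C + C)
      (F := fun δ μ => legVal (w μ) (μ * ω) t y₀ (X - δ)) ?_
      fun μ hμ => tendsto_legVal_sub (hw μ (hμ0 μ hμ))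
    filter_upwards [Ioo_mem_nhdsGT (zero_lt_one (α := ℝ)), Ioo_mem_nhdsGT (half_pos he₀)]
      with δ hδ hδ₂
    refine ⟨main (X - δ) (e₀ / 2) (half_pos he₀) (by linarith [hδ.2]) (by linarith [hδ.1])
      (by linarith [hδ.1]) ?_, fun μ hμ => abs_legVal_le (hC μ (hμ0 μ hμ)) _ _ _ _⟩
    intro y hy μ hμ hyt σ hσ x hx hxy
    refine hdrop y ⟨hy.1, by linarith [hy.2, hδ.1]⟩ μ hμ hyt σ hσ x hx ?_
    rw [abs_le] at hxy ⊢
    constructor <;> linarith [hδ₂.1, hδ₂.2]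

/-- The data used in the positivity argument: a solution bounded by `B` with nonnegative initial
data, nonnegative incoming data at `x = 0` and partial reflection at `x = 1`. -/
structure PosSetting (T B : ℝ) (η : ℝ → ℝ) (G : ℝ → ℝ → ℝ → ℝ → ℝ) : Prop where
  T_pos : 0 < T
  B_nonneg : 0 ≤ B
  bdd : ∀ t x μ ω, |G t x μ ω| ≤ B
  eta_nonneg : ∀ ω ∈ Ioi (0:ℝ), 0 ≤ η ω
  eta_le : ∀ ω ∈ Ioi (0:ℝ), η ω ≤ 1
  integrable : BracketIntegrableSol T G
  pde : SatisfiesPTE T G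
  init : ∀ x ∈ Icc (0:ℝ) 1, ∀ μ ∈ Icc (-1:ℝ) 1, ∀ ω ∈ Ioi (0:ℝ), 0 ≤ G 0 x μ ω
  inflow : ∀ t ∈ Icc (0:ℝ) T, ∀ μ ∈ Ioc (0:ℝ) 1, ∀ ω ∈ Ioi (0:ℝ), 0 ≤ G t 0 μ ω
  refl : ∀ t ∈ Icc (0:ℝ) T, ∀ μ ∈ Ioc (0:ℝ) 1, ∀ ω ∈ Ioi (0:ℝ),
    η ω * G t 1 μ ω ≤ G t 1 (-μ) ω

/-- Clamping to `[0, T]`. -/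
noncomputable def clampTo (T t : ℝ) : ℝ := max 0 (min t T)

lemma clampTo_of_mem {T t : ℝ} (h : t ∈ Icc 0 T) : clampTo T t = t := by
  simp [clampTo, h.1, h.2]

lemma clampTo_mem {T : ℝ} (hT : 0 ≤ T) (t : ℝ) : clampTo T t ∈ Icc 0 T :=
  ⟨le_max_left _ _, max_le hT (min_le_right _ _)⟩

lemma continuous_clampTo (T : ℝ) : Continuous (clampTo T) := by unfold clampTo; fun_prop

/-- The clamped function `exp (ω t) G(t, x, μ, ω)`. -/
noncomputable def expSol (T : ℝ) (G : ℝ → ℝ → ℝ → ℝ → ℝ) (μ ω t x : ℝ) : ℝ :=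
  Real.exp (ω * clampTo T t) * G (clampTo T t) (clampTo 1 x) μ ω

/-- The bracket `⟨ω G⟩(t, x)`. -/
noncomputable def energy (G : ℝ → ℝ → ℝ → ℝ → ℝ) (t x : ℝ) : ℝ :=
  bracket fun μ ω => ω * G t x μ ω

lemma expSol_of_mem {T : ℝ} {G : ℝ → ℝ → ℝ → ℝ → ℝ} {μ ω t x : ℝ} (ht : t ∈ Icc 0 T)
    (hx : x ∈ Icc (0:ℝ) 1) : expSol T G μ ω t x = Real.exp (ω * t) * G t x μ ω := by
  rw [expSol, clampTo_of_mem ht, clampTo_of_mem hx]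

namespace PosSetting

variable {T B : ℝ} {η : ℝ → ℝ} {G : ℝ → ℝ → ℝ → ℝ → ℝ}

lemma abs_expSol_le (h : PosSetting T B η G) {μ ω : ℝ} (hω : 0 < ω) (t x : ℝ) :
    |expSol T G μ ω t x| ≤ Real.exp (ω * T) * B := by
  rw [expSol, abs_mul, abs_of_pos (Real.exp_pos _)]
  refine mul_le_mul ?_ (h.bdd _ _ _ _) (abs_nonneg _) (Real.exp_pos _).le
  exact Real.exp_le_exp.2 (mul_le_mul_of_nonneg_left (clampTo_mem h.T_pos.le t).2 hω.le)

lemma sepBdd_expSol (h : PosSetting T B η G) {μ ω : ℝ} (hμ : μ ∈ Icc (-1:ℝ) 1) (hω : 0 < ω) :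
    SepBdd (expSol T G μ ω) where
  contL x := by
    refine Continuous.mul (by have := continuous_clampTo T; fun_prop) ?_
    refine ContinuousOn.comp_continuous (s := Icc 0 T) (f := clampTo T)
      (g := fun s => G s (clampTo 1 x) μ ω) ?_ (continuous_clampTo T) (clampTo_mem h.T_pos.le)
    intro t ht
    exact ((h.pde t ht _ (clampTo_mem zero_le_one x) μ hμ ω hω).1).continuousAt.continuousWithinAt
  contR t := by
    refine continuous_const.mul ?_
    refine ContinuousOn.comp_continuous (s := Icc 0 1) (f := clampTo 1)
      (g := fun y => G (clampTo T t) y μ ω) ?_ (continuous_clampTo 1) (clampTo_mem zero_le_one)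
    intro x hx
    exact ((h.pde _ (clampTo_mem h.T_pos.le t) x hx μ hμ
      ω hω).2.1).continuousAt.continuousWithinAt
  bdd := ⟨_, h.abs_expSol_le hω⟩

lemma hasDerivWithinAt_expSol_left (h : PosSetting T B η G) {μ ω t x : ℝ}
    (hμ : μ ∈ Icc (-1:ℝ) 1) (hω : 0 < ω) (ht : t ∈ Icc 0 T) (hx : x ∈ Icc (0:ℝ) 1) :
    HasDerivWithinAt (fun s => expSol T G μ ω s x)
      (Real.exp (ω * t) * (ω * G t x μ ω + deriv (fun s => G s x μ ω) t)) (Icc 0 T) t := by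
  have h1 := (h.pde t ht x hx μ hμ ω hω).1.hasDerivAt
  have h2 : HasDerivAt (fun s => Real.exp (ω * s)) (Real.exp (ω * t) * (ω * 1)) t :=
    ((hasDerivAt_id t).const_mul ω).exp
  refine ((h2.mul h1).hasDerivWithinAt.congr (fun s hs => expSol_of_mem hs hx)
    (expSol_of_mem ht hx)).congr_deriv ?_
  ring

lemma hasDerivWithinAt_expSol_right (h : PosSetting T B η G) {μ ω t x : ℝ}
    (hμ : μ ∈ Icc (-1:ℝ) 1) (hω : 0 < ω) (ht : t ∈ Icc 0 T) (hx : x ∈ Icc (0:ℝ) 1) :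
    HasDerivWithinAt (fun y => expSol T G μ ω t y)
      (Real.exp (ω * t) * deriv (fun y => G t y μ ω) x) (Icc 0 1) x := by
  have h1 := (h.pde t ht x hx μ hμ ω hω).2.1.hasDerivAt
  exact (h1.const_mul _).hasDerivWithinAt.congr (fun s hs => expSol_of_mem ht hs)
    (expSol_of_mem ht hx)

lemma deriv_add (h : PosSetting T B η G) {μ ω t x : ℝ}
    (hμ : μ ∈ Icc (-1:ℝ) 1) (hω : 0 < ω) (ht : t ∈ Icc 0 T) (hx : x ∈ Icc (0:ℝ) 1) :
    ω * G t x μ ω + deriv (fun s => G s x μ ω) t + μ * ω * deriv (fun y => G t y μ ω) x =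
      Mw ω * energy G t x := by
  have := (h.pde t ht x hx μ hμ ω hω).2.2
  unfold coll at this
  unfold energy
  linarith

lemma hasDerivWithinAt_expSol_zero (h : PosSetting T B η G) {ω t x : ℝ}
    (hω : 0 < ω) (ht : t ∈ Icc 0 T) (hx : x ∈ Icc (0:ℝ) 1) :
    HasDerivWithinAt (fun s => expSol T G 0 ω s x)
      (Real.exp (ω * t) * (Mw ω * energy G t x)) (Icc 0 T) t := by
  have h0 : (0:ℝ) ∈ Icc (-1:ℝ) 1 := by norm_num
  refine (h.hasDerivWithinAt_expSol_left h0 hω ht hx).congr_deriv ?_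
  rw [← h.deriv_add h0 hω ht hx]
  ring

lemma transports (h : PosSetting T B η G) {μ ω : ℝ} (hμ : μ ∈ Icc (-1:ℝ) 1) (hω : 0 < ω) :
    Transports T (μ * ω) (expSol T G μ ω) (expSol T G 0 ω) := fun t ht x hx =>
  ⟨_, _, _, _, by rw [← h.deriv_add hμ hω ht hx]; ring,
    h.hasDerivWithinAt_expSol_left hμ hω ht hx, h.hasDerivWithinAt_expSol_right hμ hω ht hx,
    h.hasDerivWithinAt_expSol_zero hω ht hx,
    h.hasDerivWithinAt_expSol_right (by norm_num) hω ht hx⟩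

end PosSetting

lemma SepBdd.reflect {w : ℝ → ℝ → ℝ} (hw : SepBdd w) : SepBdd fun t x => w t (1 - x) :=
  ⟨fun x => hw.contL _, fun t => (hw.contR t).comp (by fun_prop), by
    obtain ⟨C, hC⟩ := hw.bdd; exact ⟨C, fun _ _ => hC _ _⟩⟩

lemma HasDerivWithinAt.reflect {f : ℝ → ℝ} {f' x : ℝ}
    (h : HasDerivWithinAt f f' (Icc 0 1) (1 - x)) :
    HasDerivWithinAt (fun y => f (1 - y)) (-f') (Icc 0 1) x := by
  have h1 : HasDerivWithinAt (fun y : ℝ => 1 - y) (-1) (Icc 0 1) x :=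
    ((hasDerivAt_id x).const_sub 1).hasDerivWithinAt
  have := h.scomp x h1 (fun y hy => ⟨by linarith [hy.2], by linarith [hy.1]⟩)
  refine this.congr_deriv (by simp)

lemma Transports.reflect {T c : ℝ} {w b : ℝ → ℝ → ℝ} (h : Transports T (-c) w b) :
    Transports T c (fun t x => w t (1 - x)) fun t x => b t (1 - x) := by
  intro t ht x hx
  obtain ⟨α₁, α₂, β₁, β₂, h0, d1, d2, d3, d4⟩ :=
    h t ht (1 - x) ⟨by linarith [hx.2], by linarith [hx.1]⟩
  exact ⟨α₁, -α₂, β₁, -β₂, by linarith, d1, d2.reflect, d3, d4.reflect⟩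

lemma legVal_exit {w : ℝ → ℝ → ℝ} {c t X : ℝ} (hc : 0 < c) (ht : 0 ≤ t) :
    legVal w c t 0 X = w t X -
      if X ≤ c * t then w (t - X / c) 0 else w 0 (X - c * t) := by
  have h0 : min 0 (c * t) = 0 := min_eq_left (mul_nonneg hc.le ht)
  unfold legVal
  rw [h0]
  split_ifs with h
  · rw [min_eq_left h]; simp
  · rw [min_eq_right (not_le.1 h).le, mul_div_cancel_left₀ _ hc.ne']; simp

lemma integral_Icc_neg_one_one {f : ℝ → ℝ} (hf : IntegrableOn f (Icc (-1) 1)) :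
    IntegrableOn (fun μ => f μ + f (-μ)) (Ioc 0 1) ∧
      ∫ μ in Icc (-1:ℝ) 1, f μ = ∫ μ in Ioc (0:ℝ) 1, (f μ + f (-μ)) := by
  have i0 : IntervalIntegrable f volume (-1) 1 :=
    (intervalIntegrable_iff_integrableOn_Icc_of_le (by norm_num)).2 hf
  have i1 : IntervalIntegrable f volume (-1) 0 := i0.mono_set (by
    rw [uIcc_of_le (by norm_num), uIcc_of_le (by norm_num)]
    exact Icc_subset_Icc le_rfl (by norm_num))
  have i2 : IntervalIntegrable f volume 0 1 := i0.mono_set (by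
    rw [uIcc_of_le (by norm_num), uIcc_of_le (by norm_num)]
    exact Icc_subset_Icc (by norm_num) le_rfl)
  have i3 : IntervalIntegrable (fun μ => f (-μ)) volume 0 1 := by
    have := ((IntervalIntegrable.iff_comp_neg).1 i1).symm
    simpa using this
  refine ⟨(intervalIntegrable_iff_integrableOn_Ioc_of_le zero_le_one).1 (i2.add i3), ?_⟩
  rw [integral_Icc_eq_integral_Ioc, ← intervalIntegral.integral_of_le (by norm_num),
    ← intervalIntegral.integral_of_le zero_le_one, intervalIntegral.integral_add i2 i3,
    ← intervalIntegral.integral_add_adjacent_intervals i1 i2, intervalIntegral.integral_comp_neg]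
  simp only [neg_zero]
  ring

/-- The integral of the solution over all directions. -/
noncomputable def dirInt (G : ℝ → ℝ → ℝ → ℝ → ℝ) (t x ω : ℝ) : ℝ :=
  ∫ μ in Icc (-1:ℝ) 1, G t x μ ω

lemma energy_eq (G : ℝ → ℝ → ℝ → ℝ → ℝ) (t x : ℝ) :
    energy G t x = ∫ ω in Ioi (0:ℝ), ω * dirInt G t x ω := by
  unfold energy bracket dirInt
  simp_rw [integral_const_mul]

namespace PosSetting

variable {T B : ℝ} {η : ℝ → ℝ} {G : ℝ → ℝ → ℝ → ℝ → ℝ}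

lemma integrableOn_dir (h : PosSetting T B η G) {ω t x : ℝ} (hω : 0 < ω) (ht : t ∈ Icc 0 T)
    (hx : x ∈ Icc (0:ℝ) 1) : IntegrableOn (fun μ => G t x μ ω) (Icc (-1) 1) := by
  have := ((h.integrable t ht x hx).1 ω hω).const_mul ω⁻¹
  refine this.congr (ae_of_all _ fun μ => ?_)
  simp only
  rw [inv_mul_cancel_left₀ hω.ne']

lemma integrableOn_energy (h : PosSetting T B η G) {t x : ℝ} (ht : t ∈ Icc 0 T)
    (hx : x ∈ Icc (0:ℝ) 1) : IntegrableOn (fun ω => ω * dirInt G t x ω) (Ioi 0) := by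
  have := (h.integrable t ht x hx).2
  unfold dirInt
  simp_rw [integral_const_mul] at this
  exact this

lemma legVal_le (h : PosSetting T B η G) {μ ω t x : ℝ} (hμ : μ ∈ Ioc (0:ℝ) 1) (hω : 0 < ω)
    (ht : t ∈ Icc 0 T) (hx : x ∈ Icc (0:ℝ) 1) :
    legVal (expSol T G μ ω) (μ * ω) t 0 x ≤ Real.exp (ω * t) * G t x μ ω := by
  have hc : 0 < μ * ω := mul_pos hμ.1 hω
  have hμ' : μ ∈ Icc (-1:ℝ) 1 := ⟨by linarith [hμ.1], hμ.2⟩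
  rw [legVal_exit hc ht.1, ← expSol_of_mem ht hx, sub_le_self_iff]
  split_ifs with hX
  · have h1 : x / (μ * ω) ≤ t := by rw [div_le_iff₀ hc]; linarith
    have h2 : 0 ≤ x / (μ * ω) := div_nonneg hx.1 hc.le
    have h3 : t - x / (μ * ω) ∈ Icc 0 T := ⟨by linarith, by linarith [ht.2]⟩
    rw [expSol_of_mem h3 (by norm_num)]
    exact mul_nonneg (Real.exp_pos _).le (h.inflow _ h3 μ hμ ω hω)
  · have h1 : x - μ * ω * t ∈ Icc (0:ℝ) 1 :=
      ⟨by linarith, by linarith [hx.2, mul_nonneg hc.le ht.1]⟩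
    rw [expSol_of_mem ⟨le_rfl, h.T_pos.le⟩ h1]
    exact mul_nonneg (Real.exp_pos _).le (h.init _ h1 μ hμ' ω hω)

lemma legVal_reflect_le (h : PosSetting T B η G) {μ ω t x : ℝ} (hμ : μ ∈ Ioc (0:ℝ) 1)
    (hω : 0 < ω) (ht : t ∈ Icc 0 T) (hx : x ∈ Icc (0:ℝ) 1) :
    legVal (fun t x => expSol T G (-μ) ω t (1 - x)) (μ * ω) t 0 (1 - x) +
      η ω * legVal (expSol T G μ ω) (μ * ω) t (1 - x) (2 - x) ≤
        Real.exp (ω * t) * G t x (-μ) ω := by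
  have hc : 0 < μ * ω := mul_pos hμ.1 hω
  have hμ' : -μ ∈ Icc (-1:ℝ) 1 := ⟨by linarith [hμ.2], by linarith [hμ.1]⟩
  have hx' : (0:ℝ) ≤ 1 - x := by linarith [hx.2]
  rw [legVal_exit hc ht.1, sub_sub_cancel, sub_zero, ← expSol_of_mem ht hx]
  have hη := h.eta_nonneg ω hω
  split_ifs with hX
  · have h1 : (1 - x) / (μ * ω) ≤ t := by rw [div_le_iff₀ hc]; linarith
    have h2 : 0 ≤ (1 - x) / (μ * ω) := div_nonneg hx' hc.le
    have h3 : t - (1 - x) / (μ * ω) ∈ Icc 0 T := ⟨by linarith, by linarith [ht.2]⟩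
    have h4 : legVal (expSol T G μ ω) (μ * ω) t (1 - x) (2 - x) ≤
        expSol T G μ ω (t - (1 - x) / (μ * ω)) 1 := by
      have e1 : legVal (expSol T G μ ω) (μ * ω) t (1 - x) (2 - x) =
          legVal (expSol T G μ ω) (μ * ω) (t - (1 - x) / (μ * ω)) 0 1 := by
        have e2 : μ * ω * (t - (1 - x) / (μ * ω)) = μ * ω * t - (1 - x) := by
          rw [mul_sub, mul_div_assoc', mul_div_cancel_left₀ _ hc.ne']
        have e3 : min (2 - x) (μ * ω * t) = min 1 (μ * ω * t - (1 - x)) + (1 - x) := by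
          rw [← min_add_add_right]; congr 1 <;> ring
        have e4 : (2:ℝ) - x - (1 - x) = 1 := by ring
        unfold legVal
        rw [e2, min_eq_left hX, min_eq_left (by linarith : (0:ℝ) ≤ μ * ω * t - (1 - x)), e3, e4,
          zero_div, sub_zero, sub_zero, add_div]
        congr 2 <;> ring
      rw [e1, expSol_of_mem h3 (by norm_num)]
      exact h.legVal_le hμ hω h3 (by norm_num)
    have h5 := mul_le_mul_of_nonneg_left h4 hη
    have h6 : η ω * expSol T G μ ω (t - (1 - x) / (μ * ω)) 1 ≤
        expSol T G (-μ) ω (t - (1 - x) / (μ * ω)) 1 := by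
      rw [expSol_of_mem h3 (by norm_num), expSol_of_mem h3 (by norm_num)]
      have := mul_le_mul_of_nonneg_left (h.refl _ h3 μ hμ ω hω)
        (Real.exp_pos (ω * (t - (1 - x) / (μ * ω)))).le
      linarith
    linarith
  · have h1 : 1 - (1 - x - μ * ω * t) ∈ Icc (0:ℝ) 1 :=
      ⟨by linarith [hx.1, mul_nonneg hc.le ht.1], by linarith⟩
    have h2 : legVal (expSol T G μ ω) (μ * ω) t (1 - x) (2 - x) = 0 := by
      unfold legVal
      rw [min_eq_right (not_le.1 hX).le, min_eq_right (by linarith)]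
      ring
    have h3 : 0 ≤ expSol T G (-μ) ω 0 (1 - (1 - x - μ * ω * t)) := by
      rw [expSol_of_mem ⟨le_rfl, h.T_pos.le⟩ h1]
      exact mul_nonneg (Real.exp_pos _).le (h.init _ h1 _ hμ' ω hω)
    rw [h2]; linarith

lemma dirInt_ge_of_drop (h : PosSetting T B η G) {ω t x κ d₀ e₀ : ℝ} (hω : 0 < ω) (ht : 0 ≤ t)
    (htT : t < T) (hx : x ∈ Icc (0:ℝ) 1) (hκ : 0 ≤ κ) (hd₀ : 0 < d₀) (he₀ : 0 < e₀)
    (hdrop : ∀ y ∈ Ioc (0:ℝ) 2, ∀ μ ∈ Ioc (0:ℝ) 1, y ≤ μ * ω * t → ∀ σ ∈ Icc 0 d₀,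
      ∀ x' ∈ Icc (0:ℝ) 1, |x' - x| ≤ y + e₀ →
      expSol T G 0 ω (t - y / (μ * ω) + σ) x' - expSol T G 0 ω (t - y / ω + σ) x' ≤
        κ * √(y / (μ * ω))) :
    -(18 * (κ / √ω)) ≤ Real.exp (ω * t) * dirInt G t x ω := by
  have ht' : t ∈ Icc 0 T := ⟨ht, htT.le⟩
  have hη := h.eta_nonneg ω hω
  have hη1 := h.eta_le ω hω
  have hm : ∀ μ ∈ Ioc (0:ℝ) 1, μ ∈ Icc (-1:ℝ) 1 := fun μ hμ => ⟨by linarith [hμ.1], hμ.2⟩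
  have hm' : ∀ μ ∈ Ioc (0:ℝ) 1, -μ ∈ Icc (-1:ℝ) 1 := fun μ hμ =>
    ⟨by linarith [hμ.2], by linarith [hμ.1]⟩
  have h0 : (0:ℝ) ∈ Icc (-1:ℝ) 1 := by norm_num
  obtain ⟨hi, hs⟩ := integral_Icc_neg_one_one (h.integrableOn_dir hω ht' hx)
  set C := Real.exp (ω * t) * (B + B) with hC
  set E := κ / √ω with hE
  have hE0 : 0 ≤ E := by positivity
  have key : ∀ ε ∈ Ioo (0:ℝ) 1, -(18 * E) - C * ε ≤ Real.exp (ω * t) * dirInt G t x ω := by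
    intro ε hε
    have l1 := intLower_leg (w := fun μ => expSol T G μ ω) (b := expSol T G 0 ω) (X := x) (y₀ := 0)
      (h.sepBdd_expSol h0 hω) (fun μ hμ => h.sepBdd_expSol (hm μ hμ) hω)
      (fun μ _ => h.abs_expSol_le hω) (fun μ hμ => h.transports (hm μ hμ) hω) hε.1 hε.2 hω ht htT
      le_rfl hx.1 (by linarith [hx.2]) (by linarith [hx.2]) hκ hd₀ he₀ (by
        intro y hy μ hμ hyt σ hσ x' hx' hxy
        refine hdrop y ⟨hy.1, by linarith [hy.2, hx.2]⟩ μ hμ hyt σ hσ x' hx' ?_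
        rw [abs_le] at hxy ⊢
        constructor <;> linarith [hy.1])
    have l3 := intLower_leg (w := fun μ => expSol T G μ ω) (b := expSol T G 0 ω) (X := 2 - x)
      (y₀ := 1 - x) (h.sepBdd_expSol h0 hω) (fun μ hμ => h.sepBdd_expSol (hm μ hμ) hω)
      (fun μ _ => h.abs_expSol_le hω) (fun μ hμ => h.transports (hm μ hμ) hω) hε.1 hε.2 hω ht htT
      (by linarith [hx.2]) (by linarith) (by linarith [hx.1]) (by linarith) hκ hd₀ he₀ (by
        intro y hy μ hμ hyt σ hσ x' hx' hxy
        refine hdrop y ⟨by linarith [hy.1, hx.2], by linarith [hy.2, hx.1]⟩ μ hμ hyt σ hσ x' hx' ?_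
        rw [abs_le] at hxy ⊢
        constructor <;> linarith [hy.1, hx.2])
    have l2 := intLower_leg (w := fun μ t x => expSol T G (-μ) ω t (1 - x))
      (b := fun t x => expSol T G 0 ω t (1 - x)) (X := 1 - x) (y₀ := 0)
      (h.sepBdd_expSol h0 hω).reflect (fun μ hμ => (h.sepBdd_expSol (hm' μ hμ) hω).reflect)
      (fun μ _ t x => h.abs_expSol_le hω _ _)
      (fun μ hμ => Transports.reflect (by
        have := h.transports (hm' μ hμ) hω; rwa [neg_mul] at this)) hε.1 hε.2 hω ht htT
      le_rfl (by linarith [hx.2]) (by linarith [hx.1]) (by linarith [hx.1]) hκ hd₀ he₀ (by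
        intro y hy μ hμ hyt σ hσ x' hx' hxy
        refine hdrop y ⟨hy.1, by linarith [hy.2, hx.1]⟩ μ hμ hyt σ hσ (1 - x')
          ⟨by linarith [hx'.2], by linarith [hx'.1]⟩ ?_
        rw [abs_le] at hxy ⊢
        constructor <;> linarith [hy.1])
    have hsub : Ioc ε 1 ⊆ Ioc (0:ℝ) 1 := Ioc_subset_Ioc_left hε.1.le
    have hbd : ∀ {ℓ : ℝ → ℝ} {D : ℝ}, IntLower ε (6 * E) ℓ → (∀ μ, |ℓ μ| ≤ D) →
        IntegrableOn ℓ (Ioc ε 1) := fun hℓ hD =>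
      Integrable.of_bound hℓ.1 _ (ae_of_all _ hD)
    have i1 := hbd l1 fun μ => abs_legVal_le (h.abs_expSol_le hω) _ _ _ _
    have i2 := hbd l2 fun μ => abs_legVal_le (fun t x => h.abs_expSol_le hω t (1 - x)) _ _ _ _
    have i3 := hbd l3 fun μ => abs_legVal_le (h.abs_expSol_le hω) _ _ _ _
    have hsum := setIntegral_mono_on (i1.add (i2.add (i3.const_mul (η ω))))
      ((hi.mono_set hsub).const_mul (Real.exp (ω * t))) measurableSet_Ioc (fun μ hμ => by
        have a1 := h.legVal_le (hsub hμ) hω ht' hx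
        have a2 := h.legVal_reflect_le (hsub hμ) hω ht' hx
        simp only [Pi.add_apply]
        linarith)
    rw [integral_add' i1 (i2.add (i3.const_mul (η ω))), integral_add' i2 (i3.const_mul (η ω)),
      integral_const_mul, integral_const_mul] at hsum
    have hdis : Ioc (0:ℝ) 1 = Ioc 0 ε ∪ Ioc ε 1 := (Ioc_union_Ioc_eq_Ioc hε.1.le hε.2.le).symm
    have hsub2 : Ioc 0 ε ⊆ Ioc (0:ℝ) 1 := Ioc_subset_Ioc_right hε.2.le
    have hlow := norm_setIntegral_le_of_norm_le_const (μ := volume) (s := Ioc 0 ε) (C := B + B)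
      (f := fun μ => G t x μ ω + G t x (-μ) ω) (by simp)
      (fun μ _ => (abs_add_le _ _).trans (add_le_add (h.bdd _ _ _ _) (h.bdd _ _ _ _)))
    rw [Real.volume_real_Ioc_of_le hε.1.le, sub_zero, Real.norm_eq_abs, abs_le] at hlow
    have htot : dirInt G t x ω = (∫ μ in Ioc 0 ε, (G t x μ ω + G t x (-μ) ω)) +
        ∫ μ in Ioc ε 1, (G t x μ ω + G t x (-μ) ω) := by
      rw [← setIntegral_union (Ioc_disjoint_Ioc_of_le le_rfl) measurableSet_Ioc
        (hi.mono_set hsub2) (hi.mono_set hsub), ← hdis]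
      exact hs
    have hl := mul_le_mul_of_nonneg_left hlow.1 (Real.exp_pos (ω * t)).le
    have l33 : -(6 * E) ≤ η ω * ∫ μ in Ioc ε 1, legVal (expSol T G μ ω) (μ * ω) t (1 - x) (2 - x) :=
      by nlinarith [mul_le_mul_of_nonneg_left l3.2 hη]
    rw [htot, mul_add]
    have := l1.2
    have := l2.2
    linarith
  refine le_of_tendsto (f := fun ε => -(18 * E) - C * ε) (x := 𝓝[>] 0) ?_
    (by filter_upwards [Ioo_mem_nhdsGT (zero_lt_one (α := ℝ))] with ε hε using key ε hε)
  have : Continuous fun ε : ℝ => -(18 * E) - C * ε := by fun_prop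
  have := this.tendsto 0
  rw [mul_zero, sub_zero] at this
  exact this.mono_left nhdsWithin_le_nhds

end PosSetting

lemma gstar_pos {ω : ℝ} (hω : 0 < ω) : 0 < gstar ω := by
  have : 0 < Real.exp ω - 1 := by linarith [Real.add_one_lt_exp hω.ne']
  unfold gstar; positivity

lemma gstar_le {ω : ℝ} (hω : 0 < ω) : gstar ω ≤ (1 + ω) ^ 2 * Real.exp (-ω) := by
  have h1 : ω + 1 < Real.exp ω := Real.add_one_lt_exp hω.ne'
  have h2 : 0 < Real.exp ω - 1 := by linarith
  have h3 : ω * Real.exp ω ≤ (1 + ω) * (Real.exp ω - 1) := by nlinarith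
  have h4 : (ω * Real.exp ω) ^ 2 ≤ ((1 + ω) * (Real.exp ω - 1)) ^ 2 :=
    pow_le_pow_left₀ (by positivity) h3 2
  unfold gstar
  rw [Real.exp_neg, div_le_iff₀ (by positivity), ← div_eq_mul_inv, div_mul_eq_mul_div,
    le_div_iff₀ (Real.exp_pos _)]
  nlinarith

lemma pow_mul_gstar_le {ω : ℝ} (hω : 0 < ω) {n : ℕ} (hn : n ≤ 2) :
    ω ^ n * gstar ω ≤ 384 * Real.exp (1 / 2) * Real.exp (-(1 / 2) * ω) := by
  have h1 := Real.pow_div_factorial_le_exp ((1 + ω) / 2) (by positivity) 4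
  have h2 : ω ^ n ≤ (1 + ω) ^ 2 :=
    (pow_le_pow_left₀ hω.le (by linarith) n).trans (pow_le_pow_right₀ (by linarith) hn)
  have h3 : ω ^ n * gstar ω ≤ (1 + ω) ^ 2 * ((1 + ω) ^ 2 * Real.exp (-ω)) :=
    mul_le_mul h2 (gstar_le hω) (gstar_pos hω).le (by positivity)
  have h4 : (1 + ω) ^ 4 ≤ 384 * Real.exp ((1 + ω) / 2) := by
    have : ((Nat.factorial 4 : ℕ) : ℝ) = 24 := by norm_num [Nat.factorial]
    rw [this, div_pow, div_div, div_le_iff₀ (by norm_num)] at h1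
    linarith
  have h5 : Real.exp ((1 + ω) / 2) * Real.exp (-ω) =
      Real.exp (1 / 2) * Real.exp (-(1 / 2) * ω) := by
    rw [← Real.exp_add, ← Real.exp_add]; congr 1; ring
  have h6 := mul_le_mul_of_nonneg_right h4 (Real.exp_pos (-ω)).le
  rw [mul_assoc 384 (Real.exp (1 / 2)), ← h5]
  linarith

lemma integrableOn_pow_mul_gstar {n : ℕ} (hn : n ≤ 2) :
    IntegrableOn (fun ω => ω ^ n * gstar ω) (Ioi 0) := by
  refine Integrable.mono' ((exp_neg_integrableOn_Ioi 0 (b := 1 / 2) (by norm_num)).const_mul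
    (384 * Real.exp (1 / 2))) ?_ ?_
  · unfold gstar
    exact (by fun_prop : Measurable fun ω : ℝ =>
      ω ^ n * (ω ^ 2 * Real.exp ω / (Real.exp ω - 1) ^ 2)).aestronglyMeasurable
  · refine (ae_restrict_iff' measurableSet_Ioi).2 (ae_of_all _ fun ω hω => ?_)
    rw [Real.norm_of_nonneg (mul_nonneg (pow_nonneg (le_of_lt hω) _) (gstar_pos hω).le)]
    exact pow_mul_gstar_le hω hn

lemma wgstar_pos : 0 < wgstar := by
  unfold wgstar
  have h1 := integrableOn_pow_mul_gstar (n := 1) (by norm_num)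
  simp only [pow_one] at h1
  refine mul_pos two_pos ?_
  rw [setIntegral_pos_iff_support_of_nonneg_ae ((ae_restrict_iff' measurableSet_Ioi).2
    (ae_of_all _ fun ω hω => mul_nonneg (le_of_lt hω) (gstar_pos hω).le)) h1]
  have : Function.support (fun ω => ω * gstar ω) ∩ Ioi 0 = Ioi 0 :=
    inter_eq_right.2 fun ω hω => (mul_pos hω (gstar_pos hω)).ne'
  rw [this]; simp

lemma Mw_pos {ω : ℝ} (hω : 0 < ω) : 0 < Mw ω :=
  div_pos (mul_pos hω (gstar_pos hω)) wgstar_pos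

lemma integrableOn_Mw : IntegrableOn Mw (Ioi 0) := by
  have h1 := (integrableOn_pow_mul_gstar (n := 1) (by norm_num)).div_const wgstar
  exact h1.congr (ae_of_all _ fun ω => by simp [Mw])

lemma integral_Mw : ∫ ω in Ioi (0:ℝ), Mw ω = 1 / 2 := by
  unfold Mw
  rw [integral_div]
  have h := wgstar_pos
  unfold wgstar at h ⊢
  have h2 : 0 < ∫ ω in Ioi (0:ℝ), ω * gstar ω := by linarith
  field_simp

lemma integrableOn_mul_Mw : IntegrableOn (fun ω => ω * Mw ω) (Ioi 0) := by
  have h1 := (integrableOn_pow_mul_gstar (n := 2) le_rfl).div_const wgstar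
  refine h1.congr (ae_of_all _ fun ω => ?_)
  simp only [Mw]; ring

namespace PosSetting

variable {T B : ℝ} {η : ℝ → ℝ} {G : ℝ → ℝ → ℝ → ℝ → ℝ}

/-- Drops of `exp (ω t) G(t, x, 0, ω)` for `ω ≥ 1` are controlled by those for `ω = 1`. -/
lemma drop_le_of_one (h : PosSetting T B η G) {ω t₁ t₂ x m : ℝ} (hω : 1 ≤ ω) (h1 : 0 ≤ t₁)
    (h12 : t₁ ≤ t₂) (h2 : t₂ ≤ T) (hx : x ∈ Icc (0:ℝ) 1)
    (hm : ∀ s ∈ Icc t₁ t₂, expSol T G 0 1 s x - expSol T G 0 1 t₂ x ≤ m) :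
    expSol T G 0 ω t₁ x - expSol T G 0 ω t₂ x ≤
      Mw ω / Mw 1 * Real.exp (ω * t₂) * m := by
  have hω0 : 0 < ω := by linarith
  have hM : 0 < Mw ω / Mw 1 := div_pos (Mw_pos hω0) (Mw_pos one_pos)
  have hm0 : 0 ≤ m := by simpa using hm t₂ (right_mem_Icc.2 h12)
  have hsub : Icc t₁ t₂ ⊆ Icc 0 T := Icc_subset_Icc h1 h2
  set β := fun s => expSol T G 0 1 s x
  set b := fun s => expSol T G 0 ω s x
  have hφ : ∀ s, HasDerivAt (fun s => Real.exp ((ω - 1) * s))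
      (Real.exp ((ω - 1) * s) * ((ω - 1) * 1)) s := fun s => ((hasDerivAt_id s).const_mul _).exp
  have hder : ∀ s ∈ Icc t₁ t₂, HasDerivWithinAt
      (fun s => b s - Mw ω / Mw 1 * (Real.exp ((ω - 1) * s) * (β s - β t₂ - m)))
      (Mw ω / Mw 1 * (Real.exp ((ω - 1) * s) * (ω - 1) * (m - (β s - β t₂)))) (Icc t₁ t₂) s := by
    intro s hs
    have d1 := (h.hasDerivWithinAt_expSol_zero hω0 (hsub hs) hx).mono hsub
    have d2 := (h.hasDerivWithinAt_expSol_zero one_pos (hsub hs) hx).mono hsub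
    have d3 := (hφ s).hasDerivWithinAt (s := Icc t₁ t₂)
    refine (d1.sub ((d3.mul ((d2.sub_const (β t₂)).sub_const m)).const_mul
      (Mw ω / Mw 1))).congr_deriv ?_
    have e1 : Real.exp (ω * s) = Real.exp ((ω - 1) * s) * Real.exp (1 * s) := by
      rw [← Real.exp_add]; congr 1; ring
    rw [e1]
    have := (Mw_pos one_pos).ne'
    simp only [β]
    field_simp
    ring
  have hmono : MonotoneOn
      (fun s => b s - Mw ω / Mw 1 * (Real.exp ((ω - 1) * s) * (β s - β t₂ - m))) (Icc t₁ t₂) := by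
    refine monotoneOn_of_hasDerivWithinAt_nonneg (convex_Icc _ _)
      (fun s hs => (hder s hs).continuousWithinAt)
      (fun s hs => (hder s (interior_subset hs)).mono interior_subset) fun s hs => ?_
    have := hm s (interior_subset hs)
    refine mul_nonneg hM.le (mul_nonneg (mul_nonneg (Real.exp_pos _).le (by linarith)) ?_)
    simp only [β]; linarith
  have hk := hmono (left_mem_Icc.2 h12) (right_mem_Icc.2 h12) h12
  simp only [sub_self, zero_sub] at hk
  have h3 := hm t₁ (left_mem_Icc.2 h12)
  have h4 : Real.exp ((ω - 1) * t₁) * (β t₁ - β t₂ - m) ≤ 0 :=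
    mul_nonpos_of_nonneg_of_nonpos (Real.exp_pos _).le (by simp only [β]; linarith)
  have h5 : Real.exp ((ω - 1) * t₂) ≤ Real.exp (ω * t₂) := Real.exp_le_exp.2 (by nlinarith)
  have h6 := mul_le_mul_of_nonneg_right h5 hm0
  have h7 := mul_le_mul_of_nonneg_left h4 hM.le
  have h8 := mul_le_mul_of_nonneg_left h6 hM.le
  simp only [b] at hk
  linarith

end PosSetting

/-- In the box of radius `ρ` around `(t, x)`, the function `β` drops in time at most like
`K √(t₂ - t₁)`. -/
def DropLe (T : ℝ) (β : ℝ → ℝ → ℝ) (t x ρ K : ℝ) : Prop :=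
  ∀ t₁ t₂ x', 0 ≤ t₁ → t₁ ≤ t₂ → t₂ ≤ T → x' ∈ Icc (0:ℝ) 1 → |t₁ - t| ≤ ρ → |t₂ - t| ≤ ρ →
    |x' - x| ≤ ρ → β t₁ x' - β t₂ x' ≤ K * √(t₂ - t₁)

lemma DropLe.half {T : ℝ} {β : ℝ → ℝ → ℝ} {t s x ρ K : ℝ} (h : DropLe T β t x ρ K)
    (hs : |s - t| ≤ ρ / 2) : DropLe T β s x (ρ / 2) K := by
  intro t₁ t₂ x' h1 h2 h3 h4 h5 h6 h7
  have h0 : 0 ≤ ρ := by linarith [abs_nonneg (s - t)]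
  rw [abs_le] at hs h5 h6
  refine h t₁ t₂ x' h1 h2 h3 h4 ?_ ?_ (h7.trans (by linarith)) <;> rw [abs_le] <;>
    constructor <;> linarith

namespace PosSetting

variable {T B : ℝ} {η : ℝ → ℝ} {G : ℝ → ℝ → ℝ → ℝ → ℝ}

lemma dirInt_ge_of_lt (h : PosSetting T B η G) {ω t x ρ K : ℝ} (hω : 1 ≤ ω) (ht : 0 ≤ t)
    (htT : t < T) (hx : x ∈ Icc (0:ℝ) 1) (hρ : 0 < ρ) (hK : 0 ≤ K)
    (hd : DropLe T (expSol T G 0 1) t x ρ K) :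
    -(18 * Real.exp 1 / Mw 1 * Mw ω * (K + 2 * (Real.exp T * B) * √2 / √ρ)) ≤
      dirInt G t x ω := by
  have hω0 : 0 < ω := by linarith
  have hM1 := Mw_pos one_pos
  have hMω := Mw_pos hω0
  set C₀ := 2 * (Real.exp T * B) with hC₀
  have hC0 : 0 ≤ C₀ := by have := h.B_nonneg; positivity
  set A := K + C₀ * √(2 * ω / ρ) with hA
  have hA0 : 0 ≤ A := by positivity
  have hcb : ∀ s x, |expSol T G 0 1 s x| ≤ Real.exp T * B := fun s x => by
    simpa using h.abs_expSol_le (μ := 0) one_pos s x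
  set κ := Mw ω / Mw 1 * (Real.exp 1 * Real.exp (ω * t)) * A with hκ
  have key := h.dirInt_ge_of_drop (κ := κ) (d₀ := min (1 / ω) (min (T - t) (ρ / 2)))
    (e₀ := ρ / 2) hω0 ht htT hx (by positivity) (by
      refine lt_min (by positivity) (lt_min (by linarith) (by positivity))) (by positivity) (by
      intro y hy μ hμ hyt σ hσ x' hx' hxy
      have hc : 0 < μ * ω := mul_pos hμ.1 hω0
      have hσ1 := hσ.2.trans (min_le_left _ _)
      have hσ2 := hσ.2.trans ((min_le_right _ _).trans (min_le_left _ _))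
      have hσ3 := hσ.2.trans ((min_le_right _ _).trans (min_le_right _ _))
      set τ := y / (μ * ω) with hτ
      have hμ0 := hμ.1.ne'
      have hyτ : y = τ * (μ * ω) := by rw [hτ]; field_simp
      have hτ0 : 0 < τ := div_pos hy.1 hc
      have hτt : τ ≤ t := by rw [hτ, div_le_iff₀ hc]; linarith
      have hyω : y / ω = τ * μ := by rw [hτ]; field_simp
      have hτμ : τ * μ ≤ τ := mul_le_of_le_one_right hτ0.le hμ.2
      have hτμ0 : 0 < τ * μ := mul_pos hτ0 hμ.1
      rw [hyω]
      have hdr := h.drop_le_of_one (t₁ := t - τ + σ) (t₂ := t - τ * μ + σ) (m := A * √τ) hω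
        (by linarith [hσ.1]) (by linarith) (by linarith) hx' (by
          intro s hs
          rcases le_or_gt τ (ρ / (2 * ω)) with hc1 | hc1
          · have hy2 : τ * ω ≤ ρ / 2 := by
              rw [le_div_iff₀ (by positivity)] at hc1; linarith
            have hy3 : y ≤ ρ / 2 := by
              have h1 : τ * (μ * ω) = τ * ω * μ := by ring
              rw [hyτ, h1]
              exact (mul_le_of_le_one_right (by positivity) hμ.2).trans hy2
            have hτρ : τ ≤ ρ / 2 := (le_mul_of_one_le_right hτ0.le hω).trans hy2
            have h1 := hd s (t - τ * μ + σ) x' (by linarith [hs.1, hσ.1]) hs.2 (by linarith) hx'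
              (by rw [abs_le]; constructor <;> linarith [hs.1, hs.2, hσ.1])
              (by rw [abs_le]; constructor <;> linarith [hs.1, hs.2, hσ.1]) (by linarith)
            refine h1.trans ?_
            have h2 : √(t - τ * μ + σ - s) ≤ √τ := Real.sqrt_le_sqrt (by linarith [hs.1])
            exact mul_le_mul (by rw [hA]; have : 0 ≤ C₀ * √(2 * ω / ρ) := by positivity
                                 linarith) h2 (Real.sqrt_nonneg _) hA0
          · have h1 : 1 ≤ √(2 * ω / ρ) * √τ := by
              rw [← Real.sqrt_mul (by positivity), Real.one_le_sqrt]
              rw [div_lt_iff₀ (by positivity)] at hc1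
              rw [div_mul_eq_mul_div, le_div_iff₀ hρ]; linarith
            have h2 := (abs_le.1 (hcb s x')).2
            have h3 := (abs_le.1 (hcb (t - τ * μ + σ) x')).1
            have h4 := mul_le_mul_of_nonneg_left h1 hC0
            have h5 : 0 ≤ K * √τ := by positivity
            rw [hA]
            linarith)
      refine hdr.trans ?_
      have h1 : Real.exp (ω * (t - τ * μ + σ)) ≤ Real.exp 1 * Real.exp (ω * t) := by
        rw [← Real.exp_add]
        refine Real.exp_le_exp.2 ?_
        have : ω * σ ≤ 1 := by
          rw [le_div_iff₀ hω0] at hσ1; linarith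
        have h2 : 0 < ω * (τ * μ) := mul_pos hω0 hτμ0
        linarith
      rw [hκ, mul_assoc _ A]
      exact mul_le_mul_of_nonneg_right (mul_le_mul_of_nonneg_left h1 (by positivity))
        (by positivity))
  have h1 : A / √ω ≤ K + C₀ * √2 / √ρ := by
    have hs : 1 ≤ √ω := Real.one_le_sqrt.2 hω
    have hs0 : 0 < √ω := by linarith
    rw [hA, Real.sqrt_div (by positivity), Real.sqrt_mul (by norm_num), add_div]
    have e1 : C₀ * (√2 * √ω / √ρ) / √ω = C₀ * √2 / √ρ := by field_simp
    rw [e1]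
    have := div_le_self hK hs
    linarith
  have h2 : 18 * (κ / √ω) = Real.exp (ω * t) * (18 * Real.exp 1 / Mw 1 * Mw ω * (A / √ω)) := by
    rw [hκ]; ring
  rw [h2, ← mul_neg] at key
  have h3 := le_of_mul_le_mul_left key (Real.exp_pos _)
  have h4 := mul_le_mul_of_nonneg_left h1
    (by positivity : 0 ≤ 18 * Real.exp 1 / Mw 1 * Mw ω)
  linarith

lemma tendsto_dirInt (h : PosSetting T B η G) {ω t x : ℝ} (hω : 0 < ω) (ht : t ∈ Icc 0 T)
    (hx : x ∈ Icc (0:ℝ) 1) :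
    Tendsto (fun s => dirInt G s x ω) (𝓝[Icc 0 T] t) (𝓝 (dirInt G t x ω)) := by
  refine tendsto_integral_filter_of_dominated_convergence (fun _ => B) ?_ ?_
    (integrable_const B) ?_
  · filter_upwards [self_mem_nhdsWithin] with s hs
    exact (h.integrableOn_dir hω hs hx).aestronglyMeasurable
  · exact .of_forall fun s => ae_of_all _ fun μ => h.bdd _ _ _ _
  · refine (ae_restrict_iff' measurableSet_Icc).2 (ae_of_all _ fun μ hμ => ?_)
    exact (h.pde t ht x hx μ hμ ω hω).1.continuousAt.continuousWithinAt

lemma abs_dirInt_le (h : PosSetting T B η G) (t x ω : ℝ) : |dirInt G t x ω| ≤ 2 * B := by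
  have := norm_setIntegral_le_of_norm_le_const (μ := volume) (s := Icc (-1:ℝ) 1) (C := B)
    (f := fun μ => G t x μ ω) (by simp) (fun μ _ => h.bdd _ _ _ _)
  rw [Real.volume_real_Icc_of_le (by norm_num)] at this
  refine this.trans (le_of_eq (by ring))

lemma exists_dirInt_ge (h : PosSetting T B η G) : ∃ C, 0 ≤ C ∧
    ∀ t ∈ Icc 0 T, ∀ x ∈ Icc (0:ℝ) 1, ∀ ρ K, 0 < ρ → 0 ≤ K →
      DropLe T (expSol T G 0 1) t x ρ K → ∀ ω, 1 ≤ ω →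
        -(C * (K + 1 / √ρ) * Mw ω) ≤ dirInt G t x ω := by
  have hM1 := Mw_pos one_pos
  have hB := h.B_nonneg
  set D := 18 * Real.exp 1 / Mw 1 with hD
  set C₀ := 2 * (Real.exp T * B) * √2 with hC₀
  have hC0 : 0 ≤ C₀ := by positivity
  have hD0 : 0 ≤ D := by positivity
  refine ⟨D * (1 + 2 * C₀), by positivity, ?_⟩
  intro t ht x hx ρ K hρ hK hd ω hω
  have hMω := Mw_pos (by linarith : (0:ℝ) < ω)
  have hcl : 1 / √(ρ / 2) ≤ 2 / √ρ := by
    have h2 : √2 ≤ 2 := by rw [Real.sqrt_le_left (by norm_num)]; norm_num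
    rw [Real.sqrt_div hρ.le, one_div_div]
    exact div_le_div_of_nonneg_right h2 (Real.sqrt_nonneg _)
  have hcl2 : D * Mw ω * (K + C₀ / √(ρ / 2)) ≤ D * (1 + 2 * C₀) * (K + 1 / √ρ) * Mw ω := by
    have h1 : K + C₀ / √(ρ / 2) ≤ (1 + 2 * C₀) * (K + 1 / √ρ) := by
      have h3 := mul_le_mul_of_nonneg_left hcl hC0
      have h4 : 0 ≤ C₀ * K := by positivity
      have h5 : 0 ≤ 1 / √ρ := by positivity
      have h6 : C₀ * (1 / √(ρ / 2)) = C₀ / √(ρ / 2) := by ring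
      have h7 : C₀ * (2 / √ρ) = 2 * C₀ * (1 / √ρ) := by ring
      linarith
    have := mul_le_mul_of_nonneg_left h1 (by positivity : 0 ≤ D * Mw ω)
    linarith
  have hTcl : ∀ s ∈ Ico 0 T, |s - t| ≤ ρ / 2 →
      -(D * (1 + 2 * C₀) * (K + 1 / √ρ) * Mw ω) ≤ dirInt G s x ω := by
    intro s hs hst
    have := h.dirInt_ge_of_lt hω hs.1 hs.2 hx (half_pos hρ) hK (hd.half hst)
    rw [← hD, ← hC₀] at this
    linarith
  rcases ht.2.lt_or_eq with h1 | h1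
  · exact hTcl t ⟨ht.1, h1⟩ (by rw [sub_self, abs_zero]; positivity)
  · have hsub : Ioo 0 T ⊆ Icc 0 T := Ioo_subset_Icc_self
    have hlim := (h.tendsto_dirInt (by linarith : 0 < ω) ht hx).mono_left (nhdsWithin_mono t hsub)
    have hne : (𝓝[Ioo 0 T] t).NeBot := by
      rw [h1]
      exact mem_closure_iff_nhdsWithin_neBot.1 (by
        rw [closure_Ioo h.T_pos.ne]; exact right_mem_Icc.2 h.T_pos.le)
    refine ge_of_tendsto hlim ?_
    filter_upwards [self_mem_nhdsWithin, mem_nhdsWithin_of_mem_nhds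
      (Metric.closedBall_mem_nhds t (half_pos hρ))] with s hs hs'
    exact hTcl s ⟨hs.1.le, hs.2⟩ (by rwa [Metric.mem_closedBall, Real.dist_eq] at hs')

lemma exists_energy_ge (h : PosSetting T B η G) : ∃ C, 0 ≤ C ∧
    ∀ t ∈ Icc 0 T, ∀ x ∈ Icc (0:ℝ) 1, ∀ ρ K, 0 < ρ → ρ ≤ 1 → 0 ≤ K →
      DropLe T (expSol T G 0 1) t x ρ K → -(C * (K + 1 / √ρ)) ≤ energy G t x := by
  obtain ⟨C, hC, hge⟩ := h.exists_dirInt_ge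
  have hB := h.B_nonneg
  set I := ∫ ω in Ioi (0:ℝ), ω * Mw ω with hI
  have hI0 : 0 ≤ I := setIntegral_nonneg measurableSet_Ioi fun ω hω =>
    mul_nonneg (le_of_lt hω) (Mw_pos hω).le
  refine ⟨C * I + 2 * B, by positivity, ?_⟩
  intro t ht x hx ρ K hρ hρ1 hK hd
  set A := C * (K + 1 / √ρ) with hA
  have hA0 : 0 ≤ A := by positivity
  have i1 : IntegrableOn (fun ω : ℝ => (Iic (1:ℝ)).indicator (fun _ => 2 * B) ω) (Ioi 0) := by
    rw [integrableOn_indicator_iff measurableSet_Iic, Iic_inter_Ioi]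
    exact continuous_const.integrableOn_Ioc
  have hlow := setIntegral_mono_on ((integrableOn_mul_Mw.const_mul (-A)).sub i1)
    (h.integrableOn_energy ht hx) measurableSet_Ioi (fun ω hω => by
      have hω0 : 0 < ω := hω
      have hM := Mw_pos hω0
      simp only [Pi.sub_apply]
      by_cases h1 : ω ≤ 1
      · rw [indicator_of_mem (show ω ∈ Iic (1:ℝ) from h1)]
        have h2 := (abs_le.1 (h.abs_dirInt_le t x ω)).1
        have h3 : 0 ≤ A * (ω * Mw ω) := by positivity
        nlinarith
      · rw [indicator_of_notMem (show ω ∉ Iic (1:ℝ) from h1)]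
        have h2 := hge t ht x hx ρ K hρ hK hd ω (not_le.1 h1).le
        have h3 := mul_le_mul_of_nonneg_left h2 hω0.le
        rw [← hA] at h3
        linarith)
  rw [integral_sub' (integrableOn_mul_Mw.const_mul (-A)) i1, integral_const_mul,
    setIntegral_indicator measurableSet_Iic, Ioi_inter_Iic, setIntegral_const,
    Real.volume_real_Ioc_of_le zero_le_one, ← hI, ← energy_eq] at hlow
  have h1 : 1 ≤ K + 1 / √ρ := by
    have : 1 ≤ 1 / √ρ := by
      rw [le_div_iff₀ (Real.sqrt_pos.2 hρ), one_mul]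
      exact Real.sqrt_le_one.2 hρ1
    linarith
  have h2 := mul_le_mul_of_nonneg_left h1 (by positivity : 0 ≤ 2 * B)
  simp only [sub_zero, smul_eq_mul, one_mul] at hlow
  have h3 : (C * I + 2 * B) * (K + 1 / √ρ) = A * I + 2 * B * (K + 1 / √ρ) := by rw [hA]; ring
  rw [h3]
  linarith

end PosSetting

/-- `β` has time derivative `c a` with `0 ≤ c ≤ D`, is differentiable in space, and square-root
control of the drops of `β` yields a lower bound for `a`. -/
structure SelfBound (T : ℝ) (a β : ℝ → ℝ → ℝ) (c : ℝ → ℝ) (C D : ℝ) : Prop where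
  C_nonneg : 0 ≤ C
  D_nonneg : 0 ≤ D
  sep : SepBdd β
  coeff : ∀ t ∈ Icc 0 T, 0 ≤ c t ∧ c t ≤ D
  deriv_time : ∀ t ∈ Icc 0 T, ∀ x ∈ Icc (0:ℝ) 1,
    HasDerivWithinAt (fun s => β s x) (c t * a t x) (Icc 0 T) t
  deriv_space : ∀ t ∈ Icc 0 T, ∀ x ∈ Icc (0:ℝ) 1,
    ∃ α, HasDerivWithinAt (fun y => β t y) α (Icc 0 1) x
  lower : ∀ t ∈ Icc 0 T, ∀ x ∈ Icc (0:ℝ) 1, ∀ ρ K, 0 < ρ → ρ ≤ 1 → 0 ≤ K →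
    DropLe T β t x ρ K → -(C * (K + 1 / √ρ)) ≤ a t x

/-- The function `a` is bounded below on a neighbourhood of `z` in `[0,T] × [0,1]`. -/
def BddBelowNear (T : ℝ) (a : ℝ → ℝ → ℝ) (z : ℝ × ℝ) : Prop :=
  ∃ Λ : ℝ, ∀ᶠ p in 𝓝[Icc 0 T ×ˢ Icc (0:ℝ) 1] z, -Λ ≤ a p.1 p.2

lemma isCompact_not_bddBelowNear (T : ℝ) (a : ℝ → ℝ → ℝ) :
    IsCompact {z ∈ Icc 0 T ×ˢ Icc (0:ℝ) 1 | ¬ BddBelowNear T a z} := by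
  have hR : IsCompact (Icc 0 T ×ˢ Icc (0:ℝ) 1) := isCompact_Icc.prod isCompact_Icc
  refine hR.of_isClosed_subset ?_ (sep_subset _ _)
  refine isClosed_of_closure_subset fun z hz => ?_
  refine ⟨closure_minimal (sep_subset _ _) hR.isClosed hz, ?_⟩
  rintro ⟨Λ, hΛ⟩
  have h1 := eventually_nhdsWithin_iff.1 (eventually_eventually_nhdsWithin.2 hΛ)
  obtain ⟨y, hy, hy'⟩ := ((mem_closure_iff_frequently.1 hz).and_eventually h1).exists
  exact hy.2 ⟨Λ, hy' hy.1⟩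

lemma exists_lower_bound_of_isCompact {T : ℝ} {a : ℝ → ℝ → ℝ} {S : Set (ℝ × ℝ)}
    (hS : IsCompact S) (hSR : S ⊆ Icc 0 T ×ˢ Icc (0:ℝ) 1) (h : ∀ z ∈ S, BddBelowNear T a z) :
    ∃ Λ : ℝ, 0 ≤ Λ ∧ ∀ z ∈ S, -Λ ≤ a z.1 z.2 := by
  refine hS.induction_on (p := fun U => ∃ Λ : ℝ, 0 ≤ Λ ∧ ∀ z ∈ U, -Λ ≤ a z.1 z.2)
    ⟨0, le_rfl, by simp⟩ ?_ ?_ ?_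
  · rintro s t hst ⟨Λ, h0, h1⟩
    exact ⟨Λ, h0, fun z hz => h1 z (hst hz)⟩
  · rintro s t ⟨Λ, h0, h1⟩ ⟨Λ', h0', h1'⟩
    refine ⟨max Λ Λ', le_max_of_le_left h0, ?_⟩
    rintro z (hz | hz)
    · linarith [h1 z hz, le_max_left Λ Λ']
    · linarith [h1' z hz, le_max_right Λ Λ']
  · intro z hz
    obtain ⟨Λ, hΛ⟩ := h z hz
    refine ⟨{p | -Λ ≤ a p.1 p.2}, nhdsWithin_mono z hSR hΛ, max Λ 0, le_max_right _ _, ?_⟩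
    intro p hp
    have : -Λ ≤ a p.1 p.2 := hp
    linarith [le_max_left Λ 0]

namespace SelfBound

variable {T C D : ℝ} {a β : ℝ → ℝ → ℝ} {c : ℝ → ℝ}

lemma drop_le (h : SelfBound T a β c C D) {φ φ' : ℝ → ℝ} {s₁ s₂ x : ℝ} (h0 : 0 ≤ s₁)
    (h12 : s₁ ≤ s₂) (hT : s₂ ≤ T) (hx : x ∈ Icc (0:ℝ) 1) (hφ : ContinuousOn φ (Icc s₁ s₂))
    (hφ' : ∀ s ∈ Ioo s₁ s₂, HasDerivAt φ (φ' s) s)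
    (ha : ∀ s ∈ Ioo s₁ s₂, 0 ≤ c s * a s x + φ' s) :
    β s₁ x - β s₂ x ≤ φ s₂ - φ s₁ := by
  have hsub : Icc s₁ s₂ ⊆ Icc 0 T := Icc_subset_Icc h0 hT
  have hmono : MonotoneOn (fun s => β s x + φ s) (Icc s₁ s₂) := by
    refine monotoneOn_of_hasDerivWithinAt_nonneg (f' := fun s => c s * a s x + φ' s)
      (convex_Icc _ _) ((h.sep.contL x).continuousOn.add hφ) ?_ ?_
    · intro s hs
      rw [interior_Icc] at hs ⊢
      exact ((h.deriv_time s (hsub (Ioo_subset_Icc_self hs)) x hx).mono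
        (Ioo_subset_Icc_self.trans hsub)).add (hφ' s hs).hasDerivWithinAt
    · intro s hs
      rw [interior_Icc] at hs
      exact ha s hs
  have := hmono (left_mem_Icc.2 h12) (right_mem_Icc.2 h12) h12
  simp only at this
  linarith

lemma neg_mul_le (h : SelfBound T a β c C D) {s x L : ℝ} (hs : s ∈ Icc 0 T) (hL : 0 ≤ L)
    (ha : -L ≤ a s x) : 0 ≤ c s * a s x + D * L := by
  obtain ⟨h1, h2⟩ := h.coeff s hs
  have h3 := mul_le_mul_of_nonneg_left ha h1
  have h4 := mul_le_mul_of_nonneg_right h2 hL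
  linarith

lemma drop_le_const (h : SelfBound T a β c C D) {s₁ s₂ x L : ℝ} (h0 : 0 ≤ s₁)
    (h12 : s₁ ≤ s₂) (hT : s₂ ≤ T) (hx : x ∈ Icc (0:ℝ) 1) (hL : 0 ≤ L)
    (ha : ∀ s ∈ Ioo s₁ s₂, -L ≤ a s x) : β s₁ x - β s₂ x ≤ D * L * (s₂ - s₁) := by
  have := h.drop_le (φ := fun s => D * L * s) (φ' := fun _ => D * L) h0 h12 hT hx (by fun_prop)
    (fun s _ => by simpa using (hasDerivAt_id s).const_mul (D * L)) (fun s hs =>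
      h.neg_mul_le ⟨h0.trans hs.1.le, hs.2.le.trans hT⟩ hL (ha s hs))
  linarith

lemma drop_le_sqrt (h : SelfBound T a β c C D) {s₁ s₂ x L : ℝ} (h0 : 0 ≤ s₁)
    (h12 : s₁ ≤ s₂) (hT : s₂ ≤ T) (hx : x ∈ Icc (0:ℝ) 1) (hL : 0 ≤ L)
    (ha : ∀ s ∈ Ioo s₁ s₂, -(L * (1 / √(s - s₁) + 1 / √(s₂ - s))) ≤ a s x) :
    β s₁ x - β s₂ x ≤ 4 * D * L * √(s₂ - s₁) := by
  have := h.drop_le (φ := fun s => 2 * D * L * (√(s - s₁) - √(s₂ - s)))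
    (φ' := fun s => D * (L * (1 / √(s - s₁) + 1 / √(s₂ - s)))) h0 h12 hT hx (by fun_prop) (by
      intro s hs
      have d1 := ((hasDerivAt_id s).sub_const s₁).sqrt (sub_pos.2 hs.1).ne'
      have d2 := ((hasDerivAt_id s).const_sub s₂).sqrt (sub_pos.2 hs.2).ne'
      refine ((d1.sub d2).const_mul (2 * D * L)).congr_deriv ?_
      simp only [id]
      ring) (fun s hs =>
      h.neg_mul_le ⟨h0.trans hs.1.le, hs.2.le.trans hT⟩ (by positivity) (ha s hs))
  simp only [sub_self, Real.sqrt_zero] at this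
  linarith

lemma lower_improve (h : SelfBound T a β c C D) {q S r : ℝ} {z₀ : ℝ × ℝ} (hr1 : r ≤ 1)
    (hq : 0 < q) (hq1 : q ≤ 1 / 2) (hqC : 8 * C * D * q ≤ 1) (hS : 0 ≤ S)
    (hz : ∀ z ∈ Icc 0 T ×ˢ Icc (0:ℝ) 1, 0 < r - dist z z₀ →
      -(S / √(r - dist z z₀)) ≤ a z.1 z.2) :
    ∀ z ∈ Icc 0 T ×ˢ Icc (0:ℝ) 1, 0 < r - dist z z₀ →
      -((C / q + S / 2) / √(r - dist z z₀)) ≤ a z.1 z.2 := by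
  rintro ⟨t, x⟩ ⟨ht, hx⟩ hd
  have hC := h.C_nonneg
  have hD := h.D_nonneg
  set d := r - dist (t, x) z₀ with hdef
  have hd1 : d ≤ 1 := by rw [hdef]; linarith [dist_nonneg (x := (t, x)) (y := z₀)]
  have hsd : 0 < √d := Real.sqrt_pos.2 hd
  have hsd1 : √d ≤ 1 := Real.sqrt_le_one.2 hd1
  have hqd : (q * √d) ^ 2 = q ^ 2 * d := by rw [mul_pow, Real.sq_sqrt hd.le]
  have hq2 : q ^ 2 ≤ 1 / 4 := by nlinarith
  have hρd : q ^ 2 * d ≤ d / 4 := by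
    have := mul_le_mul_of_nonneg_right hq2 hd.le
    linarith
  have hdrop : DropLe T β t x (q ^ 2 * d) (4 * D * q * S) := by
    intro t₁ t₂ x' h1 h2 h3 h4 h5 h6 h7
    have hbd : ∀ s ∈ Ioo t₁ t₂, -(2 * S / √d) ≤ a s x' := by
      intro s hs
      have hdist : dist (s, x') (t, x) ≤ q ^ 2 * d := by
        rw [Prod.dist_eq, Real.dist_eq, Real.dist_eq]
        refine max_le ?_ h7
        rw [abs_le] at h5 h6 ⊢
        constructor <;> linarith [hs.1, hs.2]
      have hd' : d / 4 ≤ r - dist (s, x') z₀ := by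
        have := dist_triangle (s, x') (t, x) z₀
        linarith
      have h8 := hz (s, x') ⟨⟨h1.trans hs.1.le, hs.2.le.trans h3⟩, h4⟩ (by linarith)
      have h9 : √d / 2 ≤ √(r - dist (s, x') z₀) := by
        refine Real.le_sqrt_of_sq_le ?_
        rw [div_pow, Real.sq_sqrt hd.le]; linarith
      have h10 : S / √(r - dist (s, x') z₀) ≤ S / (√d / 2) :=
        div_le_div_of_nonneg_left hS (by positivity) h9
      have h11 : S / (√d / 2) = 2 * S / √d := by field_simp
      simp only at h8
      linarith
    have h8 := h.drop_le_const h1 h2 h3 h4 (by positivity) hbd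
    have h9 : √(t₂ - t₁) ≤ 2 * (q * √d) := by
      refine Real.sqrt_le_iff.2 ⟨by positivity, ?_⟩
      rw [mul_pow, hqd]
      rw [abs_le] at h5 h6
      linarith [mul_pos (pow_pos hq 2) hd]
    have h10 : t₂ - t₁ ≤ 2 * (q * √d) * √(t₂ - t₁) := by
      have := mul_le_mul_of_nonneg_right h9 (Real.sqrt_nonneg (t₂ - t₁))
      rwa [Real.mul_self_sqrt (by linarith)] at this
    have h11 := mul_le_mul_of_nonneg_left h10 (by positivity : 0 ≤ D * (2 * S / √d))
    have h12 : D * (2 * S / √d) * (2 * (q * √d) * √(t₂ - t₁)) =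
        4 * D * q * S * √(t₂ - t₁) := by field_simp; ring
    linarith
  have h1 := h.lower t ht x hx (q ^ 2 * d) _ (by positivity) (by linarith) (by positivity) hdrop
  have h2 : √(q ^ 2 * d) = q * √d := by rw [← hqd, Real.sqrt_sq (by positivity)]
  rw [h2] at h1
  refine le_trans (neg_le_neg ?_) h1
  have h3 : C * (4 * D * q * S) ≤ S / 2 / √d := by
    have h4 : C * (4 * D * q * S) ≤ S / 2 := by
      have := mul_le_mul_of_nonneg_right hqC hS
      linarith
    exact h4.trans (le_div_self (by positivity) hsd hsd1)
  have h5 : (C / q + S / 2) / √d = C * (1 / (q * √d)) + S / 2 / √d := by field_simp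
  rw [h5, mul_add]
  linarith

lemma exists_lower_of_ball (h : SelfBound T a β c C D) : ∃ L, 0 ≤ L ∧
    ∀ z₀ ∈ Icc 0 T ×ˢ Icc (0:ℝ) 1, ∀ r, 0 < r → r ≤ 1 →
      (∀ z ∈ Icc 0 T ×ˢ Icc (0:ℝ) 1, dist z z₀ < r → BddBelowNear T a z) →
        -(L / √r) ≤ a z₀.1 z₀.2 := by
  have hC := h.C_nonneg
  have hD := h.D_nonneg
  set q := 1 / (8 * C * D + 2) with hq
  have hq0 : 0 < q := by positivity
  have hCD : 0 ≤ 8 * C * D := by positivity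
  have hq1 : q ≤ 1 / 2 := one_div_le_one_div_of_le (by norm_num) (by linarith)
  have hqC : 8 * C * D * q ≤ 1 := by
    rw [hq, mul_one_div, div_le_one (by positivity)]; linarith
  set A := C / q with hA
  have hA0 : 0 ≤ A := by positivity
  refine ⟨4 * A, by positivity, ?_⟩
  intro z₀ hz₀ r hr hr1 hnear
  set R := Icc 0 T ×ˢ Icc (0:ℝ) 1 with hR
  have hRc : IsCompact R := isCompact_Icc.prod isCompact_Icc
  obtain ⟨Λ, hΛ0, hΛ⟩ := exists_lower_bound_of_isCompact
    (hRc.inter_right (Metric.isClosed_closedBall (x := z₀) (ε := r / 2))) inter_subset_left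
    (fun z hz => hnear z hz.1 (by
      have := Metric.mem_closedBall.1 hz.2
      linarith))
  have hit : ∀ n : ℕ, ∀ z ∈ R, 0 < r / 2 - dist z z₀ →
      -((2 * A + Λ * (1 / 2) ^ n) / √(r / 2 - dist z z₀)) ≤ a z.1 z.2 := by
    intro n
    induction n with
    | zero =>
      intro z hz hd
      have h1 := hΛ z ⟨hz, Metric.mem_closedBall.2 (by linarith)⟩
      have h2 : √(r / 2 - dist z z₀) ≤ 1 :=
        Real.sqrt_le_one.2 (by linarith [dist_nonneg (x := z) (y := z₀)])
      have h3 : 2 * A + Λ * (1 / 2) ^ 0 ≤ (2 * A + Λ * (1 / 2) ^ 0) / √(r / 2 - dist z z₀) :=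
        le_div_self (by positivity) (Real.sqrt_pos.2 hd) h2
      rw [pow_zero, mul_one] at h3 ⊢
      linarith
    | succ n ih =>
      have := h.lower_improve (by linarith) hq0 hq1 hqC (by positivity) ih
      have e : C / q + (2 * A + Λ * (1 / 2) ^ n) / 2 = 2 * A + Λ * (1 / 2) ^ (n + 1) := by
        rw [← hA]; ring
      rwa [e] at this
  have hlim : Tendsto (fun n : ℕ => -((2 * A + Λ * (1 / 2) ^ n) / √(r / 2))) atTop
      (𝓝 (-((2 * A + Λ * 0) / √(r / 2)))) :=
    (((((tendsto_pow_atTop_nhds_zero_of_lt_one (by norm_num) (by norm_num)).const_mul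
      Λ).const_add (2 * A)).div_const _)).neg
  have h1 : -((2 * A + Λ * 0) / √(r / 2)) ≤ a z₀.1 z₀.2 :=
    le_of_tendsto' hlim fun n => by simpa using hit n z₀ hz₀ (by simpa using hr)
  refine le_trans (neg_le_neg ?_) h1
  rw [mul_zero, add_zero]
  have hsr : 0 < √r := Real.sqrt_pos.2 hr
  have h2 : √r / 2 ≤ √(r / 2) := by
    refine Real.le_sqrt_of_sq_le ?_
    rw [div_pow, Real.sq_sqrt hr.le]; linarith
  have h3 : 2 * A / √(r / 2) ≤ 2 * A / (√r / 2) :=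
    div_le_div_of_nonneg_left (by positivity) (by positivity) h2
  have h4 : 2 * A / (√r / 2) = 4 * A / √r := by field_simp; ring
  linarith

end SelfBound

namespace SelfBound

variable {T C D : ℝ} {a β : ℝ → ℝ → ℝ} {c : ℝ → ℝ}

lemma exists_mem_arm_nat (h : SelfBound T a β c C D) {p : ℝ × ℝ}
    (hp : p ∈ Icc 0 T ×ˢ Icc (0:ℝ) 1) : ∃ N : ℕ, p ∈ Arm T β 0 0 N N := by
  obtain ⟨α, hα⟩ := h.deriv_space p.1 hp.1 p.2 hp.2
  obtain ⟨m₁, hm₁⟩ := exists_nat_gt |c p.1 * a p.1 p.2|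
  obtain ⟨m₂, hm₂⟩ := exists_nat_gt |α|
  obtain ⟨n₀, hn₀⟩ := exists_mem_arm (κ₁ := 0) (κ₂ := 0) (ε := max m₁ m₂) hp.1 hp.2
    (h.deriv_time p.1 hp.1 p.2 hp.2) hα (by rw [sub_zero]; exact lt_max_of_lt_left hm₁)
    (by rw [sub_zero]; exact lt_max_of_lt_right hm₂)
  obtain ⟨g0, g1, g2⟩ := hn₀ (max n₀ (max m₁ m₂)) (le_max_left _ _)
  have hle : max (m₁:ℝ) m₂ ≤ ((max n₀ (max m₁ m₂) : ℕ) : ℝ) := by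
    push_cast
    exact le_max_right _ _
  exact ⟨_, g0, fun s hs hd => (g1 s hs hd).trans
    (mul_le_mul_of_nonneg_right hle (abs_nonneg _)), fun y hy hd => (g2 y hy hd).trans
    (mul_le_mul_of_nonneg_right hle (abs_nonneg _))⟩

lemma drop_le_of_gap (h : SelfBound T a β c C D) {L s₁ s₂ x δ : ℝ} (hL : 0 ≤ L)
    (hball : ∀ z₀ ∈ Icc 0 T ×ˢ Icc (0:ℝ) 1, ∀ r, 0 < r → r ≤ 1 →
      (∀ z ∈ Icc 0 T ×ˢ Icc (0:ℝ) 1, dist z z₀ < r → BddBelowNear T a z) →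
        -(L / √r) ≤ a z₀.1 z₀.2)
    (h0 : 0 ≤ s₁) (h12 : s₁ ≤ s₂) (hT : s₂ ≤ T) (hx : x ∈ Icc (0:ℝ) 1) (hδ : s₂ - s₁ ≤ δ)
    (hδ1 : δ ≤ 1)
    (hgap : ∀ z ∈ Icc 0 T ×ˢ Icc (0:ℝ) 1, z.1 ∈ Ioo s₁ s₂ → |z.2 - x| ≤ δ →
      BddBelowNear T a z) :
    β s₁ x - β s₂ x ≤ 4 * D * L * √(s₂ - s₁) := by
  refine h.drop_le_sqrt h0 h12 hT hx hL fun s hs => ?_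
  have p1 := sub_pos.2 hs.1
  have p2 := sub_pos.2 hs.2
  have hr : 0 < min (s - s₁) (s₂ - s) := lt_min p1 p2
  have l1 := min_le_left (s - s₁) (s₂ - s)
  have l2 := min_le_right (s - s₁) (s₂ - s)
  have key := hball (s, x) ⟨⟨h0.trans hs.1.le, hs.2.le.trans hT⟩, hx⟩ _ hr (by linarith) (by
    intro z hz hd
    rw [Prod.dist_eq, Real.dist_eq, Real.dist_eq, max_lt_iff, abs_lt] at hd
    refine hgap z hz ⟨?_, ?_⟩ (hd.2.le.trans ?_)
    · simp only at hd; linarith [hd.1.1]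
    · simp only at hd; linarith [hd.1.2]
    · linarith)
  refine le_trans (neg_le_neg ?_) key
  rw [div_eq_mul_one_div]
  refine mul_le_mul_of_nonneg_left ?_ hL
  rcases min_choice (s - s₁) (s₂ - s) with e | e <;> rw [e]
  · have : 0 ≤ 1 / √(s₂ - s) := by positivity
    linarith
  · have : 0 ≤ 1 / √(s - s₁) := by positivity
    linarith

lemma drop_le_of_arm (h : SelfBound T a β c C D) {L r t₁ t₂ x : ℝ} {N : ℕ} {p₀ : ℝ × ℝ}
    (hL : 0 ≤ L)
    (hball : ∀ z₀ ∈ Icc 0 T ×ˢ Icc (0:ℝ) 1, ∀ r, 0 < r → r ≤ 1 →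
      (∀ z ∈ Icc 0 T ×ˢ Icc (0:ℝ) 1, dist z z₀ < r → BddBelowNear T a z) →
        -(L / √r) ≤ a z₀.1 z₀.2)
    (hr1 : 2 * r ≤ 1) (hrN : 4 * r < 1 / (N + 1))
    (harm : ∀ p ∈ Icc 0 T ×ˢ Icc (0:ℝ) 1, ¬ BddBelowNear T a p → dist p p₀ < 4 * r →
      p ∈ Arm T β 0 0 N N)
    (h0 : 0 ≤ t₁) (h12 : t₁ < t₂) (hT : t₂ ≤ T) (hx : x ∈ Icc (0:ℝ) 1)
    (ht₁ : |t₁ - p₀.1| ≤ r) (ht₂ : |t₂ - p₀.1| ≤ r) (hxr : |x - p₀.2| ≤ r) :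
    β t₁ x - β t₂ x ≤ (8 * D * L + 5 * N) * √(t₂ - t₁) := by
  have hD := h.D_nonneg
  set δ := t₂ - t₁ with hδ
  have hδ0 : 0 < δ := by rw [hδ]; linarith
  rw [abs_le] at ht₁ ht₂
  have hδr : δ ≤ 2 * r := by linarith
  have hr0 : 0 < r := by linarith
  have hsq : δ ≤ √δ := Real.le_sqrt_of_sq_le (by nlinarith)
  have hDL : 0 ≤ 4 * D * L := by positivity
  set Q := {z ∈ Icc 0 T ×ˢ Icc (0:ℝ) 1 | ¬ BddBelowNear T a z} ∩
    (Icc t₁ t₂ ×ˢ Metric.closedBall x δ) with hQ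
  have hQc : IsCompact Q := (isCompact_not_bddBelowNear T a).inter_right
    (isClosed_Icc.prod Metric.isClosed_closedBall)
  have hgapQ : ∀ z ∈ Icc 0 T ×ˢ Icc (0:ℝ) 1, z.1 ∈ Icc t₁ t₂ → |z.2 - x| ≤ δ → z ∉ Q →
      BddBelowNear T a z := by
    intro z hz h1 h2 h3
    by_contra hcon
    exact h3 ⟨⟨hz, hcon⟩, h1, by rwa [Metric.mem_closedBall, Real.dist_eq]⟩
  rcases Q.eq_empty_or_nonempty with hQe | hQn
  · have := h.drop_le_of_gap hL hball h0 h12.le hT hx le_rfl (by linarith) (fun z hz h1 h2 =>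
      hgapQ z hz (Ioo_subset_Icc_self h1) h2 (by rw [hQe]; simp))
    have h2 : 0 ≤ (4 * D * L + 5 * N) * √δ := by positivity
    linarith
  obtain ⟨p, hp, hpmin⟩ := hQc.exists_isMinOn hQn continuous_fst.continuousOn
  obtain ⟨q, hq, hqmax⟩ := hQc.exists_isMaxOn hQn continuous_fst.continuousOn
  have hmem : ∀ z ∈ Q, z ∈ Arm T β 0 0 N N ∧ |z.2 - x| ≤ δ := by
    intro z hz
    have h2 := hz.2.2
    rw [Metric.mem_closedBall, Real.dist_eq] at h2
    refine ⟨harm z hz.1.1 hz.1.2 ?_, h2⟩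
    rw [Prod.dist_eq, Real.dist_eq, Real.dist_eq, max_lt_iff, abs_lt, abs_lt]
    rw [abs_le] at h2 hxr
    have h3 := hz.2.1
    refine ⟨⟨?_, ?_⟩, ?_, ?_⟩ <;> linarith [h3.1, h3.2]
  obtain ⟨hpA, hpx⟩ := hmem p hp
  obtain ⟨hqA, hqx⟩ := hmem q hq
  have hpq : p.1 ≤ q.1 := hpmin hq
  have hp1 := hp.2.1
  have hq1 := hq.2.1
  have o1 := h.drop_le_of_gap (s₁ := t₁) (s₂ := p.1) (δ := δ) hL hball h0 hp1.1
    (hp1.2.trans hT) hx (by linarith [hp1.2]) (by linarith) (fun z hz h1 h2 =>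
      hgapQ z hz ⟨h1.1.le, h1.2.le.trans hp1.2⟩ h2 (fun hzQ => by
        have : p.1 ≤ z.1 := hpmin hzQ
        linarith [h1.2]))
  have o2 := h.drop_le_of_gap (s₁ := q.1) (s₂ := t₂) (δ := δ) hL hball (h0.trans hq1.1) hq1.2
    hT hx (by linarith [hq1.1]) (by linarith) (fun z hz h1 h2 =>
      hgapQ z hz ⟨hq1.1.trans h1.1.le, h1.2.le⟩ h2 (fun hzQ => by
        have : z.1 ≤ q.1 := hqmax hzQ
        linarith [h1.1]))
  have e1 : √(p.1 - t₁) ≤ √δ := Real.sqrt_le_sqrt (by linarith [hp1.2])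
  have e2 : √(t₂ - q.1) ≤ √δ := Real.sqrt_le_sqrt (by linarith [hq1.1])
  have e3 := mul_le_mul_of_nonneg_left e1 hDL
  have e4 := mul_le_mul_of_nonneg_left e2 hDL
  have hN : (0:ℝ) ≤ N := Nat.cast_nonneg N
  have est : ∀ {u v k : ℝ}, |v| ≤ k → |u| ≤ (N:ℝ) * |v| → |u| ≤ N * k := fun h1 h2 =>
    h2.trans (mul_le_mul_of_nonneg_left h1 hN)
  have hpx' : |x - p.2| ≤ δ := by rwa [abs_sub_comm]
  have hqx' : |x - q.2| ≤ δ := by rwa [abs_sub_comm]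
  have hqt : |q.1 - p.1| ≤ δ := by rw [abs_of_nonneg (by linarith)]; linarith [hp1.1, hq1.2]
  have hpq2 : |p.2 - q.2| ≤ 2 * δ := by
    rw [abs_le] at hpx hqx ⊢
    constructor <;> linarith
  have a1 := est hpx' (by simpa using hpA.2.2 x hx (by linarith))
  have a2 := est hqt (by simpa using hpA.2.1 q.1 hqA.1.1 (by linarith))
  have a3 := est hpq2 (by simpa using hqA.2.2 p.2 hpA.1.2 (by linarith))
  have a4 := est hqx' (by simpa using hqA.2.2 x hx (by linarith))
  rw [abs_le] at a1 a2 a3 a4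
  have e5 := mul_le_mul_of_nonneg_left hsq hN
  linarith [a1.2, a2.1, a3.2, a4.1]

theorem exists_lower (h : SelfBound T a β c C D) : ∃ Λ, 0 ≤ Λ ∧
    ∀ t ∈ Icc 0 T, ∀ x ∈ Icc (0:ℝ) 1, -Λ ≤ a t x := by
  have hC := h.C_nonneg
  have hD := h.D_nonneg
  obtain ⟨L, hL, hball⟩ := h.exists_lower_of_ball
  set P := {z ∈ Icc 0 T ×ˢ Icc (0:ℝ) 1 | ¬ BddBelowNear T a z} with hP
  have hPc : IsCompact P := isCompact_not_bddBelowNear T a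
  rcases P.eq_empty_or_nonempty with hPe | hPn
  · obtain ⟨Λ, hΛ0, hΛ⟩ := exists_lower_bound_of_isCompact
      (isCompact_Icc.prod isCompact_Icc : IsCompact (Icc 0 T ×ˢ Icc (0:ℝ) 1)) Subset.rfl
      (a := a) fun z hz => by
        by_contra hcon
        have : z ∈ P := ⟨hz, hcon⟩
        rw [hPe] at this
        exact this
    exact ⟨Λ, hΛ0, fun t ht x hx => hΛ (t, x) ⟨ht, hx⟩⟩
  exfalso
  obtain ⟨N, p₀, hp₀, r, hr, hsub⟩ := baire_portion hPc hPn
    (fun N : ℕ => isClosed_arm h.sep 0 0 N N)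
    (fun p hp => mem_iUnion.2 (h.exists_mem_arm_nat hp.1))
  set ρ := min (r / 4) (min (1 / 2) (1 / (8 * (N + 1)))) with hρ
  have hρ0 : 0 < ρ := by positivity
  have hρr : 4 * ρ ≤ r := by
    have := min_le_left (r / 4) (min (1 / 2) (1 / (8 * ((N:ℝ) + 1))))
    linarith
  have hρ1 : 2 * ρ ≤ 1 := by
    have := (min_le_right (r / 4) (min (1 / 2) (1 / (8 * ((N:ℝ) + 1))))).trans (min_le_left _ _)
    linarith
  have hρN : 4 * ρ < 1 / (N + 1) := by
    have h1 := (min_le_right (r / 4) (min (1 / 2) (1 / (8 * ((N:ℝ) + 1))))).trans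
      (min_le_right _ _)
    have h2 : 1 / (8 * ((N:ℝ) + 1)) = 1 / (N + 1) / 8 := by field_simp
    have h3 : 0 < 1 / ((N:ℝ) + 1) := by positivity
    linarith
  set K := 8 * D * L + 5 * N with hK
  have hK0 : 0 ≤ K := by positivity
  refine hp₀.2 ⟨C * (K + 1 / √(ρ / 2)), ?_⟩
  rw [eventually_nhdsWithin_iff]
  filter_upwards [Metric.ball_mem_nhds p₀ (half_pos hρ0)] with z hz hzR
  rw [Metric.mem_ball, Prod.dist_eq, Real.dist_eq, Real.dist_eq, max_lt_iff, abs_lt,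
    abs_lt] at hz
  refine h.lower z.1 hzR.1 z.2 hzR.2 (ρ / 2) K (half_pos hρ0) (by linarith) hK0 ?_
  intro t₁ t₂ x h1 h2 h3 h4 h5 h6 h7
  rcases h2.eq_or_lt with h8 | h8
  · rw [h8]; simp
  rw [abs_le] at h5 h6 h7
  refine h.drop_le_of_arm (r := ρ) (p₀ := p₀) hL hball hρ1 hρN (fun p hp hp' hd =>
    hsub ⟨⟨hp, hp'⟩, Metric.mem_ball.2 (hd.trans_le hρr)⟩) h1 h8 h3 h4 ?_ ?_ ?_ <;>
  · rw [abs_le]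
    constructor <;> linarith [hz.1.1, hz.1.2, hz.2.1, hz.2.2]

end SelfBound

lemma legVal_add_time (w : ℝ → ℝ → ℝ) (q : ℝ → ℝ) (c t y₀ X : ℝ) :
    legVal (fun t x => w t x + q t) c t y₀ X = legVal w c t y₀ X +
      (q (t - min y₀ (c * t) / c) - q (t - min X (c * t) / c)) := by
  unfold legVal
  ring

/-- If `b + q` is nondecreasing in time, then the increments of `w` along characteristics are
bounded below by those of `-q`. -/
lemma Transports.legVal_ge {T c : ℝ} {w b : ℝ → ℝ → ℝ} {q : ℝ → ℝ} (h : Transports T c w b)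
    (hw : SepBdd w) (hb : SepBdd b) (hq : Continuous q) (hqb : ∃ C, ∀ t, |q t| ≤ C)
    (hqd : ∀ t ∈ Icc 0 T, ∃ α, HasDerivWithinAt q α (Icc 0 T) t) (hc : 0 < c) {t y₀ X : ℝ}
    (htT : t < T) (hy₀ : 0 ≤ y₀) (hX : y₀ ≤ X) (hX1 : X - y₀ ≤ 1)
    (hmono : ∀ x ∈ Icc (0:ℝ) 1, ∀ s₁ ∈ Icc 0 T, ∀ s₂ ∈ Icc 0 T, s₁ ≤ s₂ →
      b s₁ x + q s₁ ≤ b s₂ x + q s₂) :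
    q (t - min X (c * t) / c) - q (t - min y₀ (c * t) / c) ≤ legVal w c t y₀ X := by
  have sep : ∀ {f : ℝ → ℝ → ℝ}, SepBdd f → SepBdd fun t x => f t x + q t := fun {f} hf => by
    obtain ⟨C₁, hC₁⟩ := hf.bdd
    obtain ⟨C₂, hC₂⟩ := hqb
    exact ⟨fun x => (hf.contL x).add hq, fun t => (hf.contR t).add continuous_const,
      C₁ + C₂, fun t x => (abs_add_le _ _).trans (add_le_add (hC₁ t x) (hC₂ t))⟩
  have htr : Transports T c (fun t x => w t x + q t) fun t x => b t x + q t := by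
    intro s hs x hx
    obtain ⟨α₁, α₂, β₁, β₂, h0, d1, d2, d3, d4⟩ := h s hs x hx
    obtain ⟨α, hα⟩ := hqd s hs
    exact ⟨α₁ + α, α₂, β₁ + α, β₂, by linarith, d1.add hα, d2.add_const _, d3.add hα,
      d4.add_const _⟩
  have := htr.legVal_nonneg (sep hw) (sep hb) hc htT hy₀ hX hX1 hmono
  rw [legVal_add_time] at this
  linarith

namespace PosSetting

variable {T B : ℝ} {η : ℝ → ℝ} {G : ℝ → ℝ → ℝ → ℝ → ℝ}

lemma exists_energy_lower (h : PosSetting T B η G) : ∃ Λ, 0 ≤ Λ ∧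
    ∀ t ∈ Icc 0 T, ∀ x ∈ Icc (0:ℝ) 1, -Λ ≤ energy G t x := by
  obtain ⟨C, hC, hlow⟩ := h.exists_energy_ge
  have hM := Mw_pos one_pos
  refine SelfBound.exists_lower (β := expSol T G 0 1) (c := fun t => Real.exp t * Mw 1) (C := C)
    (D := Real.exp T * Mw 1) ⟨hC, by positivity, h.sepBdd_expSol (by norm_num) one_pos,
      fun t ht => ⟨by positivity, ?_⟩, fun t ht x hx => ?_, fun t ht x hx =>
      ⟨_, h.hasDerivWithinAt_expSol_right (by norm_num) one_pos ht hx⟩, hlow⟩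
  · exact mul_le_mul_of_nonneg_right (Real.exp_le_exp.2 ht.2) hM.le
  · refine (h.hasDerivWithinAt_expSol_zero one_pos ht hx).congr_deriv ?_
    rw [one_mul, mul_assoc]

lemma ge_of_energy_ge_of_lt (h : PosSetting T B η G) {Λ : ℝ} (hΛ : 0 ≤ Λ)
    (ha : ∀ t ∈ Icc 0 T, ∀ x ∈ Icc (0:ℝ) 1, -Λ ≤ energy G t x) {t x μ ω : ℝ} (ht : 0 ≤ t)
    (htT : t < T) (hx : x ∈ Icc (0:ℝ) 1) (hμ : μ ∈ Icc (-1:ℝ) 1) (hω : 0 < ω) :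
    -(Mw ω * Λ / ω * (Real.exp (ω * t) - 1)) ≤ Real.exp (ω * t) * G t x μ ω := by
  have hT := h.T_pos
  have hMω := Mw_pos hω
  set k := Mw ω * Λ / ω with hk
  have hk0 : 0 ≤ k := by positivity
  set q : ℝ → ℝ := fun s => k * Real.exp (ω * clampTo T s) with hq
  have hqmem : ∀ s ∈ Icc 0 T, q s = k * Real.exp (ω * s) := fun s hs => by
    simp only [hq]; rw [clampTo_of_mem hs]
  have hqc : Continuous q := by have := continuous_clampTo T; fun_prop
  have hqb : ∃ C, ∀ s, |q s| ≤ C := ⟨k * Real.exp (ω * T), fun s => by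
    rw [abs_of_nonneg (by positivity)]
    exact mul_le_mul_of_nonneg_left (Real.exp_le_exp.2
      (mul_le_mul_of_nonneg_left (clampTo_mem hT.le s).2 hω.le)) hk0⟩
  have hqd : ∀ s ∈ Icc 0 T, HasDerivWithinAt q (k * (Real.exp (ω * s) * (ω * 1))) (Icc 0 T) s :=
    fun s hs => ((((hasDerivAt_id s).const_mul ω).exp).const_mul k).hasDerivWithinAt.congr
      hqmem (hqmem s hs)
  have hq1 : ∀ s, k ≤ q s := fun s => le_mul_of_one_le_right hk0
    (Real.one_le_exp (mul_nonneg hω.le (clampTo_mem hT.le s).1))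
  have hmono : ∀ x ∈ Icc (0:ℝ) 1, ∀ s₁ ∈ Icc 0 T, ∀ s₂ ∈ Icc 0 T, s₁ ≤ s₂ →
      expSol T G 0 ω s₁ x + q s₁ ≤ expSol T G 0 ω s₂ x + q s₂ := by
    intro x hx s₁ h1 s₂ h2 h12
    have hd : ∀ s ∈ Icc 0 T, HasDerivWithinAt (fun s => expSol T G 0 ω s x + q s)
        (Real.exp (ω * s) * (Mw ω * energy G s x) + k * (Real.exp (ω * s) * (ω * 1)))
        (Icc 0 T) s := fun s hs => (h.hasDerivWithinAt_expSol_zero hω hs hx).add (hqd s hs)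
    refine monotoneOn_of_hasDerivWithinAt_nonneg (convex_Icc _ _)
      (fun s hs => (hd s hs).continuousWithinAt)
      (fun s hs => (hd s (interior_subset hs)).mono interior_subset) (fun s hs => ?_) h1 h2 h12
    have h3 := ha s (interior_subset hs) x hx
    have h4 : Real.exp (ω * s) * (Mw ω * energy G s x) + k * (Real.exp (ω * s) * (ω * 1)) =
        Real.exp (ω * s) * Mw ω * (energy G s x + Λ) := by
      rw [hk]; field_simp
    rw [h4]
    exact mul_nonneg (by positivity) (by linarith)
  have htm : t ∈ Icc 0 T := ⟨ht, htT.le⟩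
  have hqt := hqmem t htm
  rcases lt_trichotomy μ 0 with hμ0 | rfl | hμ0
  · have hν : -μ ∈ Ioc (0:ℝ) 1 := ⟨by linarith, by linarith [hμ.1]⟩
    have hc : 0 < -μ * ω := mul_pos hν.1 hω
    have hx' : 0 ≤ 1 - x := by linarith [hx.2]
    have l1 := (Transports.reflect (c := -μ * ω) (by
      rw [neg_mul, neg_neg]; exact h.transports hμ hω)).legVal_ge
        (h.sepBdd_expSol hμ hω).reflect (h.sepBdd_expSol (by norm_num) hω).reflect hqc hqb
        (fun s hs => ⟨_, hqd s hs⟩) hc htT le_rfl hx' (by linarith [hx.1]) (fun y hy =>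
          hmono (1 - y) ⟨by linarith [hy.2], by linarith [hy.1]⟩)
    have l2 := (h.transports (μ := -μ) ⟨by linarith [hν.1], hν.2⟩ hω).legVal_ge (y₀ := 1 - x)
      (X := 2 - x) (h.sepBdd_expSol ⟨by linarith [hν.1], hν.2⟩ hω)
      (h.sepBdd_expSol (by norm_num) hω) hqc hqb (fun s hs => ⟨_, hqd s hs⟩) hc htT hx'
      (by linarith) (by linarith) hmono
    have l3 := h.legVal_reflect_le hν hω htm hx
    rw [neg_neg] at l3
    have hct : 0 ≤ -μ * ω * t := mul_nonneg hc.le ht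
    rw [min_eq_left hct, zero_div, sub_zero, hqt] at l1
    set s₁ := t - min (1 - x) (-μ * ω * t) / (-μ * ω) with hs₁
    set s₂ := t - min (2 - x) (-μ * ω * t) / (-μ * ω) with hs₂
    have h21 : s₂ ≤ s₁ := by
      rw [hs₁, hs₂]
      exact sub_le_sub_left (div_le_div_of_nonneg_right
        (min_le_min_right _ (by linarith)) hc.le) _
    have hqm : q s₂ ≤ q s₁ := by
      refine mul_le_mul_of_nonneg_left (Real.exp_le_exp.2
        (mul_le_mul_of_nonneg_left ?_ hω.le)) hk0
      exact max_le_max_left _ (min_le_min_right _ h21)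
    have l4 := mul_le_mul_of_nonneg_left l2 (h.eta_nonneg ω hω)
    have l5 := mul_le_mul_of_nonneg_right (h.eta_le ω hω) (sub_nonneg.2 hqm)
    linarith [hq1 s₂]
  · have := hmono x hx 0 ⟨le_rfl, hT.le⟩ t htm ht
    have h0 := h.init x hx 0 hμ ω hω
    rw [expSol_of_mem ⟨le_rfl, hT.le⟩ hx, expSol_of_mem htm hx, hqt,
      mul_zero, Real.exp_zero, one_mul] at this
    linarith [hq1 0]
  · have hν : μ ∈ Ioc (0:ℝ) 1 := ⟨hμ0, hμ.2⟩
    have hc : 0 < μ * ω := mul_pos hμ0 hω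
    have l1 := (h.transports hμ hω).legVal_ge (y₀ := 0) (X := x) (h.sepBdd_expSol hμ hω)
      (h.sepBdd_expSol (by norm_num) hω) hqc hqb (fun s hs => ⟨_, hqd s hs⟩) hc htT le_rfl
      hx.1 (by linarith [hx.2]) hmono
    rw [min_eq_left (mul_nonneg hc.le ht), zero_div, sub_zero, hqt] at l1
    have := h.legVal_le hν hω htm hx
    linarith [hq1 (t - min x (μ * ω * t) / (μ * ω))]

lemma ge_of_energy_ge (h : PosSetting T B η G) {Λ : ℝ} (hΛ : 0 ≤ Λ)
    (ha : ∀ t ∈ Icc 0 T, ∀ x ∈ Icc (0:ℝ) 1, -Λ ≤ energy G t x) {t x μ ω : ℝ} (ht : t ∈ Icc 0 T)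
    (hx : x ∈ Icc (0:ℝ) 1) (hμ : μ ∈ Icc (-1:ℝ) 1) (hω : 0 < ω) :
    -(Mw ω * Λ / ω * (1 - Real.exp (-(ω * T)))) ≤ G t x μ ω := by
  have hMω := Mw_pos hω
  have hlt : ∀ s ∈ Ico 0 T, -(Mw ω * Λ / ω * (1 - Real.exp (-(ω * T)))) ≤ G s x μ ω := by
    intro s hs
    have h1 := h.ge_of_energy_ge_of_lt hΛ ha hs.1 hs.2 hx hμ hω
    have h2 := mul_le_mul_of_nonneg_left h1 (Real.exp_pos (-(ω * s))).le
    have h3 : Real.exp (-(ω * s)) * Real.exp (ω * s) = 1 := by rw [← Real.exp_add]; simp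
    have h4 : Real.exp (-(ω * s)) * -(Mw ω * Λ / ω * (Real.exp (ω * s) - 1)) =
        -(Mw ω * Λ / ω * (Real.exp (-(ω * s)) * Real.exp (ω * s) - Real.exp (-(ω * s)))) := by
      ring
    rw [h4, h3, ← mul_assoc, h3, one_mul] at h2
    refine le_trans (neg_le_neg (mul_le_mul_of_nonneg_left ?_ (by positivity))) h2
    have : Real.exp (-(ω * T)) ≤ Real.exp (-(ω * s)) :=
      Real.exp_le_exp.2 (neg_le_neg (mul_le_mul_of_nonneg_left hs.2.le hω.le))
    linarith
  rcases ht.2.lt_or_eq with h1 | h1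
  · exact hlt t ⟨ht.1, h1⟩
  · have hlim : Tendsto (fun s => G s x μ ω) (𝓝[<] t) (𝓝 (G t x μ ω)) :=
      (h.pde t ht x hx μ hμ ω hω).1.continuousAt.continuousWithinAt
    refine ge_of_tendsto hlim ?_
    rw [h1]
    filter_upwards [Ioo_mem_nhdsLT h.T_pos] with s hs using hlt s ⟨hs.1.le, hs.2⟩

lemma energy_ge_mul (h : PosSetting T B η G) {Λ : ℝ} (hΛ : 0 ≤ Λ)
    (ha : ∀ t ∈ Icc 0 T, ∀ x ∈ Icc (0:ℝ) 1, -Λ ≤ energy G t x) {t x : ℝ} (ht : t ∈ Icc 0 T)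
    (hx : x ∈ Icc (0:ℝ) 1) :
    -(2 * (∫ ω in Ioi (0:ℝ), Mw ω * (1 - Real.exp (-(ω * T)))) * Λ) ≤ energy G t x := by
  have hi : IntegrableOn (fun ω => Mw ω * (1 - Real.exp (-(ω * T)))) (Ioi 0) := by
    refine integrableOn_Mw.mul_bdd (c := 1) (by fun_prop) ?_
    refine (ae_restrict_iff' measurableSet_Ioi).2 (ae_of_all _ fun ω hω => ?_)
    have hωT : 0 ≤ ω * T := mul_nonneg (le_of_lt hω) h.T_pos.le
    have h1 : Real.exp (-(ω * T)) ≤ 1 := Real.exp_le_one_iff.2 (by linarith)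
    rw [Real.norm_eq_abs, abs_le]
    constructor <;> linarith [Real.exp_pos (-(ω * T))]
  have hlow := setIntegral_mono_on (hi.const_mul (-(2 * Λ))) (h.integrableOn_energy ht hx)
    measurableSet_Ioi (fun ω hω => by
      have hω0 : 0 < ω := hω
      have h1 := setIntegral_mono_on continuous_const.integrableOn_Icc
        (h.integrableOn_dir hω ht hx) measurableSet_Icc
        (fun μ hμ => h.ge_of_energy_ge hΛ ha ht hx hμ hω)
      rw [setIntegral_const, Real.volume_real_Icc_of_le (by norm_num)] at h1
      have h2 := mul_le_mul_of_nonneg_left h1 hω0.le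
      refine le_trans (le_of_eq ?_) h2
      rw [smul_eq_mul]
      field_simp
      ring)
  rw [integral_const_mul, ← energy_eq] at hlow
  linarith

lemma contraction_lt_one (hT : 0 < T) :
    0 ≤ 2 * (∫ ω in Ioi (0:ℝ), Mw ω * (1 - Real.exp (-(ω * T)))) ∧
      2 * (∫ ω in Ioi (0:ℝ), Mw ω * (1 - Real.exp (-(ω * T)))) < 1 := by
  have hexp : ∀ ω ∈ Ioi (0:ℝ), Real.exp (-(ω * T)) ≤ 1 := fun ω hω =>
    Real.exp_le_one_iff.2 (neg_nonpos.2 (mul_nonneg (le_of_lt hω) hT.le))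
  have hi : IntegrableOn (fun ω => Mw ω * Real.exp (-(ω * T))) (Ioi 0) := by
    refine integrableOn_Mw.mul_bdd (c := 1) (by fun_prop) ?_
    refine (ae_restrict_iff' measurableSet_Ioi).2 (ae_of_all _ fun ω hω => ?_)
    rw [Real.norm_eq_abs, abs_of_pos (Real.exp_pos _)]
    exact hexp ω hω
  have hpos : 0 < ∫ ω in Ioi (0:ℝ), Mw ω * Real.exp (-(ω * T)) := by
    refine (setIntegral_pos_iff_support_of_nonneg_ae ?_ hi).2 ?_
    · exact (ae_restrict_iff' measurableSet_Ioi).2 (ae_of_all _ fun ω hω =>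
        mul_nonneg (Mw_pos hω).le (Real.exp_pos _).le)
    · have : Ioi (0:ℝ) ⊆ Function.support fun ω => Mw ω * Real.exp (-(ω * T)) := fun ω hω =>
        (mul_pos (Mw_pos hω) (Real.exp_pos _)).ne'
      rw [inter_eq_self_of_subset_right this]
      simp
  have he : ∫ ω in Ioi (0:ℝ), Mw ω * (1 - Real.exp (-(ω * T))) =
      1 / 2 - ∫ ω in Ioi (0:ℝ), Mw ω * Real.exp (-(ω * T)) := by
    rw [← integral_Mw, ← integral_sub integrableOn_Mw hi]
    simp_rw [mul_sub, mul_one]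
  refine ⟨mul_nonneg zero_le_two (setIntegral_nonneg measurableSet_Ioi fun ω hω =>
    mul_nonneg (Mw_pos hω).le (sub_nonneg.2 (hexp ω hω))), ?_⟩
  rw [he]
  linarith

lemma energy_nonneg (h : PosSetting T B η G) {t x : ℝ} (ht : t ∈ Icc 0 T)
    (hx : x ∈ Icc (0:ℝ) 1) : 0 ≤ energy G t x := by
  obtain ⟨Λ, hΛ, hlow⟩ := h.exists_energy_lower
  obtain ⟨h0, h1⟩ := contraction_lt_one h.T_pos
  set r := 2 * (∫ ω in Ioi (0:ℝ), Mw ω * (1 - Real.exp (-(ω * T)))) with hr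
  have hit : ∀ n : ℕ, ∀ t ∈ Icc 0 T, ∀ x ∈ Icc (0:ℝ) 1, -(r ^ n * Λ) ≤ energy G t x := by
    intro n
    induction n with
    | zero => simpa using hlow
    | succ n ih =>
      intro t ht x hx
      have := h.energy_ge_mul (by positivity) ih ht hx
      rwa [← hr, ← mul_assoc, ← pow_succ'] at this
  have hlim := ((tendsto_pow_atTop_nhds_zero_of_lt_one h0 h1).mul_const Λ).neg
  rw [zero_mul, neg_zero] at hlim
  exact le_of_tendsto' hlim fun n => hit n t ht x hx

theorem nonneg (h : PosSetting T B η G) {t x μ ω : ℝ} (ht : t ∈ Icc 0 T)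
    (hx : x ∈ Icc (0:ℝ) 1) (hμ : μ ∈ Icc (-1:ℝ) 1) (hω : 0 < ω) : 0 ≤ G t x μ ω := by
  have := h.ge_of_energy_ge le_rfl (fun t ht x hx => by
    rw [neg_zero]; exact h.energy_nonneg ht hx) ht hx hμ hω
  simpa using this

end PosSetting

/-- Positivity preservation: if `η : (0,∞) → [0,1]`, the incoming datum `φ`
at `x = 0` is bounded and nonnegative, the boundary source `S ≥ 0`, the
initial data is nonnegative, and `G` is a bounded solution of the linearized
phonon transport equation with `G(t,1,μ,ω) = η(ω) G(t,1,−μ,ω) + S(t,μ,ω)`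
for `μ < 0`, then `G ≥ 0` on the whole domain. -/
theorem positivity_preservation (Tmax : ℝ) (hT : 0 < Tmax)
    (η : ℝ → ℝ) (φ : ℝ → ℝ → ℝ → ℝ) (S : ℝ → ℝ → ℝ → ℝ) (G : ℝ → ℝ → ℝ → ℝ → ℝ)
    (hη : ∀ ω ∈ Ioi (0:ℝ), η ω ∈ Icc (0:ℝ) 1)
    (hφbdd : ∃ Cφ, ∀ t μ ω, |φ t μ ω| ≤ Cφ)
    (hφpos : ∀ t ∈ Icc (0:ℝ) Tmax, ∀ μ ∈ Ioc (0:ℝ) 1, ∀ ω ∈ Ioi (0:ℝ), 0 ≤ φ t μ ω)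
    (hS : ∀ t ∈ Icc (0:ℝ) Tmax, ∀ μ ∈ Ico (-1:ℝ) 0, ∀ ω ∈ Ioi (0:ℝ), 0 ≤ S t μ ω)
    (hb : BoundedFn G)
    (hi : BracketIntegrableSol Tmax G)
    (hpde : SatisfiesPTE Tmax G)
    (hinit : ∀ x ∈ Icc (0:ℝ) 1, ∀ μ ∈ Icc (-1:ℝ) 1, ∀ ω ∈ Ioi (0:ℝ), 0 ≤ G 0 x μ ω)
    (hin : ∀ t ∈ Icc (0:ℝ) Tmax, ∀ μ ∈ Ioc (0:ℝ) 1, ∀ ω ∈ Ioi (0:ℝ), G t 0 μ ω = φ t μ ω)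
    (hrefl : ∀ t ∈ Icc (0:ℝ) Tmax, ∀ μ ∈ Ico (-1:ℝ) 0, ∀ ω ∈ Ioi (0:ℝ),
      G t 1 μ ω = η ω * G t 1 (-μ) ω + S t μ ω) :
    ∀ t ∈ Icc (0:ℝ) Tmax, ∀ x ∈ Icc (0:ℝ) 1, ∀ μ ∈ Icc (-1:ℝ) 1, ∀ ω ∈ Ioi (0:ℝ),
      0 ≤ G t x μ ω := by
  obtain ⟨B, hB⟩ := hb
  have hs : PosSetting Tmax B η G :=
    { T_pos := hT
      B_nonneg := (abs_nonneg _).trans (hB 0 0 0 0)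
      bdd := hB
      eta_nonneg := fun ω hω => (hη ω hω).1
      eta_le := fun ω hω => (hη ω hω).2
      integrable := hi
      pde := hpde
      init := hinit
      inflow := fun t ht μ hμ ω hω => (hφpos t ht μ hμ ω hω).trans_eq (hin t ht μ hμ ω hω).symm
      refl := fun t ht μ hμ ω hω => by
        have hμ' : -μ ∈ Ico (-1:ℝ) 0 := ⟨by linarith [hμ.2], by linarith [hμ.1]⟩
        have h1 := hrefl t ht (-μ) hμ' ω hω
        rw [neg_neg] at h1
        linarith [hS t ht (-μ) hμ' ω hω] }
  exact fun t ht x hx μ hμ ω hω => hs.nonneg ht hx hμ hω
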